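/- arXiv:1908.06928 — 6 statements merged into one kernel-verified Lean document; each statement's English description precedes it below -/
import Mathlib

section
/- Let G be a group, Z a subgroup of the center of G, and χ : Z → ℂ a group homomorphism taking values in the unit circle. Then the trivial extension χ̃ : G → ℂ of χ, defined by χ̃ = χ on Z and χ̃ = 0 on G ∖ Z, is a normalized function of positive type on G which is constant on conjugacy classes. -/
open scoped ComplexOrder

/-- A function `φ : G → ℂ` is of positive type if for all `g_1, …, g_n ∈ G` and
`c_1, …, c_n ∈ ℂ`, the number `∑_{i,j} conj(c_i)·c_j·φ(g_i⁻¹·g_j)` is a nonnegative real. -/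
def IsPositiveType {G : Type*} [Group G] (φ : G → ℂ) : Prop :=
  ∀ (n : ℕ) (g : Fin n → G) (c : Fin n → ℂ),
    0 ≤ ∑ i, ∑ j, (starRingEnd ℂ) (c i) * c j * φ ((g i)⁻¹ * g j)

theorem stmt_7 {G : Type*} [Group G] (Z : Subgroup G) (hZ : Z ≤ Subgroup.center G)
    (χ : Z →* Circle) (χext : G → ℂ)
    (hext_in : ∀ g (hg : g ∈ Z), χext g = (χ ⟨g, hg⟩ : ℂ))
    (hext_out : ∀ g ∉ Z, χext g = 0) :
    IsPositiveType χext ∧ χext 1 = 1 ∧ ∀ x g : G, χext (g * x * g⁻¹) = χext x := by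
  classical
  have hone : χext 1 = 1 := by
    rw [hext_in 1 Z.one_mem]
    have : (⟨1, Z.one_mem⟩ : Z) = 1 := rfl
    rw [this, map_one, Circle.coe_one]
  refine ⟨?_, hone, ?_⟩
  · intro n g c
    let q : Fin n → G ⧸ Z := fun i => (g i : G ⧸ Z)
    let r : Fin n → G := fun i => (q i).out
    have hr : ∀ i, (r i)⁻¹ * g i ∈ Z := fun i =>
      QuotientGroup.eq.1 (Quotient.out_eq' (q i))
    let a : Fin n → ℂ := fun i => c i * (χ ⟨(r i)⁻¹ * g i, hr i⟩ : ℂ)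
    let S : Finset (G ⧸ Z) := Finset.univ.image q
    let b : G ⧸ Z → Fin n → ℂ := fun p i => if q i = p then a i else 0
    have key : ∀ i j, (starRingEnd ℂ) (c i) * c j * χext ((g i)⁻¹ * g j)
        = ∑ p ∈ S, (starRingEnd ℂ) (b p i) * b p j := by
      intro i j
      rw [Finset.sum_eq_single (q i)]
      · by_cases h : q j = q i
        · have hm : (g i)⁻¹ * g j ∈ Z := QuotientGroup.eq.1 h.symm
          have hrr : r j = r i := by simp only [r, h]
          have hz : (⟨(g i)⁻¹ * g j, hm⟩ : Z)
              = (⟨(r i)⁻¹ * g i, hr i⟩ : Z)⁻¹ * ⟨(r j)⁻¹ * g j, hr j⟩ := by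
            apply Subtype.ext
            simp [hrr, mul_assoc]
          rw [hext_in _ hm, hz, map_mul, map_inv, Circle.coe_mul, Circle.coe_inv_eq_conj]
          simp only [b, a, h, if_true, map_mul]
          ring
        · have hm : (g i)⁻¹ * g j ∉ Z := fun hm => h (QuotientGroup.eq.2 hm).symm
          rw [hext_out _ hm]
          simp [b, h]
      · intro p _ hp
        simp [b, Ne.symm hp]
      · intro h
        exact absurd (Finset.mem_image_of_mem q (Finset.mem_univ i)) h
    have total : ∑ i, ∑ j, (starRingEnd ℂ) (c i) * c j * χext ((g i)⁻¹ * g j)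
        = ∑ p ∈ S, star (∑ i, b p i) * (∑ j, b p j) := by
      simp only [key, star_sum, Finset.sum_mul_sum]
      rw [Finset.sum_comm (s := S)]
      refine Finset.sum_congr rfl fun i _ => ?_
      rw [Finset.sum_comm]
      rfl
    rw [total]
    exact Finset.sum_nonneg fun p _ => star_mul_self_nonneg _
  · intro x g
    by_cases hx : x ∈ Z
    · have : g * x * g⁻¹ = x := by
        rw [Subgroup.mem_center_iff.1 (hZ hx) g, mul_inv_cancel_right]
      rw [this]
    · have hx' : g * x * g⁻¹ ∉ Z := by
        intro h
        apply hx
        have h2 := Subgroup.mem_center_iff.1 (hZ h) g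
        have : g * x * g⁻¹ = x := by
          have h3 : g * (g * x * g⁻¹) = g * x := by rw [h2]; group
          exact mul_left_cancel h3
        rwa [this] at h
      rw [hext_out _ hx, hext_out _ hx']
end

section
/- Let G be a group and μ an invariant random subgroup of G, i.e., a probability measure on Sub(G) invariant under the conjugation action of G. Then the function φ_μ : G → ℂ defined by φ_μ(g) = μ({H ∈ Sub(G) : g ∈ H}) is a normalized function of positive type on G which is constant on conjugacy classes. -/
open scoped ComplexOrder

open MeasureTheory

/-- The σ-algebra on `Sub(G)`, the space of subgroups of `G`, generated by the sets
`{H : g ∈ H}` for `g ∈ G`. -/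
instance subgroupMeasurableSpace (G : Type*) [Group G] : MeasurableSpace (Subgroup G) :=
  MeasurableSpace.generateFrom {s : Set (Subgroup G) | ∃ g : G, s = {H : Subgroup G | g ∈ H}}

theorem measurableSet_mem_aux {G : Type*} [Group G] (g : G) :
    MeasurableSet {H : Subgroup G | g ∈ H} :=
  MeasurableSpace.measurableSet_generateFrom ⟨g, rfl⟩

open Classical in
theorem kernel_nonneg_aux {G : Type*} [Group G] (H : Subgroup G) (n : ℕ) (g : Fin n → G)
    (c : Fin n → ℂ) :
    0 ≤ ∑ i, ∑ j, (starRingEnd ℂ) (c i) * c j * (if (g i)⁻¹ * g j ∈ H then (1 : ℂ) else 0) := by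
  let q : Fin n → G ⧸ H := fun i => (g i : G ⧸ H)
  have key : ∑ i, ∑ j, (starRingEnd ℂ) (c i) * c j *
        (if (g i)⁻¹ * g j ∈ H then (1 : ℂ) else 0)
      = ∑ x ∈ Finset.univ.image q, (starRingEnd ℂ) (∑ i, if q i = x then c i else 0) *
          (∑ i, if q i = x then c i else 0) := by
    simp_rw [map_sum, Finset.sum_mul_sum]
    rw [Finset.sum_comm]
    rw [Finset.sum_comm' (t' := Finset.univ) (s' := fun _ => Finset.univ) (by simp)]
    rw [Finset.sum_comm (s := Finset.univ.image q)]
    refine Finset.sum_congr rfl fun i _ => ?_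
    rw [Finset.sum_comm]
    refine Finset.sum_congr rfl fun j _ => ?_
    rw [Finset.sum_eq_single (q i)]
    · have : (g i)⁻¹ * g j ∈ H ↔ q j = q i := by
        rw [← QuotientGroup.eq, eq_comm]
      simp [this]
    · intro b _ hb
      simp [hb.symm]
    · intro h
      exact absurd (Finset.mem_image_of_mem q (Finset.mem_univ i)) h
  rw [key]
  refine Finset.sum_nonneg fun x _ => ?_
  exact star_mul_self_nonneg _

theorem stmt_8 {G : Type*} [Group G] (μ : Measure (Subgroup G)) [IsProbabilityMeasure μ]
    (hinv : ∀ g : G,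
      Measure.map (fun H : Subgroup G => Subgroup.map (MulAut.conj g).toMonoidHom H) μ = μ) :
    IsPositiveType (fun g : G => ((μ {H : Subgroup G | g ∈ H}).toReal : ℂ)) ∧
      ((μ {H : Subgroup G | (1 : G) ∈ H}).toReal : ℂ) = 1 ∧
      ∀ x g : G, ((μ {H : Subgroup G | g * x * g⁻¹ ∈ H}).toReal : ℂ)
        = ((μ {H : Subgroup G | x ∈ H}).toReal : ℂ) := by
  classical
  refine ⟨?_, ?_, ?_⟩
  · intro n g c
    have hint : ∀ x : G, Integrable (fun H : Subgroup G => if x ∈ H then (1 : ℂ) else 0) μ := by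
      intro x
      exact (integrable_const (1 : ℂ)).indicator (measurableSet_mem_aux x)
    have hval : ∀ x : G, ((μ {H : Subgroup G | x ∈ H}).toReal : ℂ)
        = ∫ H : Subgroup G, (if x ∈ H then (1 : ℂ) else 0) ∂μ := by
      intro x
      have := integral_indicator_const (μ := μ) (1 : ℂ) (measurableSet_mem_aux x)
      simp only [Set.indicator_apply, Set.mem_ofPred_eq] at this
      rw [this]
      simp [Measure.real]
    have : ∑ i, ∑ j, (starRingEnd ℂ) (c i) * c j *
        ((μ {H : Subgroup G | (g i)⁻¹ * g j ∈ H}).toReal : ℂ)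
        = ∫ H : Subgroup G, ∑ i, ∑ j, (starRingEnd ℂ) (c i) * c j *
          (if (g i)⁻¹ * g j ∈ H then (1 : ℂ) else 0) ∂μ := by
      rw [integral_finsetSum _ fun i _ => integrable_finsetSum _ fun j _ => (hint _).const_mul _]
      refine Finset.sum_congr rfl fun i _ => ?_
      rw [integral_finsetSum _ fun j _ => (hint _).const_mul _]
      refine Finset.sum_congr rfl fun j _ => ?_
      rw [integral_const_mul, hval]
    change 0 ≤ ∑ i, ∑ j, (starRingEnd ℂ) (c i) * c j *
        ((μ {H : Subgroup G | (g i)⁻¹ * g j ∈ H}).toReal : ℂ)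
    rw [this]
    exact integral_nonneg fun H => kernel_nonneg_aux H n g c
  · simp [one_mem]
  · intro x g
    have hpre : ∀ y : G, (fun H : Subgroup G => Subgroup.map (MulAut.conj g).toMonoidHom H) ⁻¹'
        {H | y ∈ H} = {H | g⁻¹ * y * g ∈ H} := by
      intro y
      ext H
      simp only [Set.mem_preimage, Set.mem_ofPred_eq, Subgroup.mem_map]
      constructor
      · rintro ⟨z, hz, rfl⟩
        simpa [mul_assoc] using hz
      · intro h
        exact ⟨_, h, by simp [mul_assoc]⟩
    have hm : Measurable
        (fun H : Subgroup G => Subgroup.map (MulAut.conj g).toMonoidHom H) := by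
      refine measurable_generateFrom ?_
      rintro _ ⟨y, rfl⟩
      rw [hpre]
      exact measurableSet_mem_aux _
    have h := congrArg (fun ν : Measure (Subgroup G) => ν {H | g * x * g⁻¹ ∈ H}) (hinv g)
    rw [Measure.map_apply hm (measurableSet_mem_aux _), hpre] at h
    rw [← h]
    simp [mul_assoc]
end

section
/- Let k be an infinite field, n ≥ 2, and let φ : SL_n(k) → ℂ be a normalized function of positive type that is constant on conjugacy classes. Then there exist t ∈ [0,1] and a normalized function ψ of positive type on SL_n(k) with ψ(g) = 0 for every g outside the center of SL_n(k), such that φ(g) = t + (1−t)·ψ(g) for all g ∈ SL_n(k). -/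
open scoped ComplexOrder

section Hilbert
variable {K H : Type*} [Group K] [NormedAddCommGroup H] [InnerProductSpace ℂ H]

/-- `ρ` preserves inner products. -/
def IsUnitaryRep (ρ : K →* (H →L[ℂ] H)) : Prop :=
  ∀ k v w, inner ℂ (ρ k v) (ρ k w) = inner ℂ v w

/-- `p` is the orthogonal projection of `v` on the `ρ`-fixed vectors. -/
def IsPr (ρ : K →* (H →L[ℂ] H)) (v p : H) : Prop :=
  (∀ k, ρ k p = p) ∧ ∀ w, (∀ k, ρ k w = w) → inner ℂ w v = inner ℂ w p

lemma IsUnitaryRep.comp {K' : Type*} [Group K'] {ρ : K →* (H →L[ℂ] H)} (h : IsUnitaryRep ρ) (f : K' →* K) :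
    IsUnitaryRep (ρ.comp f) := fun k v w => h (f k) v w

lemma IsUnitaryRep.adj {ρ : K →* (H →L[ℂ] H)} (h : IsUnitaryRep ρ) (k : K) (v w : H) :
    inner ℂ (ρ k v) w = inner ℂ v (ρ k⁻¹ w) := by
  rw [← h k⁻¹ (ρ k v) w, ← mul_apply_eq_comp, ← map_mul]
  simp

lemma IsUnitaryRep.norm {ρ : K →* (H →L[ℂ] H)} (h : IsUnitaryRep ρ) (k : K) (v : H) : ‖ρ k v‖ = ‖v‖ := by
  rw [← sq_eq_sq₀ (norm_nonneg _) (norm_nonneg _), ← inner_self_eq_norm_sq (𝕜 := ℂ),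
    ← inner_self_eq_norm_sq (𝕜 := ℂ), h]

lemma IsPr.unique {ρ : K →* (H →L[ℂ] H)} {v p q : H} (hp : IsPr ρ v p) (hq : IsPr ρ v q) :
    p = q := by
  have h1 : ∀ k, ρ k (p - q) = p - q := fun k => by rw [map_sub, hp.1, hq.1]
  have h2 : inner ℂ (p - q) (p - q) = (0 : ℂ) := by
    rw [inner_sub_right, ← hp.2 _ h1, ← hq.2 _ h1, sub_self]
  exact sub_eq_zero.1 (inner_self_eq_zero.1 h2)

lemma exists_pr_hull [CompleteSpace H] {ρ : K →* (H →L[ℂ] H)} (h : IsUnitaryRep ρ) (v : H) :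
    ∃ p, p ∈ closure (convexHull ℝ (Set.range fun k => ρ k v)) ∧ IsPr ρ v p := by
  let : InnerProductSpace ℝ H := InnerProductSpace.rclikeToReal ℂ H
  set C := closure (convexHull ℝ (Set.range fun k => ρ k v)) with hC
  have hconv : Convex ℝ C := (convex_convexHull ℝ _).closure
  have hsub : (Set.range fun k => ρ k v) ⊆ C :=
    (subset_convexHull ℝ _).trans subset_closure
  have hne : C.Nonempty := ⟨ρ 1 v, hsub ⟨1, rfl⟩⟩
  obtain ⟨p, hpC, hp⟩ := exists_norm_eq_iInf_of_complete_convex hne isClosed_closure.isComplete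
    hconv 0
  have hp2 := (norm_eq_iInf_iff_real_inner_le_zero hconv hpC).1 hp
  have hinv : ∀ k, ∀ x ∈ C, ρ k x ∈ C := by
    intro k
    have : C ⊆ (ρ k) ⁻¹' C := by
      refine closure_minimal (convexHull_min ?_ ?_) ?_
      · rintro _ ⟨l, rfl⟩
        refine hsub ⟨k * l, ?_⟩
        simp
      · exact hconv.is_linear_preimage (((ρ k).restrictScalars ℝ).toLinearMap.isLinear)
      · exact isClosed_closure.preimage (ρ k).continuous
    exact fun x hx => this hx
  refine ⟨p, hpC, ?_, ?_⟩
  · intro k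
    have h1 := hp2 _ (hinv k p hpC)
    have h2 : (inner ℝ p (ρ k p) : ℝ) = RCLike.re (inner ℂ p (ρ k p)) := rfl
    have h3 : ‖ρ k p - p‖ ^ 2 = ‖ρ k p‖ ^ 2 - 2 * inner ℝ (ρ k p) p + ‖p‖ ^ 2 :=
      norm_sub_sq_real _ _
    rw [h.norm, real_inner_comm] at h3
    rw [zero_sub, inner_neg_left, inner_sub_right, real_inner_self_eq_norm_sq] at h1
    have h4 : ‖ρ k p - p‖ ^ 2 ≤ 0 := by linarith
    have h5 : ‖ρ k p - p‖ = 0 := by nlinarith [norm_nonneg (ρ k p - p)]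
    exact sub_eq_zero.1 (norm_eq_zero.1 h5)
  · intro w hw
    have : C ⊆ {x | inner ℂ w v = inner ℂ w x} := by
      refine closure_minimal (convexHull_min ?_ ?_) ?_
      · rintro _ ⟨l, rfl⟩
        change inner ℂ w v = inner ℂ w (ρ l v)
        rw [← h l w v, hw]
      · intro x hx y hy a b ha hb hab
        simp only [Set.mem_ofPred_eq] at *
        have e : a • x + b • y = (a : ℂ) • x + (b : ℂ) • y := by simp
        rw [e, inner_add_right, inner_smul_right, inner_smul_right, ← hx, ← hy, ← add_mul,
          ← Complex.ofReal_add, hab]; simp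
      · exact isClosed_eq continuous_const (by fun_prop)
    exact this hpC

lemma exists_pr [CompleteSpace H] {ρ : K →* (H →L[ℂ] H)} (h : IsUnitaryRep ρ) (v : H) :
    ∃ p, IsPr ρ v p := let ⟨p, _, hp⟩ := exists_pr_hull h v; ⟨p, hp⟩

/-- The mean lemma. -/
lemma mean_le [CompleteSpace H] [Infinite K] {ρ : K →* (H →L[ℂ] H)} (h : IsUnitaryRep ρ) {v p w : H}
    (hp : IsPr ρ v p) (S : Set K) (hS : S.Finite) (c : ℂ) (ε : ℝ)
    (hw : ∀ k, k ∉ S → ‖inner ℂ w (ρ k v) - c‖ ≤ ε) : ‖inner ℂ w p - c‖ ≤ ε := by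
  obtain ⟨q, hqC, hq⟩ := exists_pr_hull h w
  set A : Set H := {x | ∃ T : Set K, T.Finite ∧ ∀ k, k ∉ T → ‖inner ℂ x (ρ k v) - c‖ ≤ ε} with hA
  have hsub : convexHull ℝ (Set.range fun k => ρ k w) ⊆ A := by
    refine convexHull_min ?_ ?_
    · rintro _ ⟨l, rfl⟩
      refine ⟨(fun k => l * k) '' S, hS.image _, fun k hk => ?_⟩
      dsimp only
      rw [h.adj, ← mul_apply_eq_comp, ← map_mul]
      exact hw _ fun hh => hk ⟨_, hh, by simp⟩
    · rintro x ⟨T, hT, hx⟩ y ⟨T', hT', hy⟩ a b ha hb hab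
      refine ⟨T ∪ T', hT.union hT', fun k hk => ?_⟩
      have hx := hx k fun hh => hk (Or.inl hh)
      have hy := hy k fun hh => hk (Or.inr hh)
      have e : a • x + b • y = (a : ℂ) • x + (b : ℂ) • y := by simp
      have e2 : inner ℂ (a • x + b • y) (ρ k v) - c
          = (a : ℂ) * (inner ℂ x (ρ k v) - c) + (b : ℂ) * (inner ℂ y (ρ k v) - c) := by
        rw [e, inner_add_left, inner_smul_left, inner_smul_left, Complex.conj_ofReal,
          Complex.conj_ofReal]
        have : c = (a : ℂ) * c + (b : ℂ) * c := by
          rw [← add_mul, ← Complex.ofReal_add, hab]; simp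
        linear_combination -this
      rw [e2]
      refine (norm_add_le _ _).trans ?_
      rw [norm_mul, norm_mul, Complex.norm_real, Complex.norm_real, Real.norm_of_nonneg ha,
        Real.norm_of_nonneg hb]
      calc _ ≤ a * ε + b * ε := by gcongr
        _ = ε := by rw [← add_mul, hab, one_mul]
  have hwp : inner ℂ w p = inner ℂ q v := by
    rw [hp.2 q hq.1, ← inner_conj_symm, hq.2 p hp.1, inner_conj_symm]
  refine le_of_forall_pos_le_add fun δ hδ => ?_
  have hv : 0 < ‖v‖ + 1 := by positivity
  obtain ⟨x, hx, hxq⟩ := Metric.mem_closure_iff.1 hqC (δ / (‖v‖ + 1)) (by positivity)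
  obtain ⟨T, hT, hxT⟩ := hsub hx
  obtain ⟨k, hk⟩ := hT.infinite_compl.nonempty
  have h1 := hxT k hk
  have h2 : inner ℂ q v = inner ℂ q (ρ k v) := by rw [← h k q v, hq.1]
  have h3 : inner ℂ q (ρ k v) - c = inner ℂ (q - x) (ρ k v) + (inner ℂ x (ρ k v) - c) := by
    rw [inner_sub_left]; ring
  rw [hwp, h2, h3, add_comm ε]
  refine (norm_add_le _ _).trans (add_le_add ?_ h1)
  refine (norm_inner_le_norm _ _).trans ?_
  rw [h.norm]
  rw [dist_eq_norm] at hxq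
  calc ‖q - x‖ * ‖v‖ ≤ δ / (‖v‖ + 1) * (‖v‖ + 1) := by
        gcongr; linarith
    _ = δ := by field_simp

lemma mean_eq [CompleteSpace H] [Infinite K] {ρ : K →* (H →L[ℂ] H)} (h : IsUnitaryRep ρ) {v p w : H}
    (hp : IsPr ρ v p) (S : Set K) (hS : S.Finite) (c : ℂ)
    (hw : ∀ k, k ∉ S → inner ℂ w (ρ k v) = c) : inner ℂ w p = c := by
  have := mean_le h hp S hS c 0 (fun k hk => by rw [hw k hk]; simp)
  exact sub_eq_zero.1 (norm_le_zero_iff.1 this)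

lemma IsPr.zero_of {ρ : K →* (H →L[ℂ] H)} {v p : H}
    (hp : IsPr ρ v p) (h0 : inner ℂ v p = 0) : p = 0 := by
  have := hp.2 p hp.1
  rw [← inner_conj_symm, h0, map_zero] at this
  exact inner_self_eq_zero.1 this.symm

/-- Comparison of two representations. -/
lemma pr_zero_of_eq [CompleteSpace H] [Infinite K] {ρ σ : K →* (H →L[ℂ] H)}
    (hρ : IsUnitaryRep ρ) (hσ : IsUnitaryRep σ) {y ξ p : H} (hp : IsPr ρ y p) (h0 : IsPr σ ξ 0)
    (S : Set K) (hS : S.Finite)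
    (hw : ∀ k, k ∉ S → inner ℂ y (ρ k y) = inner ℂ ξ (σ k ξ)) : p = 0 := by
  obtain ⟨q, hqC, hq⟩ := exists_pr_hull hσ ξ
  obtain rfl : q = 0 := hq.unique h0
  set A : Set H := {x | ∃ x' : H, inner ℂ x' p = inner ℂ y p ∧
    ∃ T : Set K, T.Finite ∧ ∀ k, k ∉ T → inner ℂ x' (ρ k y) = inner ℂ x (σ k ξ)} with hA
  have hsub : convexHull ℝ (Set.range fun k => σ k ξ) ⊆ A := by
    refine convexHull_min ?_ ?_
    · rintro _ ⟨l, rfl⟩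
      refine ⟨ρ l y, ?_, (fun k => l * k) '' S, hS.image _, fun k hk => ?_⟩
      · rw [hρ.adj, hp.1]
      · dsimp only
        rw [hρ.adj, hσ.adj, ← mul_apply_eq_comp, ← map_mul,
          ← mul_apply_eq_comp, ← map_mul]
        exact hw _ fun hh => hk ⟨_, hh, by simp⟩
    · rintro x ⟨x', hx', T, hT, hx⟩ z ⟨z', hz', T', hT', hz⟩ a b ha hb hab
      have e : ∀ x z : H, a • x + b • z = (a : ℂ) • x + (b : ℂ) • z := by simp
      have e2 : ∀ x z t : H, inner ℂ (a • x + b • z) t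
          = (a : ℂ) * (inner ℂ x t) + (b : ℂ) * (inner ℂ z t) := by
        intro x z t
        rw [e, inner_add_left, inner_smul_left, inner_smul_left, Complex.conj_ofReal,
          Complex.conj_ofReal]
      refine ⟨a • x' + b • z', ?_, T ∪ T', hT.union hT', fun k hk => ?_⟩
      · rw [e2, hx', hz', ← add_mul, ← Complex.ofReal_add, hab]; simp
      · rw [e2, e2, hx k fun hh => hk (Or.inl hh), hz k fun hh => hk (Or.inr hh)]
  apply hp.zero_of
  rw [← norm_le_zero_iff]
  refine le_of_forall_pos_le_add fun δ hδ => ?_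
  obtain ⟨x, hx, hxq⟩ := Metric.mem_closure_iff.1 hqC (δ / (‖ξ‖ + 1)) (by positivity)
  obtain ⟨x', hx', T, hT, hxT⟩ := hsub hx
  have := mean_le hρ hp T hT 0 δ (w := x') (fun k hk => by
    rw [hxT k hk, sub_zero]
    refine (norm_inner_le_norm _ _).trans ?_
    rw [hσ.norm]
    rw [dist_eq_norm, zero_sub, norm_neg] at hxq
    calc ‖x‖ * ‖ξ‖ ≤ δ / (‖ξ‖ + 1) * (‖ξ‖ + 1) := by
          gcongr; linarith
      _ = δ := by field_simp)
  rw [hx', sub_zero] at this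
  simpa using this

end Hilbert

section GNS

lemma IsPositiveType.conj {G : Type*} [Group G] {φ : G → ℂ} (h : IsPositiveType φ) (g : G) :
    (starRingEnd ℂ) (φ g⁻¹) = φ g := by
  have h0 := h 1 ![1] ![1]
  have h1 := h 2 ![1, g] ![1, 1]
  have h2 := h 2 ![1, g] ![1, Complex.I]
  simp [Fin.sum_univ_two, Complex.le_def] at h0 h1 h2
  apply Complex.ext <;> simp <;> linarith [h0.2, h1.2, h2.2]

lemma IsPositiveType.finset {G : Type*} [Group G] {φ : G → ℂ} (h : IsPositiveType φ)
    (s : Finset G) (c : G → ℂ) :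
    0 ≤ ∑ x ∈ s, ∑ y ∈ s, (starRingEnd ℂ) (c x) * c y * φ (x⁻¹ * y) := by
  have := h s.card (fun i => (s.equivFin.symm i : G)) (fun i => c (s.equivFin.symm i))
  have e : ∀ F : G → ℂ, ∑ i, F (s.equivFin.symm i) = ∑ x ∈ s, F x := by
    intro F
    rw [Equiv.sum_comp s.equivFin.symm (fun x : s => F x), Finset.sum_coe_sort]
  rw [← e (fun x => ∑ y ∈ s, (starRingEnd ℂ) (c x) * c y * φ (x⁻¹ * y))]
  simp only [← e]
  exact this

lemma isPositiveType_of_rep {G H : Type*} [Group G] [NormedAddCommGroup H] [InnerProductSpace ℂ H]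
    {ρ : G →* (H →L[ℂ] H)} (h : IsUnitaryRep ρ) (ξ : H) :
    IsPositiveType (fun g => inner ℂ ξ (ρ g ξ)) := by
  intro n g c
  have : ∑ i, ∑ j, (starRingEnd ℂ) (c i) * c j * inner ℂ ξ (ρ ((g i)⁻¹ * g j) ξ)
      = inner ℂ (∑ i, c i • ρ (g i) ξ) (∑ i, c i • ρ (g i) ξ) := by
    rw [sum_inner]
    refine Finset.sum_congr rfl fun i _ => ?_
    rw [inner_sum]
    refine Finset.sum_congr rfl fun j _ => ?_
    rw [inner_smul_left, inner_smul_right, ← h (g i) ξ, ← mul_apply_eq_comp, ← map_mul,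
      mul_inv_cancel_left, mul_assoc]
  rw [this, inner_self_eq_norm_sq_to_K]
  have : (0:ℝ) ≤ ‖∑ i, c i • ρ (g i) ξ‖ ^ 2 := by positivity
  have h2 := Complex.zero_le_real.2 this
  push_cast at h2
  exact h2

/-- The pre-Hilbert structure. -/
noncomputable abbrev gnsCore {G : Type*} [Group G] {φ : G → ℂ} (h : IsPositiveType φ) :
    PreInnerProductSpace.Core ℂ (G →₀ ℂ) where
  inner f g := f.sum fun x a => g.sum fun y b => (starRingEnd ℂ) a * b * φ (x⁻¹ * y)
  conj_inner_symm f g := by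
    rw [Finsupp.sum_comm]
    simp only [map_finsuppSum]
    refine congrArg _ (funext fun x => funext fun a => ?_)
    refine congrArg _ (funext fun y => funext fun b => ?_)
    simp only [map_mul, Complex.conj_conj]
    rw [← h.conj (x⁻¹ * y), mul_inv_rev, inv_inv]
    ring
  add_left _ _ _ := by
    rw [Finsupp.sum_add_index'] <;> simp [← Finsupp.sum_add, add_mul]
  smul_left _ _ _ := by
    rw [Finsupp.sum_smul_index] <;> simp [Finsupp.mul_sum, ← mul_assoc]
  re_inner_nonneg f := by
    have := h.finset f.support f
    simp only [Complex.le_def] at this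
    exact this.1

theorem gns.{u} {G : Type u} [Group G] {φ : G → ℂ} (h : IsPositiveType φ) :
    ∃ (H : Type u) (_ : NormedAddCommGroup H) (_ : InnerProductSpace ℂ H) (_ : CompleteSpace H)
      (ρ : G →* (H →L[ℂ] H)) (ξ : H), IsUnitaryRep ρ ∧ ∀ g, inner ℂ ξ (ρ g ξ) = φ g := by
  let c : PreInnerProductSpace.Core ℂ (G →₀ ℂ) := gnsCore h
  let : SeminormedAddCommGroup (G →₀ ℂ) :=
    InnerProductSpace.Core.toSeminormedAddCommGroup (𝕜 := ℂ)
  let : InnerProductSpace ℂ (G →₀ ℂ) := .ofCore _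
  have hin : ∀ f g : G →₀ ℂ, inner ℂ f g =
    f.sum fun x a => g.sum fun y b => (starRingEnd ℂ) a * b * φ (x⁻¹ * y) := fun _ _ => rfl
  have hinv : ∀ (t : G) (f g : G →₀ ℂ), inner ℂ (Finsupp.lmapDomain ℂ ℂ (t * ·) f)
      (Finsupp.lmapDomain ℂ ℂ (t * ·) g) = inner ℂ f g := by
    intro t f g
    have hi : Function.Injective (t * ·) := mul_right_injective t
    rw [hin, hin]
    simp only [Finsupp.lmapDomain_apply]
    rw [Finsupp.sum_mapDomain_index_inj hi]
    refine Finsupp.sum_congr fun x _ => ?_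
    rw [Finsupp.sum_mapDomain_index_inj hi]
    refine Finsupp.sum_congr fun y _ => ?_
    congr 2
    group
  have hnorm : ∀ (t : G) (f : G →₀ ℂ), ‖Finsupp.lmapDomain ℂ ℂ (t * ·) f‖ = ‖f‖ := by
    intro t f
    rw [← sq_eq_sq₀ (norm_nonneg _) (norm_nonneg _), ← inner_self_eq_norm_sq (𝕜 := ℂ),
      ← inner_self_eq_norm_sq (𝕜 := ℂ), hinv]
  let T : G → ((G →₀ ℂ) →L[ℂ] (G →₀ ℂ)) := fun t =>
    (Finsupp.lmapDomain ℂ ℂ (t * ·)).mkContinuous 1 (fun f => by rw [hnorm, one_mul])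
  have hT : ∀ t f, T t f = Finsupp.mapDomain (t * ·) f := fun _ _ => rfl
  have hcoe : ∀ t (f : G →₀ ℂ), (T t).completion (f : UniformSpace.Completion (G →₀ ℂ)) =
      ((T t f : G →₀ ℂ) : UniformSpace.Completion (G →₀ ℂ)) := fun t f =>
    ContinuousLinearMap.completion_apply_coe _ _
  let ρ : G →* (UniformSpace.Completion (G →₀ ℂ) →L[ℂ] UniformSpace.Completion (G →₀ ℂ)) :=
    { toFun := fun t => (T t).completion
      map_one' := by
        ext f
        induction f using UniformSpace.Completion.induction_on with
        | hp => exact isClosed_eq (ContinuousLinearMap.continuous _) continuous_id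
        | ih f =>
          rw [hcoe, hT]
          have : ((1 : G) * ·) = id := by ext; simp
          rw [this, Finsupp.mapDomain_id]; rfl
      map_mul' := by
        intro s t
        ext f
        induction f using UniformSpace.Completion.induction_on with
        | hp => exact isClosed_eq (ContinuousLinearMap.continuous _)
                  (ContinuousLinearMap.continuous _)
        | ih f =>
          rw [mul_apply_eq_comp, hcoe, hcoe, hcoe, hT, hT, hT, ← Finsupp.mapDomain_comp]
          congr 2
          ext; simp [mul_assoc] }
  refine ⟨UniformSpace.Completion (G →₀ ℂ), inferInstance, inferInstance, inferInstance, ρ,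
    ((Finsupp.single 1 1 : G →₀ ℂ) : UniformSpace.Completion (G →₀ ℂ)), ?_, ?_⟩
  · intro t v w
    induction v, w using UniformSpace.Completion.induction_on₂ with
    | hp => exact isClosed_eq (by fun_prop) (by fun_prop)
    | ih v w =>
      change inner ℂ ((T t).completion _) ((T t).completion _) = _
      rw [hcoe, hcoe, UniformSpace.Completion.inner_coe, UniformSpace.Completion.inner_coe]
      exact hinv t v w
  · intro t
    change inner ℂ _ ((T t).completion _) = _
    rw [hcoe, UniformSpace.Completion.inner_coe, hT, Finsupp.mapDomain_single, hin]
    simp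

end GNS

section SLgroup
open Matrix Matrix.SpecialLinearGroup

variable {k : Type*} [Field k] {n : ℕ}

lemma sl_ext {A B : SpecialLinearGroup (Fin n) k}
    (h : (A : Matrix (Fin n) (Fin n) k) = (B : Matrix (Fin n) (Fin n) k)) : A = B :=
  Subtype.ext h

lemma sl_coe_mul (A B : SpecialLinearGroup (Fin n) k) :
    ((A * B : SpecialLinearGroup (Fin n) k) : Matrix (Fin n) (Fin n) k) =
      (A : Matrix (Fin n) (Fin n) k) * (B : Matrix (Fin n) (Fin n) k) := rfl

/-- The unipotent matrix `1 + u ⊗ v`. -/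
def rankOne (u v : Fin n → k) (h : v ⬝ᵥ u = 0) : SpecialLinearGroup (Fin n) k :=
  ⟨1 + vecMulVec u v, by
    rw [vecMulVec_eq Unit, det_one_add_replicateCol_mul_replicateRow, h, add_zero]⟩

lemma rankOne_apply (u v : Fin n → k) (h : v ⬝ᵥ u = 0) (p q : Fin n) :
    (rankOne u v h) p q = (if p = q then 1 else 0) + u p * v q := by
  simp [rankOne, Matrix.one_apply, vecMulVec_apply]

/-- Root subgroups. -/
def rootHom {p q : Fin n} (hpq : p ≠ q) : Multiplicative k →* SpecialLinearGroup (Fin n) k where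
  toFun a := transvection hpq (Multiplicative.toAdd a)
  map_one' := transvection_coeff_zero _
  map_mul' _ _ := transvection_add hpq _ _

/-- The torus. -/
noncomputable def torus {i j : Fin n} (hij : i ≠ j) : kˣ →* SpecialLinearGroup (Fin n) k where
  toFun s := diag2n hij ((s : k) ^ n) (pow_ne_zero _ s.ne_zero)
  map_one' := by
    apply sl_ext
    ext p q
    simp [diag2n_coe, diagonal_apply, Matrix.one_apply]
  map_mul' s t := by
    apply sl_ext
    rw [sl_coe_mul, diag2n_coe, diag2n_coe, diag2n_coe, diagonal_mul_diagonal]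
    congr 1
    ext l
    split_ifs <;> simp [mul_pow, mul_comm]

/-- A determinant one diagonal matrix. -/
noncomputable def diagOne (j : Fin n) (s : kˣ) : SpecialLinearGroup (Fin n) k :=
  ⟨diagonal fun l => if l = j then (s : k) ^ (n - 1) else (s : k)⁻¹, by
    rw [det_diagonal, ← Finset.mul_prod_erase _ _ (Finset.mem_univ j)]
    rw [Finset.prod_congr rfl (g := fun _ => (s : k)⁻¹)]
    · rw [Finset.prod_const, Finset.card_erase_of_mem (Finset.mem_univ j), Finset.card_univ,
        Fintype.card_fin, if_pos rfl, ← mul_pow, mul_inv_cancel₀ s.ne_zero, one_pow]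
    · intro x hx
      simp [Finset.ne_of_mem_erase hx]⟩

lemma diagOne_coe (j : Fin n) (s : kˣ) : (diagOne j s : Matrix (Fin n) (Fin n) k) =
    diagonal fun l => if l = j then (s : k) ^ (n - 1) else (s : k)⁻¹ := rfl

/-- The other torus. -/
noncomputable def torusOne (j : Fin n) : kˣ →* SpecialLinearGroup (Fin n) k where
  toFun s := diagOne j s
  map_one' := by
    apply sl_ext
    ext p q
    simp [diagOne_coe, diagonal_apply, Matrix.one_apply]
  map_mul' s t := by
    apply sl_ext
    rw [sl_coe_mul, diagOne_coe, diagOne_coe, diagOne_coe, diagonal_mul_diagonal]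
    congr 1
    ext l
    split_ifs <;> simp [mul_pow, mul_comm]

lemma diag2n_decompose {i j : Fin n} (hij : i ≠ j) (a : k) (ha : a ≠ 0) :
    diag2n hij a ha = transvection hij a * transvection hij.symm (- a⁻¹) * transvection hij a *
      transvection hij (-1) * transvection hij.symm 1 * transvection hij (-1) := by
  apply sl_ext
  simp only [sl_coe_mul, transvection_coe, diag2n_coe, mul_add, add_mul, mul_one, one_mul,
    single_mul_single_same, single_mul_single_of_ne _ _ _ _ hij,
    single_mul_single_of_ne _ _ _ _ hij.symm, zero_mul, mul_zero, add_zero, zero_add]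
  ext p q
  simp only [Matrix.add_apply, diagonal_apply, Matrix.one_apply, single_apply]
  grind

lemma sl_induction (hn : 2 ≤ n) (P : SpecialLinearGroup (Fin n) k → Prop)
    (M : SpecialLinearGroup (Fin n) k)
    (ht : ∀ (i j : Fin n) (hij : i ≠ j) (a : k), P (transvection hij a))
    (hmul : ∀ A B, P A → P B → P (A * B)) : P M := by
  have : Nontrivial (Fin n) := Fin.nontrivial_iff_two_le.2 hn
  refine diagonal_transvection_induction' P M (fun i j hij c hc => ?_) ht hmul
  rw [diag2n_decompose]
  refine hmul _ _ (hmul _ _ (hmul _ _ (hmul _ _ (hmul _ _ ?_ ?_) ?_) ?_) ?_) ?_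
  all_goals exact ht _ _ _ _

lemma transvection_comm {p i q : Fin n} (hpi : p ≠ i) (hiq : i ≠ q) (hpq : p ≠ q) (a : k) :
    transvection hpq a = transvection hpi a * transvection hiq 1 * transvection hpi (-a) *
      transvection hiq (-1) := by
  apply sl_ext
  simp only [sl_coe_mul, transvection_coe, mul_add, add_mul, mul_one, one_mul,
    single_mul_single_same, single_mul_single_of_ne _ _ _ _ hpi, single_mul_single_of_ne _ _ _ _ hpq,
    single_mul_single_of_ne _ _ _ _ hiq, single_mul_single_of_ne _ _ _ _ hpq.symm,
    single_mul_single_of_ne _ _ _ _ hpi.symm, single_mul_single_of_ne _ _ _ _ hiq.symm, zero_mul, mul_zero, add_zero, zero_add]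
  ext p q
  simp only [Matrix.add_apply, Matrix.one_apply, single_apply]
  grind

/-- The diagonal entries of the torus. -/
lemma torus_conj {i j : Fin n} (hij : i ≠ j) {p q : Fin n} (hpq : p ≠ q) (a : k) (s : kˣ) (x y : k)
    (hx : x = if p = i then (s:k)^n else if p = j then ((s:k)^n)⁻¹ else 1)
    (hy : y = if q = i then (s:k)^n else if q = j then ((s:k)^n)⁻¹ else 1) (b : k)
    (hb : x * a = b * y) :
    torus hij s * transvection hpq a = transvection hpq b * torus hij s := by
  apply sl_ext
  simp only [torus, MonoidHom.coe_mk, OneHom.coe_mk, sl_coe_mul, transvection_coe,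
    mul_add, add_mul, mul_one, one_mul, diag2n_coe]
  congr 1
  ext u v
  rw [diagonal_mul, mul_diagonal, single_apply, single_apply]
  by_cases h : p = u ∧ q = v
  · obtain ⟨rfl, rfl⟩ := h
    simp only [and_self, if_true]
    rw [← hx, ← hy, hb]
  · simp [h]

/-- An off-diagonal entry can be used to clear a column. -/
lemma exists_conj_of_entry (g : SpecialLinearGroup (Fin n) k) (i j : Fin n) (hij : i ≠ j)
    (h0 : g i j ≠ 0) : ∃ h : SpecialLinearGroup (Fin n) k, ∃ c : k, c ≠ 0 ∧
      ∀ p, (h * g * h⁻¹) p j = if p = i then c else 0 := by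
  set b := g i j with hb
  let y : Fin n → k := fun l => if l = i then 0 else - g l j / b
  have hy : (Pi.single i (1 : k)) ⬝ᵥ y = 0 := by simp [y]
  let Q := rankOne y (Pi.single i (1 : k)) hy
  refine ⟨Q, b, h0, fun p => ?_⟩
  have hQj : ∀ x, Q x j = if x = j then 1 else 0 := by
    intro x
    rw [rankOne_apply]
    simp [hij.symm]
  have hX : Q * g * Q⁻¹ * Q = Q * g := by group
  have h1 : (Q * g * Q⁻¹ * Q) p j = (Q * g * Q⁻¹) p j := by
    rw [sl_coe_mul (Q * g * Q⁻¹) Q, Matrix.mul_apply]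
    simp [hQj]
  rw [← h1, hX, sl_coe_mul, Matrix.mul_apply]
  have h2 : ∀ x, Q p x * g x j = (if p = x then g x j else 0) +
      (if x = i then y p * g x j else 0) := by
    intro x
    rw [rankOne_apply, Pi.single_apply]
    split_ifs <;> simp [add_mul]
  rw [Finset.sum_congr rfl fun x _ => h2 x, Finset.sum_add_distrib]
  simp only [Finset.sum_ite_eq, Finset.sum_ite_eq', Finset.mem_univ, if_true, ← hb, y]
  split_ifs with h
  · rw [h, ← hb]; ring
  · field_simp
    ring

lemma exists_conj (g : SpecialLinearGroup (Fin n) k) (hg : g ∉ Subgroup.center _) :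
    ∃ h : SpecialLinearGroup (Fin n) k, ∃ i j : Fin n, i ≠ j ∧ ∃ c : k, c ≠ 0 ∧
      ∀ p, (h * g * h⁻¹) p j = if p = i then c else 0 := by
  by_cases hd : ∃ i j : Fin n, i ≠ j ∧ g i j ≠ 0
  · obtain ⟨i, j, hij, h0⟩ := hd
    obtain ⟨h, c, hc⟩ := exists_conj_of_entry g i j hij h0
    exact ⟨h, i, j, hij, c, hc⟩
  push Not at hd
  have hne : ∃ i j : Fin n, g i i ≠ g j j := by
    by_contra hcon
    push Not at hcon
    apply hg
    rw [mem_center_iff]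
    by_cases hn : n = 0
    · subst hn
      exact ⟨1, by simp, by ext i; exact i.elim0⟩
    · let z : Fin n := ⟨0, Nat.pos_of_ne_zero hn⟩
      have hs : scalar (Fin n) (g z z) = (g : Matrix (Fin n) (Fin n) k) := by
        ext p q
        rw [scalar_apply, diagonal_apply]
        split_ifs with hpq
        · subst hpq; exact hcon _ _
        · exact (hd p q hpq).symm
      refine ⟨g z z, ?_, hs⟩
      have := g.det_coe
      rw [← hs, scalar_apply, det_diagonal] at this
      simpa using this
  obtain ⟨i, j, hne⟩ := hne
  have hij : i ≠ j := fun h => hne (by rw [h])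
  set u : SpecialLinearGroup (Fin n) k := transvection hij (1 : k) with hu
  have hent : (u * g * u⁻¹) i j ≠ 0 := by
    rw [hu, transvection_inv, sl_coe_mul, sl_coe_mul, transvection_coe, transvection_coe]
    have : ((1 + single i j (1:k)) * (g : Matrix (Fin n) (Fin n) k) * (1 + single i j (-1:k))) i j
        = g j j - g i i := by
      simp [mul_add, add_mul, hd i j hij, hd j i hij.symm, mul_assoc]
      ring
    rw [this]
    exact sub_ne_zero.2 hne.symm
  obtain ⟨h, c, hc0, hc⟩ := exists_conj_of_entry _ i j hij hent
  refine ⟨h * u, i, j, hij, c, hc0, fun p => ?_⟩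
  rw [← hc p]
  congr 3
  group

/-- The commutator with the torus is conjugate to a torus element. -/
lemma commutator_conj (g : SpecialLinearGroup (Fin n) k) {i j : Fin n} (hij : i ≠ j) (c : k)
    (hg : ∀ p, (g⁻¹ : SpecialLinearGroup (Fin n) k) p j = if p = i then c else 0) (s : kˣ)
    (hs : (s : k) ^ (2 * n) ≠ 1) :
    ∃ P : SpecialLinearGroup (Fin n) k,
      g⁻¹ * diagOne j s * g * (diagOne j s)⁻¹ = P * torus hij s * P⁻¹ := by
  have hn : 1 ≤ n := by have := j.2; omega
  set m : k := (s : k) ^ n with hm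
  have hm0 : m ≠ 0 := pow_ne_zero _ s.ne_zero
  have hm2 : m * m ≠ 1 := by rwa [hm, ← pow_add, ← two_mul]
  have hsm : (s : k) ^ (n - 1) = m * (s : k)⁻¹ := by
    rw [hm, eq_mul_inv_iff_mul_eq₀ s.ne_zero, ← pow_succ]; congr 1; omega
  let D : Fin n → k := fun l => if l = i then m else if l = j then m⁻¹ else 1
  have hD : (torus hij s : Matrix (Fin n) (Fin n) k) = diagonal D := rfl
  have hci : c * g j i = 1 := by
    have h1 : ((g * g⁻¹ : SpecialLinearGroup (Fin n) k) : Matrix (Fin n) (Fin n) k) j j = 1 := by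
      rw [mul_inv_cancel]; simp
    rw [sl_coe_mul, Matrix.mul_apply] at h1
    simp only [hg] at h1
    simpa [mul_comm] using h1
  let q : Fin n → k := fun l => if l = i then 0 else (m - 1) * c * g j l * D l / (D l - m)
  have hq : q ⬝ᵥ (Pi.single i (1 : k)) = 0 := by simp [q]
  let P := rankOne (Pi.single i (1 : k)) q hq
  refine ⟨P, ?_⟩
  rw [eq_mul_inv_iff_mul_eq]
  have hinv : (diagOne j s)⁻¹ = diagOne j s⁻¹ := (map_inv (torusOne j) s).symm
  let E : Fin n → k := fun l => if l = j then m⁻¹ else 1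
  have hM : ∀ p l, (g⁻¹ * diagOne j s * g) p l =
      (s : k)⁻¹ * ((if p = l then 1 else 0) + (m - 1) * (if p = i then c else 0) * g j l) := by
    intro p l
    have h1 : ((g⁻¹ * g : SpecialLinearGroup (Fin n) k) : Matrix (Fin n) (Fin n) k) p l
        = if p = l then 1 else 0 := by
      rw [inv_mul_cancel]; simp [Matrix.one_apply]
    rw [sl_coe_mul, Matrix.mul_apply] at h1
    rw [sl_coe_mul, sl_coe_mul, diagOne_coe, Matrix.mul_apply, ← h1, ← hg p, mul_add,
      Finset.mul_sum]
    have h2 : ∀ x, ((g⁻¹ : SpecialLinearGroup (Fin n) k) * diagonal (fun l => if l = j then (s : k) ^ (n - 1) else (s : k)⁻¹)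
        : Matrix (Fin n) (Fin n) k) p x * g x l =
        (s : k)⁻¹ * ((g⁻¹ : SpecialLinearGroup (Fin n) k) p x * g x l) +
        if x = j then (s : k)⁻¹ * ((m - 1) * (g⁻¹ : SpecialLinearGroup (Fin n) k) p x * g x l) else 0 := by
      intro x
      rw [mul_diagonal, hsm]
      split_ifs <;> ring
    rw [Finset.sum_congr rfl fun x _ => h2 x, Finset.sum_add_distrib]
    simp
  have hN : ∀ p l, (g⁻¹ * diagOne j s * g * (diagOne j s)⁻¹) p l =
      ((if p = l then 1 else 0) + (m - 1) * (if p = i then c else 0) * g j l) * E l := by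
    intro p l
    have hs0 : (s : k) ≠ 0 := s.ne_zero
    rw [hinv, sl_coe_mul _ (diagOne j s⁻¹), diagOne_coe, mul_diagonal, hM]
    by_cases hl : l = j
    · simp only [hl, E, if_true]
      rw [Units.val_inv_eq_inv_val, inv_pow, hsm]
      field_simp
    · simp only [hl, E, if_false]
      rw [Units.val_inv_eq_inv_val, inv_inv]
      field_simp
  apply sl_ext
  ext p l
  rw [sl_coe_mul _ P, sl_coe_mul P, hD, mul_diagonal, rankOne_apply, Matrix.mul_apply]
  have h3 : ∀ x, (g⁻¹ * diagOne j s * g * (diagOne j s)⁻¹) p x * P x l =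
      (if x = l then (g⁻¹ * diagOne j s * g * (diagOne j s)⁻¹) p x else 0) +
      (if x = i then (g⁻¹ * diagOne j s * g * (diagOne j s)⁻¹) p x * q l else 0) := by
    intro x
    rw [rankOne_apply, Pi.single_apply]
    split_ifs <;> simp [mul_add]
  rw [Finset.sum_congr rfl fun x _ => h3 x, Finset.sum_add_distrib]
  simp only [Finset.sum_ite_eq', Finset.mem_univ, if_true]
  rw [hN, hN, Pi.single_apply]
  by_cases hp : p = i
  · subst hp
    simp only [if_true, E, hij, if_false]
    by_cases hl : p = l
    · subst hl
      simp only [q, D, if_true, hij, if_false]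
      linear_combination (m - 1) * hci
    · have hl' : ¬ l = p := fun h => hl h.symm
      have hED : D l = if l = j then m⁻¹ else 1 := by simp [D, hl']
      have hDm : D l - m ≠ 0 := by
        rw [hED]
        split_ifs
        · intro h
          apply hm2
          have : m⁻¹ = m := sub_eq_zero.1 h
          nth_rewrite 1 [← this]
          exact inv_mul_cancel₀ hm0
        · intro h
          apply hm2
          rw [← sub_eq_zero.1 h, one_mul]
      have hql : q l * (D l - m) = (m - 1) * c * g j l * D l := by
        simp only [q, hl', if_false]
        field_simp
      rw [← hED]
      simp only [hl, if_false]
      linear_combination ((m - 1) * q l) * hci - hql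
  · simp only [hp, if_false]
    by_cases hl : p = l
    · subst hl
      simp [E, D, hp]
    · simp [hl]

end SLgroup

section Key

/-- If `T` normalizes `U` and almost all `t u` behave like `t`, then the projection on the
`T`-fixed vectors is `U`-fixed. -/
lemma fix_of_conj {T U H : Type*} [Group T] [Group U] [Infinite T] [Infinite U]
    [NormedAddCommGroup H] [InnerProductSpace ℂ H] [CompleteSpace H]
    {π : T →* (H →L[ℂ] H)} {σ : U →* (H →L[ℂ] H)} (hπ : IsUnitaryRep π) (hσ : IsUnitaryRep σ)
    (hnorm : ∀ t v, (∀ u, σ u v = v) → ∀ u, σ u (π t v) = π t v)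
    (S : Set T) (hS : S.Finite) {ξ ω : H}
    (hf : ∀ t, t ∉ S → ∀ u, inner ℂ ξ (π t (σ u ξ)) = inner ℂ ξ (π t ξ))
    (hω : IsPr π ξ ω) (u : U) : σ u ω = ω := by
  obtain ⟨η, hη⟩ := exists_pr hσ ξ
  have h1 : ∀ t, t ∉ S → inner ℂ ξ (π t η) = inner ℂ ξ (π t ξ) := by
    intro t ht
    have := mean_eq hσ hη ∅ Set.finite_empty (inner ℂ ξ (π t ξ)) (w := π t⁻¹ ξ) (fun u _ => by
      rw [hπ.adj, inv_inv]; exact hf t ht u)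
    rwa [hπ.adj, inv_inv] at this
  obtain ⟨p, hp⟩ := exists_pr hπ (ξ - η)
  have hp0 : p = 0 := by
    apply hp.zero_of
    refine mean_eq hπ hp S hS 0 fun t ht => ?_
    have h2 : inner ℂ ξ (π t (ξ - η)) = 0 := by rw [map_sub, inner_sub_right, h1 t ht, sub_self]
    have h3 : inner ℂ η (π t (ξ - η)) = 0 := by
      have h4 := hη.2 (π t⁻¹ η) (hnorm t⁻¹ η hη.1)
      rw [← inv_inv t, ← hπ.adj, inner_sub_right, h4, sub_self]
    rw [inner_sub_left, h2, h3, sub_self]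
  subst hp0
  obtain ⟨ω', hmem, hω'⟩ := exists_pr_hull hπ η
  have h5 : IsPr π ξ ω' := by
    refine ⟨hω'.1, fun w hw => ?_⟩
    have h6 := hp.2 w hw
    rw [inner_sub_right, inner_zero_right] at h6
    rw [sub_eq_zero.1 h6, hω'.2 w hw]
  obtain rfl := hω.unique h5
  have hsub : closure (convexHull ℝ (Set.range fun t => π t η)) ⊆ {x | σ u x = x} := by
    refine closure_minimal (convexHull_min ?_ ?_) ?_
    · rintro _ ⟨t, rfl⟩
      exact hnorm t η hη.1 u
    · intro x hx y hy a b _ _ _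
      simp only [Set.mem_ofPred_eq] at *
      have e : a • x + b • y = (a : ℂ) • x + (b : ℂ) • y := by simp
      rw [e, map_add, map_smul, map_smul, hx, hy]
    · exact isClosed_eq (σ u).continuous continuous_id
  exact hsub hmem

open Matrix Matrix.SpecialLinearGroup

lemma finite_exc {k : Type*} [Field k] {n : ℕ} (hn : 2 ≤ n) :
    {s : kˣ | (s : k) ^ (2 * n) = 1}.Finite := by
  have : NeZero (2 * n) := ⟨by omega⟩
  have hfin : Finite (rootsOfUnity (2 * n) k) := inferInstance
  have hfin2 : (rootsOfUnity (2 * n) k : Set kˣ).Finite := Set.finite_coe_iff.1 hfin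
  refine hfin2.subset fun s hs => ?_
  simp only [SetLike.mem_coe, mem_rootsOfUnity]
  ext
  simpa using hs

lemma infinite_units (k : Type*) [Field k] [Infinite k] : Infinite kˣ := by
  have h : Infinite {x : k // x ≠ 0} := Set.Infinite.to_subtype (Set.finite_singleton (0:k)).infinite_compl
  exact Infinite.of_injective _ (unitsEquivNeZero (G₀ := k)).symm.injective

variable {k : Type*} [Field k] [Infinite k] {n : ℕ} {H : Type*}
  [NormedAddCommGroup H] [InnerProductSpace ℂ H] [CompleteSpace H]

lemma torus_pr_zero (hn : 2 ≤ n) {L : SpecialLinearGroup (Fin n) k →* (H →L[ℂ] H)}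
    (hL : IsUnitaryRep L) {ξ : H} (h0 : IsPr L ξ 0)
    (hc : ∀ h g, inner ℂ ξ (L (h * g * h⁻¹) ξ) = inner ℂ ξ (L g ξ)) {i j : Fin n} (hij : i ≠ j) :
    IsPr (L.comp (torus hij)) ξ 0 := by
  have := infinite_units k
  obtain ⟨ω, hω⟩ := exists_pr (hL.comp (torus hij)) ξ
  have key : ∀ (p q : Fin n) (hpq : p ≠ q) (a : k), (p = i ∨ p = j ∨ q = i ∨ q = j) →
      L (transvection hpq a) ω = ω := by
    intro p q hpq a hor
    let x : kˣ → k := fun s => if p = i then (s:k)^n else if p = j then ((s:k)^n)⁻¹ else 1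
    let y : kˣ → k := fun s => if q = i then (s:k)^n else if q = j then ((s:k)^n)⁻¹ else 1
    have hx0 : ∀ s, x s ≠ 0 := by
      intro s
      have := pow_ne_zero n s.ne_zero
      simp only [x]
      split_ifs <;> simp
    have hconj : ∀ (s : kˣ) (a b : k), x s * a = b * y s →
      torus hij s * transvection hpq a = transvection hpq b * torus hij s :=
      fun s a b hab => torus_conj hij hpq a s (x s) (y s) rfl rfl b hab
    refine fix_of_conj (hL.comp (torus hij)) (hL.comp (rootHom hpq)) ?_
      {s : kˣ | (s : k) ^ (2 * n) = 1} (finite_exc hn) ?_ hω (Multiplicative.ofAdd a)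
    · intro s v hv b
      have e := hconj s (y s * Multiplicative.toAdd b / x s) (Multiplicative.toAdd b) (by
        have := hx0 s
        field_simp)
      have hv' := hv (Multiplicative.ofAdd (y s * Multiplicative.toAdd b / x s))
      simp only [MonoidHom.comp_apply] at hv' ⊢
      change L (transvection hpq (Multiplicative.toAdd b)) _ = _
      change L (transvection hpq (y s * Multiplicative.toAdd b / x s)) _ = _ at hv'
      rw [← mul_apply_eq_comp, ← map_mul, ← e, map_mul, mul_apply_eq_comp, hv']
    · intro s hs b
      have hs : (s : k) ^ (2 * n) ≠ 1 := hs
      have hm : (s : k) ^ n * (s : k) ^ n ≠ 1 := by rwa [← pow_add, ← two_mul]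
      have hm0 : (s : k) ^ n ≠ 0 := pow_ne_zero n s.ne_zero
      have hyx : y s - x s ≠ 0 := by
        intro h
        apply hm
        have h := sub_eq_zero.1 h
        simp only [x, y] at h
        generalize (s : k) ^ n = m at *
        have : m * m⁻¹ = 1 := mul_inv_cancel₀ hm0
        grind
      set a := Multiplicative.toAdd b with ha
      have e := hconj s (a * y s / (y s - x s)) (a * x s / (y s - x s)) (by ring)
      have e2 : torus hij s * transvection hpq a =
          transvection hpq (a * x s / (y s - x s)) * torus hij s *
            (transvection hpq (a * x s / (y s - x s)))⁻¹ := by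
        rw [← e, transvection_inv, mul_assoc, ← transvection_add]
        congr 2
        field_simp
        ring
      simp only [MonoidHom.comp_apply]
      change inner ℂ ξ (L _ (L (transvection hpq a) ξ)) = _
      rw [← mul_apply_eq_comp, ← map_mul, e2, hc]
  have hall : ∀ g, L g ω = ω := by
    intro g
    refine sl_induction hn (fun g => L g ω = ω) g ?_ ?_
    · intro p q hpq a
      by_cases hp : p = i
      · exact key p q hpq a (Or.inl hp)
      by_cases hq : q = i
      · exact key p q hpq a (Or.inr (Or.inr (Or.inl hq)))
      have hq' : i ≠ q := fun h => hq h.symm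
      have k1 := fun a => key p i hp a (by tauto)
      have k2 := fun a => key i q hq' a (by tauto)
      rw [transvection_comm hp hq' hpq a]
      simp only [map_mul, mul_apply_eq_comp, k1, k2]
    · intro A B hA hB
      rw [map_mul, mul_apply_eq_comp, hB, hA]
  have : ω = 0 := by
    have h1 := h0.2 ω hall
    rw [inner_zero_right] at h1
    have h2 := hω.2 ω hω.1
    rw [h1] at h2
    exact inner_self_eq_zero.1 h2.symm
  rwa [this] at hω

theorem key_vanish (hn : 2 ≤ n) {L α : SpecialLinearGroup (Fin n) k →* (H →L[ℂ] H)}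
    (hL : IsUnitaryRep L) (hα : IsUnitaryRep α) {ξ : H} (h0 : IsPr L ξ 0)
    (hαξ : ∀ g, α g ξ = ξ) (hcomp : ∀ h g v, α h (L g v) = L (h * g * h⁻¹) (α h v))
    (g : SpecialLinearGroup (Fin n) k) (hg : g ∉ Subgroup.center _) :
    inner ℂ ξ (L g ξ) = 0 := by
  have := infinite_units k
  have hc : ∀ h g, inner ℂ ξ (L (h * g * h⁻¹) ξ) = inner ℂ ξ (L g ξ) := by
    intro h g
    rw [← hα h ξ (L g ξ), hcomp, hαξ]
  obtain ⟨h, i, j, hij, c, hc0, hcol⟩ := exists_conj g⁻¹ (fun hh => hg (by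
    simpa using (Subgroup.center _).inv_mem hh))
  rw [← hc h g]
  have hcol' : ∀ p, ((h * g * h⁻¹)⁻¹ : SpecialLinearGroup (Fin n) k) p j = if p = i then c else 0 := by
    intro p
    rw [← hcol p]
    congr 3
    group
  generalize h * g * h⁻¹ = g' at hcol'
  obtain ⟨p, hp⟩ := exists_pr (hα.comp (torusOne j)) (L g' ξ)
  have hp0 : p = 0 := by
    refine pr_zero_of_eq (hα.comp (torusOne j)) (hL.comp (torus hij)) hp
      (torus_pr_zero hn hL h0 hc hij) {s : kˣ | (s : k) ^ (2 * n) = 1} (finite_exc hn) ?_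
    intro s hs
    have hs : (s : k) ^ (2 * n) ≠ 1 := hs
    obtain ⟨P, hP⟩ := commutator_conj g' hij c hcol' s hs
    simp only [MonoidHom.comp_apply]
    change inner ℂ _ (α (diagOne j s) _) = _
    rw [hcomp, hαξ, hL.adj, ← mul_apply_eq_comp, ← map_mul, ← hc P (torus hij s), ← hP]
    congr 3
    group
  rw [hp.2 ξ (fun s => hαξ _), hp0, inner_zero_right]

end Key

lemma isPositiveType_delta {G : Type*} [Group G] [DecidableEq G] :
    IsPositiveType (fun g : G => if g = 1 then (1 : ℂ) else 0) := by
  intro n g c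
  have h1 : ∀ i j, (starRingEnd ℂ) (c i) * c j * (if (g i)⁻¹ * g j = 1 then (1 : ℂ) else 0) =
      ∑ x ∈ Finset.univ.image g, (starRingEnd ℂ) (if g i = x then c i else 0) *
        (if g j = x then c j else 0) := by
    intro i j
    rw [Finset.sum_eq_single (g i)]
    · simp only [if_true, inv_mul_eq_one, eq_comm (a := g i)]
      split_ifs <;> simp
    · intro x _ hx
      simp [hx.symm]
    · intro h
      exact absurd (Finset.mem_image_of_mem g (Finset.mem_univ i)) h
  have h2 : ∑ i, ∑ j, (starRingEnd ℂ) (c i) * c j * (if (g i)⁻¹ * g j = 1 then (1 : ℂ) else 0) =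
      ∑ x ∈ Finset.univ.image g, (starRingEnd ℂ) (∑ i, if g i = x then c i else 0) *
        (∑ i, if g i = x then c i else 0) := by
    simp only [h1]
    rw [Finset.sum_congr rfl fun i _ => Finset.sum_comm, Finset.sum_comm]
    refine Finset.sum_congr rfl fun x _ => ?_
    rw [map_sum, Finset.sum_mul_sum]
  rw [h2]
  exact Finset.sum_nonneg fun x _ => star_mul_self_nonneg _

section Final

lemma pos_prod {G : Type*} [Group G] {φ : G → ℂ} (hpos : IsPositiveType φ)
    (hcentral : ∀ x g : G, φ (g * x * g⁻¹) = φ x) :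
    IsPositiveType (fun x : G × G => φ (x.1 * x.2⁻¹)) := by
  intro n g c
  have h := hpos n (fun i => (g i).1 * (g i).2⁻¹) c
  have e : ∀ i j, φ (((g i)⁻¹ * g j).1 * ((g i)⁻¹ * g j).2⁻¹) =
      φ (((g i).1 * (g i).2⁻¹)⁻¹ * ((g j).1 * (g j).2⁻¹)) := by
    intro i j
    rw [← hcentral _ (g i).2]
    congr 1
    simp only [Prod.fst_mul, Prod.snd_mul, Prod.fst_inv, Prod.snd_inv]
    group
  simp only [e]
  exact h

lemma fixed_of_inner {K H : Type*} [Group K] [NormedAddCommGroup H] [InnerProductSpace ℂ H]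
    {ρ : K →* (H →L[ℂ] H)} (h : IsUnitaryRep ρ) {ξ : H} (g : K)
    (h1 : inner ℂ ξ (ρ g ξ) = 1) (h2 : inner ℂ ξ ξ = (1 : ℂ)) : ρ g ξ = ξ := by
  rw [← sub_eq_zero, ← inner_self_eq_zero (𝕜 := ℂ)]
  have h3 : inner ℂ (ρ g ξ) ξ = (1 : ℂ) := by rw [← inner_conj_symm, h1, map_one]
  rw [inner_sub_left, inner_sub_right, inner_sub_right, h, h1, h2, h3]
  ring

end Final

theorem stmt_12 {k : Type*} [Field k] [Infinite k] (n : ℕ) (hn : 2 ≤ n)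
    (φ : Matrix.SpecialLinearGroup (Fin n) k → ℂ)
    (hpos : IsPositiveType φ) (hone : φ 1 = 1)
    (hcentral : ∀ x g : Matrix.SpecialLinearGroup (Fin n) k, φ (g * x * g⁻¹) = φ x) :
    ∃ t : ℝ, t ∈ Set.Icc (0 : ℝ) 1 ∧
      ∃ ψ : Matrix.SpecialLinearGroup (Fin n) k → ℂ,
        IsPositiveType ψ ∧ ψ 1 = 1 ∧
        (∀ g : Matrix.SpecialLinearGroup (Fin n) k,
          g ∉ Subgroup.center (Matrix.SpecialLinearGroup (Fin n) k) → ψ g = 0) ∧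
        ∀ g : Matrix.SpecialLinearGroup (Fin n) k, φ g = (t : ℂ) + (1 - (t : ℂ)) * ψ g := by
  classical
  obtain ⟨H, _, _, _, π, ξ, hπ, hφ⟩ := gns (pos_prod hpos hcentral)
  let L : Matrix.SpecialLinearGroup (Fin n) k →* (H →L[ℂ] H) := π.comp (MonoidHom.inl _ _)
  let α : Matrix.SpecialLinearGroup (Fin n) k →* (H →L[ℂ] H) :=
    π.comp ((MonoidHom.id _).prod (MonoidHom.id _))
  have hL : IsUnitaryRep L := hπ.comp _
  have hα : IsUnitaryRep α := hπ.comp _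
  have hLφ : ∀ g, inner ℂ ξ (L g ξ) = φ g := by
    intro g
    have := hφ (g, 1)
    simpa [L] using this
  have hξ : inner ℂ ξ ξ = (1 : ℂ) := by
    have := hLφ 1
    rw [map_one, hone] at this
    exact this
  have hαξ : ∀ g, α g ξ = ξ := by
    intro g
    refine fixed_of_inner hα g ?_ hξ
    have := hφ (g, g)
    simp only [mul_inv_cancel, hone] at this
    exact this
  have hcomp : ∀ h g v, α h (L g v) = L (h * g * h⁻¹) (α h v) := by
    intro h g v
    change π (h, h) (π (g, 1) v) = π (h * g * h⁻¹, 1) (π (h, h) v)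
    rw [← mul_apply_eq_comp, ← map_mul, ← mul_apply_eq_comp, ← map_mul]
    simp
  obtain ⟨γ, hγ⟩ := exists_pr hL ξ
  have hfix : ∀ h w, (∀ g, L g w = w) → ∀ g, L g (α h w) = α h w := by
    intro h w hw g
    have := hcomp h (h⁻¹ * g * h) w
    have e : h * (h⁻¹ * g * h) * h⁻¹ = g := by group
    rw [e, hw] at this
    exact this.symm
  have hαγ : ∀ h, α h γ = γ := by
    intro h
    refine IsPr.unique (ρ := L) (v := ξ) ⟨hfix h γ hγ.1, fun w hw => ?_⟩ hγ
    have h1 := hγ.2 _ (hfix h⁻¹ w hw)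
    rw [hα.adj, hα.adj, inv_inv, hαξ] at h1
    exact h1
  set ζ := ξ - γ with hζ
  have hζ0 : IsPr L ζ 0 := by
    refine ⟨fun g => map_zero _, fun w hw => ?_⟩
    rw [hζ, inner_sub_right, hγ.2 w hw, sub_self, inner_zero_right]
  have hαζ : ∀ h, α h ζ = ζ := fun h => by rw [hζ, map_sub, hαξ, hαγ]
  have hγζ : inner ℂ γ ζ = (0 : ℂ) := by rw [hζ0.2 γ hγ.1, inner_zero_right]
  have hζγ : inner ℂ ζ γ = (0 : ℂ) := by rw [← inner_conj_symm, hγζ, map_zero]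
  have hdec : ∀ g, φ g = ((‖γ‖ ^ 2 : ℝ) : ℂ) + inner ℂ ζ (L g ζ) := by
    intro g
    have h1 : ξ = γ + ζ := by rw [hζ]; abel
    have h2 : inner ℂ γ (L g ζ) = (0 : ℂ) := by
      rw [← inv_inv g, ← hL.adj, hγ.1, hγζ]
    rw [← hLφ g, h1, map_add, hγ.1, inner_add_left, inner_add_right, inner_add_right, h2, hζγ,
      inner_self_eq_norm_sq_to_K]
    simp
  have hsum : ‖γ‖ ^ 2 + ‖ζ‖ ^ 2 = 1 := by
    have := hdec 1
    rw [hone, map_one] at this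
    change (1 : ℂ) = _ + inner ℂ ζ ζ at this
    rw [inner_self_eq_norm_sq_to_K] at this
    change (1 : ℂ) = _ + (‖ζ‖ : ℂ) ^ 2 at this
    apply Complex.ofReal_injective
    push_cast at this ⊢
    exact this.symm
  refine ⟨‖γ‖ ^ 2, ⟨by positivity, by nlinarith [sq_nonneg ‖ζ‖]⟩, ?_⟩
  by_cases hz : ζ = 0
  · refine ⟨fun g => if g = 1 then 1 else 0, isPositiveType_delta, by simp, ?_, ?_⟩
    · intro g hg
      have hne : g ≠ 1 := by
        rintro rfl
        exact hg (one_mem _)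
      simp [hne]
    · intro g
      have ht : ‖γ‖ ^ 2 = 1 := by rw [← hsum, hz]; simp
      rw [hdec g, hz, ht]
      simp
  · have hnz : (‖ζ‖ : ℂ) ≠ 0 := by exact_mod_cast norm_ne_zero_iff.2 hz
    have hs : ∀ g, inner ℂ ((‖ζ‖ : ℂ)⁻¹ • ζ) (L g ((‖ζ‖ : ℂ)⁻¹ • ζ)) =
        inner ℂ ζ (L g ζ) / (‖ζ‖ : ℂ) ^ 2 := by
      intro g
      rw [map_smul, inner_smul_left, inner_smul_right, map_inv₀, Complex.conj_ofReal]
      field_simp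
    refine ⟨fun g => inner ℂ ((‖ζ‖ : ℂ)⁻¹ • ζ) (L g ((‖ζ‖ : ℂ)⁻¹ • ζ)),
      isPositiveType_of_rep hL _, ?_, ?_, ?_⟩
    · dsimp only
      rw [hs, map_one]
      change inner ℂ ζ ζ / _ = (1 : ℂ)
      rw [inner_self_eq_norm_sq_to_K]
      exact div_self (pow_ne_zero 2 hnz)
    · intro g hg
      dsimp only
      rw [hs, key_vanish hn hL hα hζ0 hαζ hcomp g hg, zero_div]
    · intro g
      have h1 : (1 : ℂ) - ((‖γ‖ ^ 2 : ℝ) : ℂ) = (‖ζ‖ : ℂ) ^ 2 := by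
        have h := congrArg (fun x : ℝ => (x : ℂ)) hsum
        push_cast at h ⊢
        linear_combination -h
      dsimp only
      rw [hs, hdec g, h1]
      field_simp
end

section
/- Let k be an infinite field, n ≥ 2, and let PSL_n(k) denote the quotient of SL_n(k) by its center. Then every normalized function of positive type on PSL_n(k) that is constant on conjugacy classes is a convex combination of the constant function 1 and δ_e: there exists t ∈ [0,1] such that φ(e) = 1 and φ(g) = t for every g ≠ e. -/
open scoped ComplexOrder

lemma posType_fintype {G : Type*} [Group G] {φ : G → ℂ} (hpos : IsPositiveType φ)
    {ι : Type*} [Fintype ι] (g : ι → G) (c : ι → ℂ) :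
    0 ≤ ∑ i, ∑ j, (starRingEnd ℂ) (c i) * c j * φ ((g i)⁻¹ * g j) := by
  have e := Fintype.equivFin ι
  have h := hpos _ (g ∘ e.symm) (c ∘ e.symm)
  simp only [Function.comp_apply] at h
  rw [e.symm.sum_comp (fun i => ∑ j, (starRingEnd ℂ) (c i) * c (e.symm j) *
    φ ((g i)⁻¹ * g (e.symm j)))] at h
  convert h using 2 with i
  exact (e.symm.sum_comp (fun j => (starRingEnd ℂ) (c i) * c j * φ ((g i)⁻¹ * g j))).symm

lemma posType_herm {G : Type*} [Group G] {φ : G → ℂ} (hpos : IsPositiveType φ)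
    (hone : φ 1 = 1) (g : G) : φ g⁻¹ = (starRingEnd ℂ) (φ g) := by
  have h1 := hpos 2 ![1, g] ![1, 1]
  have h2 := hpos 2 ![1, g] ![1, Complex.I]
  simp [Fin.sum_univ_two, hone, Complex.le_def] at h1 h2
  apply Complex.ext
  · simp; linarith
  · simp; linarith

lemma posType_bessel {G : Type*} [Group G] {φ : G → ℂ} (hpos : IsPositiveType φ)
    (hone : φ 1 = 1) (a b : ℕ → G) (α β κ : ℂ) (ha : ∀ i, φ (a i) = α) (hb : ∀ i, φ (b i) = β)
    (hab : ∀ i, φ ((a i)⁻¹ * b i) = κ)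
    (hoff : ∀ i j, i ≠ j → φ ((a i)⁻¹ * a j) - φ ((a i)⁻¹ * b j) - φ ((b i)⁻¹ * a j)
      + φ ((b i)⁻¹ * b j) = 0) : α = β := by
  have hba : ∀ i, φ ((b i)⁻¹ * a i) = (starRingEnd ℂ) κ := by
    intro i
    rw [← hab i, ← posType_herm hpos hone]; simp
  have key : ∀ N : ℕ, (N : ℝ) * Complex.normSq (α - β) ≤ 2 - 2 * κ.re := by
    intro N
    rcases Nat.eq_zero_or_pos N with rfl | hN
    · have h1 := hpos 2 ![a 0, b 0] ![1, -1]
      simp [Fin.sum_univ_two, hone, Complex.le_def, hab, hba] at h1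
      simp; linarith
    have h := posType_fintype hpos
      (Sum.elim (fun _ : Unit => 1) (Sum.elim (fun i : Fin N => a i) (fun i : Fin N => b i)))
      (Sum.elim (fun _ => -(N : ℂ) * (α - β)) (Sum.elim (fun _ => 1) (fun _ => -1)))
    simp only [Fintype.sum_sum_type, Sum.elim_inl, Sum.elim_inr, Finset.univ_unique,
      Finset.card_singleton, one_smul, inv_one, one_mul, mul_one, hone, ha, hb,
      posType_herm hpos hone, Finset.sum_const, Finset.card_univ, Fintype.card_fin,
      Finset.sum_add_distrib] at h
    have hG : ∑ i : Fin N, ∑ j : Fin N, (φ ((a i)⁻¹ * a j) - φ ((a i)⁻¹ * b j)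
        - φ ((b i)⁻¹ * a j) + φ ((b i)⁻¹ * b j)) = N * (2 - κ - (starRingEnd ℂ) κ) := by
      have : ∀ i : Fin N, ∑ j : Fin N, (φ ((a i)⁻¹ * a j) - φ ((a i)⁻¹ * b j)
        - φ ((b i)⁻¹ * a j) + φ ((b i)⁻¹ * b j)) = 2 - κ - (starRingEnd ℂ) κ := by
        intro i
        rw [Finset.sum_eq_single i]
        · simp [hab, hba, hone]; ring
        · intro j _ hj
          exact hoff _ _ (fun h => hj (Fin.ext h.symm))
        · simp
      simp only [this, Finset.sum_const, Finset.card_univ, Fintype.card_fin, nsmul_eq_mul]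
    simp only [Finset.sum_add_distrib, Finset.sum_sub_distrib] at hG
    simp only [map_neg, map_mul, map_sub, map_one, one_mul, mul_one, neg_mul, mul_neg,
      Finset.sum_neg_distrib, neg_neg, map_natCast, nsmul_eq_mul] at h
    have h' : (0:ℂ) ≤ -(N : ℂ) ^ 2 * ((α - β) * (starRingEnd ℂ) (α - β))
        + N * (2 - κ - (starRingEnd ℂ) κ) := by
      rw [← hG]
      convert h using 1
      rw [map_sub]
      ring
    rw [Complex.mul_conj] at h'
    have h2 := (Complex.le_def.1 h').1
    have h3 : (-(N : ℂ) ^ 2 * ((Complex.normSq (α - β) : ℝ) : ℂ)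
        + N * (2 - κ - (starRingEnd ℂ) κ)) = (((-(N : ℝ) ^ 2 * Complex.normSq (α - β)
        + N * (2 - 2 * κ.re) : ℝ)) : ℂ) := by
      apply Complex.ext
      · simp [← Complex.ofReal_natCast, ← Complex.ofReal_pow]
        ring_nf
        simp
      · simp [← Complex.ofReal_natCast, ← Complex.ofReal_pow]
    rw [h3] at h2
    simp only [Complex.zero_re, Complex.ofReal_re] at h2
    have hN' : (0 : ℝ) < N := by exact_mod_cast hN
    by_contra hcon
    push Not at hcon
    nlinarith [mul_lt_mul_of_pos_left hcon hN']
  have h0 : Complex.normSq (α - β) = 0 := by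
    by_contra hne
    have hp : 0 < Complex.normSq (α - β) := lt_of_le_of_ne (Complex.normSq_nonneg _) (Ne.symm hne)
    obtain ⟨N, hN⟩ := exists_nat_gt ((2 - 2 * κ.re) / Complex.normSq (α - β))
    rw [div_lt_iff₀ hp] at hN
    linarith [key N]
  exact sub_eq_zero.1 (Complex.normSq_eq_zero.1 h0)

open Matrix in
lemma det_one_add_vmv {k : Type*} [Field k] {n : ℕ} (v l : Fin n → k) :
    (1 + vecMulVec v l).det = 1 + l ⬝ᵥ v := by
  rw [vecMulVec_eq Unit, det_one_add_replicateCol_mul_replicateRow]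

/-- The underlying matrix. -/
def slm {k : Type*} [Field k] {n : ℕ} (x : Matrix.SpecialLinearGroup (Fin n) k) :
    Matrix (Fin n) (Fin n) k := x

lemma slm_ext {k : Type*} [Field k] {n : ℕ} {x y : Matrix.SpecialLinearGroup (Fin n) k}
    (h : slm x = slm y) : x = y := Subtype.ext h

lemma slm_mul {k : Type*} [Field k] {n : ℕ} (x y : Matrix.SpecialLinearGroup (Fin n) k) :
    slm (x * y) = slm x * slm y := Matrix.SpecialLinearGroup.coe_mul x y

lemma slm_one {k : Type*} [Field k] {n : ℕ} :
    slm (1 : Matrix.SpecialLinearGroup (Fin n) k) = 1 := rfl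

lemma slm_inv_mul {k : Type*} [Field k] {n : ℕ} (x : Matrix.SpecialLinearGroup (Fin n) k) :
    slm x⁻¹ * slm x = 1 := by rw [← slm_mul, inv_mul_cancel, slm_one]

lemma slm_mul_inv {k : Type*} [Field k] {n : ℕ} (x : Matrix.SpecialLinearGroup (Fin n) k) :
    slm x * slm x⁻¹ = 1 := by rw [← slm_mul, mul_inv_cancel, slm_one]

/-- The transvection `1 + v lᵀ`. -/
def tv {k : Type*} [Field k] {n : ℕ} (v l : Fin n → k) (h : l ⬝ᵥ v = 0) :
    Matrix.SpecialLinearGroup (Fin n) k :=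
  ⟨1 + Matrix.vecMulVec v l, by rw [det_one_add_vmv, h, add_zero]⟩

lemma slm_tv {k : Type*} [Field k] {n : ℕ} (v l : Fin n → k) (h : l ⬝ᵥ v = 0) :
    slm (tv v l h) = 1 + Matrix.vecMulVec v l := rfl

open Matrix in
lemma tv_mul {k : Type*} [Field k] {n : ℕ} (v l m : Fin n → k) (h : l ⬝ᵥ v = 0)
    (h' : m ⬝ᵥ v = 0) : tv v l h * tv v m h' = tv v (l + m) (by simp [h, h']) := by
  apply slm_ext
  simp only [slm_tv, slm_mul]
  rw [mul_add, add_mul, add_mul, vecMulVec_mul_vecMulVec, h, vecMulVec_add]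
  simp [add_assoc]

open Matrix in
lemma tv_inv {k : Type*} [Field k] {n : ℕ} (v l : Fin n → k) (h : l ⬝ᵥ v = 0) :
    (tv v l h)⁻¹ = tv v (-l) (by simp [h]) := by
  rw [inv_eq_iff_mul_eq_one, tv_mul]
  apply slm_ext
  simp [slm_tv, slm_one]

open Matrix in
lemma tv_conj {k : Type*} [Field k] {n : ℕ} (x : SpecialLinearGroup (Fin n) k)
    (v l : Fin n → k) (h : l ⬝ᵥ v = 0) :
    ∃ h', x * tv v l h * x⁻¹ = tv (slm x *ᵥ v) (l ᵥ* (slm x⁻¹)) h' := by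
  refine ⟨?_, ?_⟩
  · rw [← dotProduct_mulVec, mulVec_mulVec, slm_inv_mul, one_mulVec, h]
  · apply slm_ext
    simp only [slm_tv, slm_mul]
    rw [mul_add, add_mul, mul_one, slm_mul_inv, mul_vecMulVec, vecMulVec_mul]

open Matrix in
lemma sepvec {k : Type*} [Field k] {n : ℕ} (v w : Fin n → k) (hv : v ≠ 0)
    (hw : ∀ c : k, w ≠ c • v) : ∃ f : Fin n → k, f ⬝ᵥ v = 1 ∧ f ⬝ᵥ w = 0 := by
  obtain ⟨i, hi⟩ := Function.ne_iff.1 hv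
  simp only [Pi.zero_apply] at hi
  obtain ⟨j, hj⟩ := Function.ne_iff.1 (hw (w i / v i))
  have hne : w j * v i - w i * v j ≠ 0 := by
    intro h0
    apply hj
    simp only [Pi.smul_apply, smul_eq_mul]
    field_simp
    linear_combination h0
  refine ⟨(w j * v i - w i * v j)⁻¹ • (Pi.single i (w j) - Pi.single j (w i)), ?_, ?_⟩
  · rw [smul_dotProduct, sub_dotProduct, single_dotProduct, single_dotProduct, smul_eq_mul,
      inv_mul_cancel₀ hne]
  · rw [smul_dotProduct, sub_dotProduct, single_dotProduct, single_dotProduct, smul_eq_mul]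
    ring

open Matrix in
lemma exists_H {k : Type*} [Field k] {n : ℕ} (v f : Fin n → k) (hfv : f ⬝ᵥ v = 1) :
    ∃ H : kˣ →* SpecialLinearGroup (Fin n) k, ∀ ν : kˣ,
      slm (H ν) = (ν : k) • (1 + vecMulVec v ((((ν : k)⁻¹) ^ n - 1) • f)) := by
  have hdet : ∀ ν : kˣ, ((ν : k) • (1 + vecMulVec v ((((ν : k)⁻¹) ^ n - 1) • f))).det = 1 := by
    intro ν
    rw [det_smul, det_one_add_vmv, smul_dotProduct, hfv]
    simp
  let H : kˣ → SpecialLinearGroup (Fin n) k := fun ν => ⟨_, hdet ν⟩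
  have hH : ∀ ν, slm (H ν) = (ν : k) • (1 + vecMulVec v ((((ν : k)⁻¹) ^ n - 1) • f)) :=
    fun _ => rfl
  refine ⟨MonoidHom.mk' H ?_, hH⟩
  · intro a b
    apply slm_ext
    simp only [slm_mul, hH]
    rw [smul_mul_smul_comm, mul_add, add_mul, add_mul, vecMulVec_mul_vecMulVec, smul_dotProduct, hfv]
    simp only [Units.val_mul, mul_one, one_mul]
    congr 1
    rw [add_assoc, ← vecMulVec_add, ← vecMulVec_add]
    congr 2
    ext i
    simp [mul_pow]
    ring

open Matrix in
lemma H_mulVec {k : Type*} [Field k] {n : ℕ} (v f x : Fin n → k) (a b : k) :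
    (a • (1 + vecMulVec v (b • f))) *ᵥ x = a • (x + (b * (f ⬝ᵥ x)) • v) := by
  rw [smul_mulVec, add_mulVec, one_mulVec, vecMulVec_mulVec, smul_dotProduct,
    op_smul_eq_smul, smul_eq_mul]

open Matrix in
lemma H_vecMul {k : Type*} [Field k] {n : ℕ} (v f x : Fin n → k) (a b : k) :
    x ᵥ* (a • (1 + vecMulVec v (b • f))) = a • (x + (b * (x ⬝ᵥ v)) • f) := by
  rw [vecMul_smul, vecMul_add, vecMul_one, vecMul_vecMulVec, smul_smul, mul_comm]

open Matrix in
lemma conj_solve {k : Type*} [Field k] {n : ℕ} (d : SpecialLinearGroup (Fin n) k)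
    (v p m : Fin n → k) (c : k) (hp : p ⬝ᵥ v = 0) (hm : m ⬝ᵥ v = 0)
    (hdv : slm d *ᵥ v = c • v) (hpd : p ᵥ* slm d = c • p - c • m) :
    tv v p hp * (d * tv v m hm) * (tv v p hp)⁻¹ = d := by
  rw [mul_inv_eq_iff_eq_mul]
  apply slm_ext
  simp only [slm_tv, slm_mul]
  have e1 : slm d * (1 + vecMulVec v m) = slm d + c • vecMulVec v m := by
    rw [mul_add, mul_one, mul_vecMulVec, hdv, smul_vecMulVec]
  have e2 : slm d * (1 + vecMulVec v p) = slm d + c • vecMulVec v p := by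
    rw [mul_add, mul_one, mul_vecMulVec, hdv, smul_vecMulVec]
  rw [e1, e2, add_mul, one_mul, mul_add, vecMulVec_mul, hpd, mul_smul_comm,
    vecMulVec_mul_vecMulVec, hp, zero_smul, vecMulVec_zero, vecMulVec_sub, vecMulVec_smul,
    vecMulVec_smul]
  simp

lemma exists_units {k : Type*} [Field k] [Infinite k] (N : ℕ) (hN : 0 < N) :
    ∃ ν : ℕ → kˣ, ∀ i j, i ≠ j → ((ν i)⁻¹ * ν j) ^ N ≠ 1 := by
  have hinf : (Set.range (fun x : k => x ^ N)).Infinite := by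
    intro hfin
    have : (Set.univ : Set k).Finite := by
      refine Set.Finite.of_finite_fibers (f := fun x : k => x ^ N) (by simpa using hfin) ?_
      rintro y -
      have h1 : (Polynomial.nthRootsFinset N (y : k) : Set k).Finite := Finset.finite_toSet _
      refine h1.subset ?_
      intro x hx
      simp only [Finset.mem_coe, Polynomial.mem_nthRootsFinset hN]
      exact hx.2
    exact Set.infinite_univ this
  have hinf2 := hinf.sdiff (Set.finite_singleton (0 : k))
  obtain e := hinf2.natEmbedding
  choose x hx using fun i => (e i).2.1
  have hx0 : ∀ i, x i ≠ 0 := by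
    intro i h0
    apply (e i).2.2
    rw [← hx i]
    simp [h0, hN.ne']
  refine ⟨fun i => Units.mk0 (x i) (hx0 i), fun i j hij h => hij ?_⟩
  apply e.injective
  apply Subtype.ext
  rw [← hx i, ← hx j]
  rw [mul_pow, inv_pow, inv_mul_eq_one] at h
  simpa using congrArg Units.val h

open Matrix in
lemma core_conj {k : Type*} [Field k] {n : ℕ} (g : SpecialLinearGroup (Fin n) k)
    (v f : Fin n → k) (hfv : f ⬝ᵥ v = 1) (hfg : f ⬝ᵥ (slm g *ᵥ v) = 0)
    (H : kˣ →* SpecialLinearGroup (Fin n) k)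
    (hH : ∀ ν : kˣ, slm (H ν) = (ν : k) • (1 + vecMulVec v ((((ν : k)⁻¹) ^ n - 1) • f)))
    (μ : kˣ) (hμ : μ ^ (2 * n) ≠ 1) (m : Fin n → k) (hm : m ⬝ᵥ v = 0) :
    ∃ x : SpecialLinearGroup (Fin n) k,
      x * (g⁻¹ * H μ * g * (H μ)⁻¹ * tv v m hm) * x⁻¹ = g⁻¹ * H μ * g * (H μ)⁻¹ := by
  set c : k := (μ : k) ^ n with hc
  have hμ0 : (μ : k) ≠ 0 := μ.ne_zero
  have hc0 : c ≠ 0 := pow_ne_zero _ hμ0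
  have hc2 : c ^ 2 ≠ 1 := by
    intro h
    apply hμ
    apply Units.ext
    rw [Units.val_pow_eq_pow_val, mul_comm, pow_mul, ← hc, h, Units.val_one]
  have hc1 : c - 1 ≠ 0 := by
    intro h; apply hc2; rw [sub_eq_zero.1 h]; simp
  have hc1' : c + 1 ≠ 0 := by
    intro h; apply hc2; rw [eq_neg_of_add_eq_zero_left h]; simp
  set a := slm g⁻¹ *ᵥ v with ha
  set b := f ᵥ* slm g with hb
  have hbv : b ⬝ᵥ v = 0 := by rw [hb, ← dotProduct_mulVec, hfg]
  have hba : b ⬝ᵥ a = 1 := by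
    rw [hb, ha, ← dotProduct_mulVec, mulVec_mulVec, slm_mul_inv, one_mulVec, hfv]
  set s := m ⬝ᵥ a with hs
  set t : k := c ^ 2 / ((c - 1) * (c + 1)) * s with ht
  set p : Fin n → k := (c - 1)⁻¹ • (c • m + ((c⁻¹ - 1) * t) • b) with hp
  have hpv : p ⬝ᵥ v = 0 := by
    simp [hp, hm, hbv]
  have hpa : p ⬝ᵥ a = t := by
    simp only [hp, smul_dotProduct, add_dotProduct, hba, ← hs, smul_eq_mul]
    rw [ht]
    field_simp
    ring
  have hinv : slm (H μ)⁻¹ = ((μ : k)⁻¹) • (1 + vecMulVec v ((c - 1) • f)) := by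
    rw [← map_inv, hH]
    simp [hc]
  have hHμ : slm (H μ) = (μ : k) • (1 + vecMulVec v ((c⁻¹ - 1) • f)) := by
    rw [hH, hc, inv_pow]
  refine ⟨tv v p hpv, conj_solve _ v p m c hpv hm ?_ ?_⟩
  · rw [slm_mul, slm_mul, slm_mul, ← mulVec_mulVec, ← mulVec_mulVec, ← mulVec_mulVec, hinv,
      H_mulVec, hfv, mulVec_smul, mulVec_add, mulVec_smul, hHμ, H_mulVec]
    simp only [dotProduct_smul, dotProduct_add, hfg, smul_zero, add_zero, mul_zero, zero_smul,
      mulVec_smul, mulVec_add, mulVec_mulVec, slm_inv_mul, one_mulVec]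
    ext i
    simp
    field_simp
    ring
  · have hfb : (((c⁻¹ - 1) * t) • f) ᵥ* slm g = ((c⁻¹ - 1) * t) • b := by rw [smul_vecMul]
    have hz : ((μ : k) • (p + ((c⁻¹ - 1) * t) • b)) ⬝ᵥ v = 0 := by
      rw [smul_dotProduct, add_dotProduct, hpv, smul_dotProduct, hbv]; simp
    rw [slm_mul, slm_mul, slm_mul, ← vecMul_vecMul, ← vecMul_vecMul, ← vecMul_vecMul, hHμ,
      H_vecMul, ← dotProduct_mulVec, ← ha, hpa, smul_vecMul, add_vecMul, vecMul_vecMul,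
      slm_inv_mul, vecMul_one, hfb, hinv, H_vecMul, hz]
    ext i
    simp [hp]
    field_simp
    ring

open Matrix in
lemma core {k : Type*} [Field k] [Infinite k] {n : ℕ}
    {ψ : SpecialLinearGroup (Fin n) k → ℂ} (hpos : IsPositiveType ψ) (hone : ψ 1 = 1)
    (hcent : ∀ x g, ψ (g * x * g⁻¹) = ψ x)
    (g : SpecialLinearGroup (Fin n) k) (v l : Fin n → k) (hl : l ⬝ᵥ v = 0)
    (hgv : ∀ c : k, slm g *ᵥ v ≠ c • v) : ψ g = ψ (g * tv v l hl) := by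
  have hv : v ≠ 0 := by
    rintro rfl
    exact hgv 0 (by simp)
  have hn : 0 < n := by
    rcases Nat.eq_zero_or_pos n with rfl | h
    · exact absurd (Subsingleton.elim v 0) hv
    · exact h
  obtain ⟨f, hfv, hfg⟩ := sepvec v (slm g *ᵥ v) hv hgv
  obtain ⟨H, hH⟩ := exists_H v f hfv
  obtain ⟨ν, hν⟩ := exists_units (k := k) (2 * n) (by omega)
  have main : ∀ μ : kˣ, μ ^ (2 * n) ≠ 1 → ∀ m hm,
      ψ (g⁻¹ * H μ * g * (H μ)⁻¹ * tv v m hm) = ψ (g⁻¹ * H μ * g * (H μ)⁻¹) := by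
    intro μ hμ m hm
    obtain ⟨x, hx⟩ := core_conj g v f hfv hfg H hH μ hμ m hm
    rw [← hcent _ x, hx]
  have hconjτ : ∀ μ : kˣ, ∃ m hm, H μ * tv v l hl * (H μ)⁻¹ = tv v m hm := by
    intro μ
    obtain ⟨h', hh⟩ := tv_conj (H μ) v l hl
    refine ⟨((μ : k) * ((μ : k)⁻¹ ^ n)) • (l ᵥ* slm (H μ)⁻¹), ?_, ?_⟩
    · rw [← map_inv, hH, H_vecMul, hl]
      simp [hl]
    · rw [hh]
      apply slm_ext
      rw [slm_tv, slm_tv, vecMulVec_smul, ← smul_vecMulVec, hH, H_mulVec, hfv]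
      congr 2
      ext i
      simp
      ring
  set τ := tv v l hl with hτ
  have tr : ∀ x y z : SpecialLinearGroup (Fin n) k, ∀ i j,
      ψ ((H (ν i) * x * (H (ν i))⁻¹)⁻¹ * (H (ν j) * y * (H (ν j))⁻¹)) =
      ψ (x⁻¹ * H ((ν i)⁻¹ * ν j) * y * (H ((ν i)⁻¹ * ν j))⁻¹) := by
    intro x y z i j
    rw [← hcent _ (H (ν i))⁻¹]
    congr 1
    rw [map_mul, map_inv]
    group
  refine posType_bessel hpos hone (fun i => H (ν i) * g * (H (ν i))⁻¹)
    (fun i => H (ν i) * (g * τ) * (H (ν i))⁻¹) _ _ (ψ τ) (fun i => hcent _ _)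
    (fun i => hcent _ _) ?_ ?_
  · intro i
    rw [← hcent τ (H (ν i))]
    congr 1
    group
  · intro i j hij
    rw [tr _ _ 1, tr _ _ 1, tr _ _ 1, tr _ _ 1]
    have hμ := hν i j hij
    generalize (ν i)⁻¹ * ν j = μ at hμ
    obtain ⟨m, hm, hmm⟩ := hconjτ μ
    have e1 : ψ (g⁻¹ * H μ * (g * τ) * (H μ)⁻¹) = ψ (g⁻¹ * H μ * g * (H μ)⁻¹) := by
      rw [← main μ hμ m hm, ← hmm]
      congr 1
      group
    have e2 : ψ ((g * τ)⁻¹ * H μ * g * (H μ)⁻¹) = ψ (g⁻¹ * H μ * g * (H μ)⁻¹) := by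
      rw [← main μ hμ (-l) (by simp [hl]), ← tv_inv v l hl, ← hτ, ← hcent _ τ]
      congr 1
      group
    have e3 : ψ ((g * τ)⁻¹ * H μ * (g * τ) * (H μ)⁻¹) = ψ (g⁻¹ * H μ * g * (H μ)⁻¹) := by
      rw [← main μ hμ (m + -l) (by simp [hl, hm]), ← tv_mul v m (-l) hm (by simp [hl]),
        ← tv_inv v l hl, ← hτ, ← hmm, ← hcent _ τ]
      congr 1
      group
    rw [e1, e2, e3]
    ring

open Matrix in
/-- Over an infinite field, two non-scalar matrices have a common non-eigenvector. -/
lemma exists_non_eigen {k : Type*} [Field k] [Infinite k] {n : ℕ}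
    (A B : Matrix (Fin n) (Fin n) k) (hA : ∀ c : k, A ≠ c • 1) (hB : ∀ c : k, B ≠ c • 1) :
    ∃ v : Fin n → k, (∀ c : k, A *ᵥ v ≠ c • v) ∧ (∀ c : k, B *ᵥ v ≠ c • v) := by
  classical
  have hfin : ∀ M : Matrix (Fin n) (Fin n) k,
      (Set.range (Module.End.eigenspace (toLin' M))).Finite := by
    intro M
    have h1 := Module.End.finite_hasEigenvalue (toLin' M)
    refine ((h1.image (Module.End.eigenspace (toLin' M))).union (Set.finite_singleton ⊥)).subset ?_
    rintro _ ⟨c, rfl⟩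
    by_cases h : Module.End.eigenspace (toLin' M) c = ⊥
    · right; exact h
    · left; exact ⟨c, h, rfl⟩
  have htop : ∀ M : Matrix (Fin n) (Fin n) k, (∀ c : k, M ≠ c • 1) →
      ⊤ ∉ Set.range (Module.End.eigenspace (toLin' M)) := by
    rintro M hM ⟨c, hc⟩
    apply hM c
    apply toLin'.injective
    apply LinearMap.ext
    intro x
    have hx : x ∈ Module.End.eigenspace (toLin' M) c := by rw [hc]; trivial
    rw [Module.End.mem_eigenspace_iff] at hx
    rw [hx]; simp
  let s := (hfin A).toFinset ∪ (hfin B).toFinset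
  have hs : ⊤ ∉ s := by
    simp only [s, Finset.mem_union, Set.Finite.mem_toFinset, not_or]
    exact ⟨htop A hA, htop B hB⟩
  have := Subspace.biUnion_ne_univ_of_top_notMem hs
  obtain ⟨v, hv⟩ := (Set.ne_univ_iff_exists_notMem _).1 this
  simp only [Set.mem_iUnion, not_exists] at hv
  refine ⟨v, fun c hc => ?_, fun c hc => ?_⟩
  · refine hv (Module.End.eigenspace (toLin' A) c) ?_ ?_
    · simp [s]
    · simpa [Module.End.mem_eigenspace_iff] using hc
  · refine hv (Module.End.eigenspace (toLin' B) c) ?_ ?_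
    · simp [s]
    · simpa [Module.End.mem_eigenspace_iff] using hc

lemma mem_center_of_scalar {k : Type*} [Field k] {n : ℕ}
    (g : Matrix.SpecialLinearGroup (Fin n) k) (c : k) (h : slm g = c • 1) :
    g ∈ Subgroup.center (Matrix.SpecialLinearGroup (Fin n) k) := by
  rw [Subgroup.mem_center_iff]
  intro x
  apply slm_ext
  rw [slm_mul, slm_mul, h]
  simp

open Matrix in
lemma step {k : Type*} [Field k] [Infinite k] {n : ℕ}
    {ψ : SpecialLinearGroup (Fin n) k → ℂ} (hpos : IsPositiveType ψ) (hone : ψ 1 = 1)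
    (hcent : ∀ x g, ψ (g * x * g⁻¹) = ψ x)
    (g : SpecialLinearGroup (Fin n) k) (v l : Fin n → k) (hl : l ⬝ᵥ v = 0)
    (hg : g ∉ Subgroup.center (SpecialLinearGroup (Fin n) k))
    (hgt : g * tv v l hl ∉ Subgroup.center (SpecialLinearGroup (Fin n) k)) :
    ψ g = ψ (g * tv v l hl) := by
  by_cases hgv : ∀ c : k, slm g *ᵥ v ≠ c • v
  · exact core hpos hone hcent g v l hl hgv
  push Not at hgv
  obtain ⟨c, hc⟩ := hgv
  by_cases hv : v = 0
  · have : tv v l hl = 1 := by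
      apply slm_ext
      rw [slm_tv, slm_one, hv]
      simp
    rw [this, mul_one]
  set τ := tv v l hl with hτ
  have hτg : τ * g ∉ Subgroup.center (SpecialLinearGroup (Fin n) k) := by
    intro h
    apply hgt
    have h2 := (Subgroup.mem_center_iff.1 h) τ
    have h3 : g * τ = τ * g := by
      have : τ * (g * τ) = τ * (τ * g) := by rw [h2]; group
      exact mul_left_cancel this
    rw [h3]; exact h
  obtain ⟨w, hw1, hw2⟩ := exists_non_eigen (slm g) (slm (τ * g))
    (fun c h => hg (mem_center_of_scalar _ c h)) (fun c h => hτg (mem_center_of_scalar _ c h))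
  have hwv : ∀ d : k, w ≠ d • v := by
    rintro d rfl
    apply hw1 c
    rw [mulVec_smul, hc, smul_comm]
  obtain ⟨f, hfv, hfw⟩ := sepvec v w hv hwv
  have h1 : ψ g = ψ (g * tv w f hfw) := core hpos hone hcent g w f hfw hw1
  set σ := tv w f hfw with hσ
  have h2 : ψ (g * σ) = ψ (g * σ * τ) := by
    apply core hpos hone hcent
    intro d hd
    have hσv : slm σ *ᵥ v = v + w := by
      rw [hσ, slm_tv, add_mulVec, one_mulVec, vecMulVec_mulVec, hfv]
      simp
    rw [slm_mul, ← mulVec_mulVec, hσv, mulVec_add, hc] at hd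
    have hgw : slm g *ᵥ w = (d - c) • v := by
      rw [sub_smul, ← hd]; simp
    have hwe : w = (d - c) • (slm g⁻¹ *ᵥ v) := by
      rw [← mulVec_smul, ← hgw, mulVec_mulVec, slm_inv_mul, one_mulVec]
    have hve : v = c • (slm g⁻¹ *ᵥ v) := by
      rw [← mulVec_smul, ← hc, mulVec_mulVec, slm_inv_mul, one_mulVec]
    have hc0 : c ≠ 0 := by
      rintro rfl
      apply hv; rw [hve, zero_smul]
    apply hwv ((d - c) * c⁻¹)
    rw [mul_smul]
    conv_rhs => rw [hve]
    rw [smul_smul c⁻¹ c, inv_mul_cancel₀ hc0, one_smul]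
    exact hwe
  have h3 : ψ (g * τ) = ψ (g * σ * τ) := by
    obtain ⟨h', hh⟩ := tv_conj τ⁻¹ w f hfw
    have e : g * σ * τ = g * τ * (τ⁻¹ * σ * τ⁻¹⁻¹) := by group
    rw [e, hσ, hh]
    apply core hpos hone hcent
    intro d hd
    apply hw2 d
    rw [mulVec_mulVec, ← slm_mul, mul_inv_cancel_right] at hd
    rw [slm_mul, ← mulVec_mulVec, hd, mulVec_smul, mulVec_mulVec, slm_mul_inv, one_mulVec]
  rw [h1, h2, h3]

/-- The subgroup generated by transvections. -/
def tvK (k : Type*) [Field k] (n : ℕ) : Subgroup (Matrix.SpecialLinearGroup (Fin n) k) :=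
  Subgroup.closure {x | ∃ v l, ∃ h, x = tv v l h}

/-- The elementary transvection. -/
def elt {k : Type*} [Field k] {n : ℕ} (i j : Fin n) (hij : i ≠ j) (x : k) :
    Matrix.SpecialLinearGroup (Fin n) k :=
  tv (Pi.single i x) (Pi.single j 1) (by simp [hij])

open Matrix in
lemma slm_elt {k : Type*} [Field k] {n : ℕ} (i j : Fin n) (hij : i ≠ j) (x : k) :
    slm (elt i j hij x) = 1 + x • single i j 1 := by
  rw [elt, slm_tv]
  congr 1
  ext a b
  rw [vecMulVec_apply, Matrix.smul_apply, Matrix.single_apply, Pi.single_apply, Pi.single_apply]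
  by_cases h1 : a = i
  · by_cases h2 : b = j
    · simp [h1, h2]
    · simp [h2, Ne.symm h2]
  · simp [h1, Ne.symm h1]

lemma elt_mem {k : Type*} [Field k] {n : ℕ} (i j : Fin n) (hij : i ≠ j) (x : k) :
    elt i j hij x ∈ tvK k n := Subgroup.subset_closure ⟨_, _, _, rfl⟩

open Matrix in
lemma list_mem {k : Type*} [Field k] {n : ℕ} (L : List (TransvectionStruct (Fin n) k)) :
    ∃ x ∈ tvK k n, slm x = (L.map TransvectionStruct.toMatrix).prod := by
  induction L with
  | nil => exact ⟨1, one_mem _, by simp [slm_one]⟩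
  | cons t L ih =>
    obtain ⟨x, hx, hxe⟩ := ih
    refine ⟨elt t.i t.j t.hij t.c * x, mul_mem (elt_mem _ _ _ _) hx, ?_⟩
    rw [slm_mul, slm_elt, hxe]
    simp [TransvectionStruct.toMatrix, transvection]

open Matrix in
lemma h_mem {k : Type*} [Field k] {n : ℕ} (i j : Fin n) (hij : i ≠ j) (x : k) (hx : x ≠ 0) :
    ∃ y ∈ tvK k n, slm y = 1 + (x - 1) • single i i 1 + (x⁻¹ - 1) • single j j 1 := by
  refine ⟨(elt i j hij (x - 1) * elt j i hij.symm 1) * (elt i j hij (x⁻¹ - 1) *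
    elt j i hij.symm (-x)), mul_mem (mul_mem (elt_mem _ _ _ _) (elt_mem _ _ _ _))
      (mul_mem (elt_mem _ _ _ _) (elt_mem _ _ _ _)), ?_⟩
  have key : ∀ p q : k, slm (elt i j hij p * elt j i hij.symm q) =
      1 + p • single i j 1 + q • single j i 1 + (p * q) • single i i 1 := by
    intro p q
    rw [slm_mul, slm_elt, slm_elt, mul_add, add_mul, add_mul, smul_mul_smul_comm,
      single_mul_single_same]
    simp only [mul_one, one_mul]
    abel
  rw [slm_mul, key, key]
  simp only [mul_add, add_mul, smul_mul_smul_comm, single_mul_single_same, mul_one, one_mul,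
    single_mul_single_of_ne _ _ _ _ hij, single_mul_single_of_ne _ _ _ _ hij.symm, smul_zero,
    add_zero, zero_add]
  match_scalars <;> field_simp <;> ring

open Matrix Classical in
lemma diag_mem {k : Type*} [Field k] {n : ℕ} (N : ℕ) : ∀ (D : Fin n → k)
    (d : SpecialLinearGroup (Fin n) k), slm d = diagonal D →
    (Finset.univ.filter (fun i => D i ≠ 1)).card ≤ N → d ∈ tvK k n := by
  induction N with
  | zero =>
    intro D d hd hN
    have h1 : d = 1 := by
      apply slm_ext
      rw [hd, slm_one, ← diagonal_one]
      congr 1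
      ext i
      by_contra h
      have : i ∈ (Finset.univ.filter (fun i => D i ≠ 1)) := by simpa using h
      rw [Finset.card_eq_zero.1 (Nat.le_zero.1 hN)] at this
      simp at this
    rw [h1]; exact one_mem _
  | succ N ih =>
    intro D d hd hN
    have hdet : ∏ i, D i = 1 := by
      rw [← det_diagonal, ← hd]; exact d.2
    have hD0 : ∀ i, D i ≠ 0 := by
      intro i hi
      rw [Finset.prod_eq_zero (Finset.mem_univ i) hi] at hdet
      exact zero_ne_one hdet
    by_cases hall : ∀ i, D i = 1
    · apply ih D d hd
      simp [hall]
    push Not at hall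
    obtain ⟨i, hi⟩ := hall
    have : ∃ j, j ≠ i ∧ D j ≠ 1 := by
      by_contra hcon
      push Not at hcon
      rw [Finset.prod_eq_single i (fun j _ h => hcon j h) (by simp)] at hdet
      exact hi hdet
    obtain ⟨j, hji, hj⟩ := this
    obtain ⟨y, hy, hye⟩ := h_mem i j hji.symm (D i)⁻¹ (inv_ne_zero (hD0 i))
    have hyd : slm (y * d) = diagonal (Function.update (Function.update D i 1) j (D i * D j)) := by
      rw [slm_mul, hye, hd]
      ext a b
      rw [mul_diagonal]
      simp only [Matrix.add_apply, Matrix.smul_apply, Matrix.single_apply, one_apply, diagonal_apply,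
        Function.update_apply, smul_eq_mul]
      have := hD0 i
      by_cases hab : a = b
      · subst hab
        by_cases h1 : a = j
        · subst h1
          simp [hji.symm]
        · by_cases h2 : a = i
          · subst h2
            simp [hji, h1, this]
          · simp [h1, h2, Ne.symm h1, Ne.symm h2]
      · have h1 : ¬ (i = a ∧ i = b) := fun h => hab (h.1.symm.trans h.2)
        have h2 : ¬ (j = a ∧ j = b) := fun h => hab (h.1.symm.trans h.2)
        simp [hab, h1, h2]
    have hmem := ih _ _ hyd ?_
    · exact (Subgroup.mul_mem_cancel_left _ hy).1 hmem
    · have hlt : (Finset.univ.filter (fun a =>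
          Function.update (Function.update D i 1) j (D i * D j) a ≠ 1)).card <
          (Finset.univ.filter (fun i => D i ≠ 1)).card := by
        apply Finset.card_lt_card
        rw [Finset.ssubset_iff_of_subset]
        · refine ⟨i, by simpa using hi, by simp [Function.update_apply, hji.symm]⟩
        · intro a ha
          simp only [Finset.mem_filter, Finset.mem_univ, true_and, Function.update_apply] at ha ⊢
          by_cases h1 : a = j
          · subst h1; exact hj
          · by_cases h2 : a = i
            · subst h2; exact hi
            · simpa [h1, h2] using ha
      omega

open Matrix in
lemma tvK_top {k : Type*} [Field k] {n : ℕ} (s : SpecialLinearGroup (Fin n) k) :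
    s ∈ tvK k n := by
  obtain ⟨L, L', D, h⟩ := Pivot.exists_list_transvec_mul_diagonal_mul_list_transvec (slm s)
  obtain ⟨x, hx, hxe⟩ := list_mem L
  obtain ⟨y, hy, hye⟩ := list_mem L'
  rw [← hxe, ← hye] at h
  have hd : slm (x⁻¹ * s * y⁻¹) = diagonal D := by
    rw [slm_mul, slm_mul, h, mul_assoc, mul_assoc, mul_assoc, slm_mul_inv, mul_one, ← mul_assoc,
      slm_inv_mul, one_mul]
  have := diag_mem _ D _ hd le_rfl
  rw [Subgroup.mul_mem_cancel_right _ (inv_mem hy), Subgroup.mul_mem_cancel_left _ (inv_mem hx)]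
    at this
  exact this

open Matrix in
lemma elt_add {k : Type*} [Field k] {n : ℕ} (i j : Fin n) (hij : i ≠ j) (x y : k) :
    elt i j hij x * elt i j hij y = elt i j hij (x + y) := by
  apply slm_ext
  rw [slm_mul, slm_elt, slm_elt, slm_elt, mul_add, add_mul, add_mul, smul_mul_smul_comm,
    single_mul_single_of_ne _ _ _ _ hij.symm]
  simp only [mul_one, one_mul, smul_zero, add_zero]
  module

lemma elt_inv {k : Type*} [Field k] {n : ℕ} (i j : Fin n) (hij : i ≠ j) (x : k) :
    (elt i j hij x)⁻¹ = elt i j hij (-x) := by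
  rw [inv_eq_iff_mul_eq_one, elt_add, add_neg_cancel]
  apply slm_ext
  rw [slm_elt, slm_one]
  simp

open Matrix in
lemma elt_noncentral {k : Type*} [Field k] {n : ℕ} (i j : Fin n) (hij : i ≠ j) (x : k)
    (hx : x ≠ 0) : elt i j hij x ∉ Subgroup.center (SpecialLinearGroup (Fin n) k) := by
  intro h
  have h1 := Subgroup.mem_center_iff.1 h (elt j i hij.symm 1)
  have h2 := congrArg slm h1
  simp only [slm_mul, slm_elt, mul_add, add_mul, smul_mul_smul_comm, single_mul_single_same] at h2
  have h3 := congrFun (congrFun h2 i) i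
  simp [Matrix.single_apply, hij, hij.symm] at h3
  exact hx h3

/-- All noncentral elements have the same value. -/
lemma all_eq {k : Type*} [Field k] [Infinite k] {n : ℕ} (i j : Fin n) (hij : i ≠ j)
    {ψ : Matrix.SpecialLinearGroup (Fin n) k → ℂ} (hpos : IsPositiveType ψ) (hone : ψ 1 = 1)
    (hcent : ∀ x g, ψ (g * x * g⁻¹) = ψ x)
    (hZ : ∀ z ∈ Subgroup.center (Matrix.SpecialLinearGroup (Fin n) k), ∀ g, ψ (z * g) = ψ g)
    (s : Matrix.SpecialLinearGroup (Fin n) k)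
    (hs : s ∉ Subgroup.center (Matrix.SpecialLinearGroup (Fin n) k)) :
    ψ s = ψ (elt i j hij 1) := by
  have hcomm : ∀ a b, ψ (a * b) = ψ (b * a) := by
    intro a b
    rw [← hcent (a * b) b]
    congr 1
    group
  have hcz : ∀ a b : Matrix.SpecialLinearGroup (Fin n) k,
      a * b ∈ Subgroup.center (Matrix.SpecialLinearGroup (Fin n) k) →
      b * a ∈ Subgroup.center (Matrix.SpecialLinearGroup (Fin n) k) := by
    intro a b h
    have := (inferInstance : (Subgroup.center (Matrix.SpecialLinearGroup (Fin n) k)).Normal).mem_comm h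
    exact this
  have two : ∀ v l h v' l' h',
      tv v l h ∉ Subgroup.center (Matrix.SpecialLinearGroup (Fin n) k) →
      tv v' l' h' ∉ Subgroup.center (Matrix.SpecialLinearGroup (Fin n) k) →
      tv v l h * tv v' l' h' ∉ Subgroup.center (Matrix.SpecialLinearGroup (Fin n) k) →
      ψ (tv v l h) = ψ (tv v' l' h') := by
    intro v l h v' l' h' h1 h2 h3
    rw [step hpos hone hcent _ v' l' h' h1 h3, hcomm]
    exact (step hpos hone hcent _ v l h h2 (fun h => h3 (hcz _ _ h))).symm
  have helt : ∀ y : k, y ≠ 0 → y ≠ -1 → ψ (elt i j hij y) = ψ (elt i j hij 1) := by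
    intro y h0 h1
    refine two _ _ _ _ _ _ (elt_noncentral i j hij y h0)
      (elt_noncentral i j hij 1 one_ne_zero) ?_
    have := elt_add i j hij y 1
    rw [elt, elt] at this
    rw [this]
    exact elt_noncentral i j hij _ (fun h => h1 (eq_neg_of_add_eq_zero_left h))
  have htv : ∀ v l h, tv v l h ∉ Subgroup.center (Matrix.SpecialLinearGroup (Fin n) k) →
      ψ (tv v l h) = ψ (elt i j hij 1) := by
    classical
    intro v l h h1
    obtain ⟨y, hy⟩ := Infinite.exists_notMem_finset ({0, -1} : Finset k)
    obtain ⟨y', hy'⟩ := Infinite.exists_notMem_finset ({0, -1, y} : Finset k)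
    simp only [Finset.mem_insert, Finset.mem_singleton, not_or] at hy hy'
    by_cases hc : tv v l h * elt i j hij y ∈
        Subgroup.center (Matrix.SpecialLinearGroup (Fin n) k)
    · rw [← helt y' hy'.1 hy'.2.1]
      refine two _ _ _ _ _ _ h1 (elt_noncentral i j hij y' hy'.1) ?_
      intro hc'
      have hc'' : tv v l h * elt i j hij y' ∈
        Subgroup.center (Matrix.SpecialLinearGroup (Fin n) k) := hc'
      have := mul_mem (inv_mem hc) hc''
      rw [mul_inv_rev, mul_assoc, inv_mul_cancel_left, elt_inv, elt_add] at this
      refine elt_noncentral i j hij _ ?_ this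
      intro h0
      exact hy'.2.2 (neg_add_eq_zero.1 h0).symm
    · rw [← helt y hy.1 hy.2]
      exact two _ _ _ _ _ _ h1 (elt_noncentral i j hij y hy.1) hc
  have main : ∀ s ∈ tvK k n, s ∈ Subgroup.center (Matrix.SpecialLinearGroup (Fin n) k) ∨
      ψ s = ψ (elt i j hij 1) := by
    have right : ∀ s v l h, (s ∈ Subgroup.center (Matrix.SpecialLinearGroup (Fin n) k) ∨
        ψ s = ψ (elt i j hij 1)) →
        (s * tv v l h ∈ Subgroup.center (Matrix.SpecialLinearGroup (Fin n) k) ∨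
        ψ (s * tv v l h) = ψ (elt i j hij 1)) := by
      intro s v l h hP
      by_cases h1 : s * tv v l h ∈ Subgroup.center (Matrix.SpecialLinearGroup (Fin n) k)
      · exact Or.inl h1
      right
      by_cases h2 : s ∈ Subgroup.center (Matrix.SpecialLinearGroup (Fin n) k)
      · rw [hZ s h2]
        exact htv v l h (fun h3 => h1 (mul_mem h2 h3))
      · rw [← step hpos hone hcent s v l h h2 h1]
        exact hP.resolve_left h2
    intro s hs
    refine Subgroup.closure_induction_right (p := fun s _ =>
      s ∈ Subgroup.center (Matrix.SpecialLinearGroup (Fin n) k) ∨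
      ψ s = ψ (elt i j hij 1)) (Or.inl (one_mem _)) ?_ ?_ hs
    · rintro x - y ⟨v, l, h, rfl⟩ hP
      exact right x v l h hP
    · rintro x - y ⟨v, l, h, rfl⟩ hP
      rw [tv_inv]
      exact right x _ _ _ hP
  exact (main s (tvK_top s)).resolve_left hs

theorem stmt_13 {k : Type*} [Field k] [Infinite k] (n : ℕ) (hn : 2 ≤ n)
    (φ : Matrix.SpecialLinearGroup (Fin n) k ⧸
        Subgroup.center (Matrix.SpecialLinearGroup (Fin n) k) → ℂ)
    (hpos : IsPositiveType φ) (hone : φ 1 = 1)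
    (hcentral : ∀ x g : Matrix.SpecialLinearGroup (Fin n) k ⧸
        Subgroup.center (Matrix.SpecialLinearGroup (Fin n) k), φ (g * x * g⁻¹) = φ x) :
    ∃ t : ℝ, t ∈ Set.Icc (0 : ℝ) 1 ∧ φ 1 = 1 ∧
      ∀ g : Matrix.SpecialLinearGroup (Fin n) k ⧸
        Subgroup.center (Matrix.SpecialLinearGroup (Fin n) k), g ≠ 1 → φ g = (t : ℂ) := by
  let i : Fin n := ⟨0, by omega⟩
  let j : Fin n := ⟨1, by omega⟩
  have hij : i ≠ j := by simp [i, j]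
  let ψ : Matrix.SpecialLinearGroup (Fin n) k → ℂ := fun g => φ (QuotientGroup.mk g)
  have hpψ : IsPositiveType ψ := fun N g c => hpos N (fun a => QuotientGroup.mk (g a)) c
  have h1ψ : ψ 1 = 1 := hone
  have hcψ : ∀ x g, ψ (g * x * g⁻¹) = ψ x := fun x g =>
    hcentral (QuotientGroup.mk x) (QuotientGroup.mk g)
  have hZ : ∀ z ∈ Subgroup.center (Matrix.SpecialLinearGroup (Fin n) k), ∀ g,
      ψ (z * g) = ψ g := by
    intro z hz g
    have : (QuotientGroup.mk z : Matrix.SpecialLinearGroup (Fin n) k ⧸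
        Subgroup.center (Matrix.SpecialLinearGroup (Fin n) k)) = 1 :=
      (QuotientGroup.eq_one_iff z).2 hz
    simp only [ψ]
    rw [QuotientGroup.mk_mul, this, one_mul]
  have hall := fun s hs => all_eq i j hij hpψ h1ψ hcψ hZ s hs
  set T := ψ (elt i j hij 1) with hT
  have hconj : (starRingEnd ℂ) T = T := by
    rw [hT, ← posType_herm hpψ h1ψ, elt_inv]
    exact hall _ (elt_noncentral i j hij _ (by simp))
  obtain ⟨t, ht⟩ := Complex.conj_eq_iff_real.1 hconj
  refine ⟨t, ⟨?_, ?_⟩, hone, ?_⟩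
  · -- lower bound
    have key : ∀ N : ℕ, 0 ≤ (N : ℝ) * (1 - t) + (N : ℝ) ^ 2 * t := by
      intro N
      have e := Infinite.natEmbedding k
      have h := hpψ N (fun a => elt i j hij (e a)) (fun _ => 1)
      have hval : ∀ a b : Fin N, ψ ((elt i j hij (e a))⁻¹ * elt i j hij (e b)) =
          (if a = b then (1 - (t : ℂ)) else 0) + t := by
        intro a b
        by_cases hab : a = b
        · subst hab; simp [h1ψ]
        · rw [elt_inv, elt_add, if_neg hab, zero_add, ← ht]
          apply hall
          apply elt_noncentral
          intro h0
          apply hab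
          exact Fin.ext (e.injective (neg_add_eq_zero.1 h0))
      simp only [hval] at h
      simp [Finset.sum_add_distrib] at h
      have h2 : (0 : ℂ) ≤ (((N : ℝ) * (1 - t) + (N : ℝ) ^ 2 * t : ℝ) : ℂ) := by
        convert h using 1
        push_cast
        ring
      exact_mod_cast h2
    by_contra hneg
    push Not at hneg
    obtain ⟨N, hN⟩ := exists_nat_gt ((1 - t) / (-t))
    have h1 := key (N + 1)
    rw [div_lt_iff₀ (by linarith)] at hN
    push_cast at h1
    have h2 : (0 : ℝ) ≤ N := Nat.cast_nonneg N
    nlinarith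
  · have h := hpψ 2 ![1, elt i j hij 1] ![1, -1]
    have hi : ψ (elt i j hij 1)⁻¹ = t := by
      rw [posType_herm hpψ h1ψ, ← hT, hconj, ht]
    have hi2 : ψ (elt i j hij 1) = t := ht
    simp [Fin.sum_univ_two, h1ψ, hi, hi2, Complex.le_def] at h
    linarith
  · intro g hg
    induction g using QuotientGroup.induction_on with
    | H s =>
      rw [← ht]
      exact hall s (fun h => hg ((QuotientGroup.eq_one_iff s).2 h))
end

section
/- Let k be an infinite field, n ≥ 1, and let φ : Sp_{2n}(k) → ℂ be a normalized function of positive type that is constant on conjugacy classes. Then there exist t ∈ [0,1] and a normalized function ψ of positive type on Sp_{2n}(k) with ψ(g) = 0 for every g ∉ {I, −I}, such that φ(g) = t + (1−t)·ψ(g) for all g ∈ Sp_{2n}(k). -/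
open scoped ComplexOrder

open scoped InnerProductSpace

namespace SpChar

section GNS

variable {Γ : Type*} [Group Γ]

lemma posType_conj {Φ : Γ → ℂ} (h : IsPositiveType Φ) (x : Γ) :
    (starRingEnd ℂ) (Φ x⁻¹) = Φ x := by
  have h0 := h 1 (fun _ => 1) (fun _ => 1)
  have h1 := h 2 ![1, x] ![1, 1]
  have h2 := h 2 ![1, x] ![1, Complex.I]
  simp [Fin.sum_univ_two] at h0 h1 h2
  rw [Complex.le_def] at h0 h1 h2
  simp at h0 h1 h2
  apply Complex.ext <;> simp <;> linarith [h0.2, h1.2, h2.2]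

/-- The space of finitely supported functions, carrying the GNS form. -/
def PreGNS (_Φ : Γ → ℂ) : Type _ := Γ →₀ ℂ

variable (Φ : Γ → ℂ)

noncomputable instance : AddCommGroup (PreGNS Φ) := inferInstanceAs (AddCommGroup (Γ →₀ ℂ))
noncomputable instance : Module ℂ (PreGNS Φ) := inferInstanceAs (Module ℂ (Γ →₀ ℂ))

/-- The GNS form. -/
noncomputable def gnsForm (f g : Γ →₀ ℂ) : ℂ :=
  f.sum fun x a => g.sum fun y b => (starRingEnd ℂ) a * b * Φ (x⁻¹ * y)

lemma gnsForm_add_left (f f' g : Γ →₀ ℂ) :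
    gnsForm Φ (f + f') g = gnsForm Φ f g + gnsForm Φ f' g := by
  unfold gnsForm
  rw [Finsupp.sum_add_index']
  · intro x; simp
  · intro x a b
    rw [← Finsupp.sum_add]
    refine Finset.sum_congr rfl fun y _ => ?_
    simp only [map_add]; ring

lemma gnsForm_smul_left (f g : Γ →₀ ℂ) (r : ℂ) :
    gnsForm Φ (r • f) g = (starRingEnd ℂ) r * gnsForm Φ f g := by
  unfold gnsForm
  rw [Finsupp.sum_smul_index' (by intro x; simp), Finsupp.mul_sum]
  refine Finset.sum_congr rfl fun x _ => ?_
  dsimp only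
  rw [Finsupp.mul_sum]
  refine Finset.sum_congr rfl fun y _ => ?_
  simp only [smul_eq_mul, map_mul]; ring

lemma gnsForm_nonneg (h : IsPositiveType Φ) (f : Γ →₀ ℂ) : 0 ≤ gnsForm Φ f f := by
  classical
  have e := f.support.equivFin
  have := h f.support.card (fun i => (e.symm i : Γ)) (fun i => f (e.symm i))
  convert this using 1
  unfold gnsForm Finsupp.sum
  rw [← Finset.sum_coe_sort f.support, ← e.symm.sum_comp]
  refine Finset.sum_congr rfl fun i _ => ?_
  dsimp only
  rw [← Finset.sum_coe_sort f.support, ← e.symm.sum_comp]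

lemma gnsForm_conj (h : IsPositiveType Φ) (f g : Γ →₀ ℂ) :
    (starRingEnd ℂ) (gnsForm Φ g f) = gnsForm Φ f g := by
  unfold gnsForm
  rw [Finsupp.sum_comm]
  simp only [Finsupp.sum, map_sum]
  refine Finset.sum_congr rfl fun i _ => Finset.sum_congr rfl fun j _ => ?_
  have := posType_conj h (i⁻¹ * j)
  simp only [mul_inv_rev, inv_inv] at this
  simp only [map_mul, this, Complex.conj_conj]; ring

lemma gnsForm_mapDomain (f g : Γ →₀ ℂ) (x : Γ) :
    gnsForm Φ (f.mapDomain (x * ·)) (g.mapDomain (x * ·)) = gnsForm Φ f g := by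
  unfold gnsForm
  rw [Finsupp.sum_mapDomain_index]
  · refine Finset.sum_congr rfl fun i _ => ?_
    dsimp only
    rw [Finsupp.sum_mapDomain_index]
    · refine Finset.sum_congr rfl fun j _ => ?_
      simp [mul_assoc]
    · simp
    · intros; ring
  · simp
  · intro b m₁ m₂
    rw [← Finsupp.sum_add]
    refine Finset.sum_congr rfl fun y _ => ?_
    simp only [map_add]; ring

/-- The core. -/
@[reducible] noncomputable def gnsCore (h : IsPositiveType Φ) :
    PreInnerProductSpace.Core ℂ (PreGNS Φ) where
  inner f g := gnsForm Φ f g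
  conj_inner_symm f g := gnsForm_conj Φ h f g
  re_inner_nonneg f := (Complex.le_def.1 (gnsForm_nonneg Φ h f)).1
  add_left f g k := gnsForm_add_left Φ f g k
  smul_left f g r := gnsForm_smul_left Φ f g r

universe u

theorem gns {Γ : Type u} [Group Γ] (Φ : Γ → ℂ) (h : IsPositiveType Φ) :
    ∃ (H : Type u) (_ : NormedAddCommGroup H) (_ : InnerProductSpace ℂ H) (_ : CompleteSpace H)
      (π : Γ →* (H →L[ℂ] H)) (ξ : H), (∀ g x, ‖π g x‖ = ‖x‖) ∧
      ∀ g, Φ g = ⟪ξ, π g ξ⟫_ℂ := by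
  let core := gnsCore Φ h
  let i1 : SeminormedAddCommGroup (PreGNS Φ) :=
    @InnerProductSpace.Core.toSeminormedAddCommGroup ℂ _ _ _ _ core
  let i2 : InnerProductSpace ℂ (PreGNS Φ) := InnerProductSpace.ofCore core
  have hin : ∀ f g : PreGNS Φ, ⟪f, g⟫_ℂ = gnsForm Φ f g := fun f g => rfl
  let T : Γ → (PreGNS Φ →ₗᵢ[ℂ] PreGNS Φ) := fun x =>
    LinearMap.isometryOfInner
      (show PreGNS Φ →ₗ[ℂ] PreGNS Φ from Finsupp.lmapDomain ℂ ℂ (x * ·))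
      (fun f g => gnsForm_mapDomain Φ f g x)
  have hT : ∀ x (f : PreGNS Φ), T x f = Finsupp.mapDomain (x * ·) f := fun x f => rfl
  have hT1 : ∀ f, T 1 f = f := by
    intro f; rw [hT]; simp only [one_mul]; exact Finsupp.mapDomain_id
  have hTm : ∀ x y f, T (x * y) f = T x (T y f) := by
    intro x y f
    rw [hT, hT, hT]
    simp only [mul_assoc]
    exact Finsupp.mapDomain_comp (f := (y * ·)) (g := (x * ·))
  let H := UniformSpace.Completion (PreGNS Φ)
  have huc : ∀ x, UniformContinuous (T x) := fun x => (T x).isometry.uniformContinuous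
  let M : Γ → H → H := fun x => UniformSpace.Completion.map (T x)
  have hMc : ∀ x, Continuous (M x) := fun x => UniformSpace.Completion.continuous_map
  have hMcoe : ∀ x (f : PreGNS Φ), M x (f : H) = ((T x f : PreGNS Φ) : H) := fun x f =>
    UniformSpace.Completion.map_coe (huc x) f
  let N : Γ → (H →L[ℂ] H) := fun x =>
    { toFun := M x
      map_add' := fun a b => by
        induction a, b using UniformSpace.Completion.induction_on₂ with
        | hp => 
          exact isClosed_eq ((hMc x).comp continuous_add)
            (((hMc x).comp continuous_fst).add ((hMc x).comp continuous_snd))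
        | ih a b => 
          rw [← UniformSpace.Completion.coe_add, hMcoe, hMcoe, hMcoe, map_add,
            UniformSpace.Completion.coe_add]
      map_smul' := fun r a => by
        induction a using UniformSpace.Completion.induction_on with
        | hp => 
          exact isClosed_eq ((hMc x).comp (continuous_const_smul r))
            ((hMc x).const_smul r)
        | ih a => 
          rw [← UniformSpace.Completion.coe_smul, hMcoe, hMcoe, map_smul,
            UniformSpace.Completion.coe_smul, RingHom.id_apply]
      cont := hMc x }
  have hN : ∀ x (f : PreGNS Φ), N x (f : H) = ((T x f : PreGNS Φ) : H) := hMcoe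
  let π : Γ →* (H →L[ℂ] H) :=
    { toFun := N
      map_one' := by
        ext a
        induction a using UniformSpace.Completion.induction_on with
        | hp => exact isClosed_eq (N 1).continuous (ContinuousLinearMap.continuous _)
        | ih a => rw [hN, hT1]; rfl
      map_mul' := fun x y => by
        ext a
        induction a using UniformSpace.Completion.induction_on with
        | hp => exact isClosed_eq (N _).continuous (ContinuousLinearMap.continuous _)
        | ih a => rw [hN, hTm, mul_apply_eq_comp, hN, hN] }
  refine ⟨H, inferInstance, inferInstance, inferInstance, π,
    ((show PreGNS Φ from (Finsupp.single 1 1 : Γ →₀ ℂ)) : PreGNS Φ), ?_, ?_⟩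
  · intro g a
    induction a using UniformSpace.Completion.induction_on with
    | hp => exact isClosed_eq (π g).continuous.norm continuous_norm
    | ih a => 
      change ‖N g a‖ = _
      rw [hN, UniformSpace.Completion.norm_coe, UniformSpace.Completion.norm_coe, (T g).norm_map]
  · intro g
    change _ = ⟪_, N g _⟫_ℂ
    rw [hN, UniformSpace.Completion.inner_coe, hin, hT, Finsupp.mapDomain_single]
    simp [gnsForm]

end GNS

/-- Diagonal coefficients of isometric representations are of positive type. -/
lemma posType_of_rep {Γ H : Type*} [Group Γ] [NormedAddCommGroup H] [InnerProductSpace ℂ H]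
    (π : Γ →* (H →L[ℂ] H)) (hπ : ∀ g x y, ⟪π g x, π g y⟫_ℂ = ⟪x, y⟫_ℂ) (ξ : H) (r : ℝ)
    (hr : 0 ≤ r) : IsPositiveType (fun g => (r : ℂ) * ⟪ξ, π g ξ⟫_ℂ) := by
  intro n g c
  have key : ∑ i, ∑ j, (starRingEnd ℂ) (c i) * c j * ((r : ℂ) * ⟪ξ, π ((g i)⁻¹ * g j) ξ⟫_ℂ)
      = (r : ℂ) * ⟪∑ i, c i • π (g i) ξ, ∑ i, c i • π (g i) ξ⟫_ℂ := by
    rw [sum_inner, Finset.mul_sum]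
    refine Finset.sum_congr rfl fun i _ => ?_
    rw [inner_sum, Finset.mul_sum]
    refine Finset.sum_congr rfl fun j _ => ?_
    rw [inner_smul_left, inner_smul_right, ← hπ (g i) ξ, ← mul_apply_eq_comp,
      ← map_mul, mul_inv_cancel_left]
    ring
  rw [key]
  refine mul_nonneg (by exact_mod_cast hr) ?_
  rw [inner_self_eq_norm_sq_to_K]
  have := sq_nonneg ‖∑ i, c i • π (g i) ξ‖
  rw [← RCLike.ofReal_pow]
  exact RCLike.ofReal_nonneg.2 this

lemma posType_delta {Γ : Type*} [Group Γ] [DecidableEq Γ] :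
    IsPositiveType (fun g : Γ => if g = 1 then (1 : ℂ) else 0) := by
  intro n g c
  have key : ∑ i, ∑ j, (starRingEnd ℂ) (c i) * c j * (if (g i)⁻¹ * g j = 1 then (1 : ℂ) else 0)
      = ∑ x ∈ Finset.univ.image g, (starRingEnd ℂ) (∑ i with g i = x, c i) *
        (∑ i with g i = x, c i) := by
    rw [← Finset.sum_fiberwise_of_maps_to (s := Finset.univ) (t := Finset.univ.image g) (g := g)
      (fun i _ => Finset.mem_image_of_mem _ (Finset.mem_univ _))]
    refine Finset.sum_congr rfl fun x _ => ?_
    rw [map_sum, Finset.sum_mul]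
    refine Finset.sum_congr rfl fun i hi => ?_
    rw [Finset.mul_sum, Finset.sum_filter]
    refine Finset.sum_congr rfl fun j _ => ?_
    rw [Finset.mem_filter] at hi
    simp only [inv_mul_eq_one, hi.2]
    simp [eq_comm]
  rw [key]
  refine Finset.sum_nonneg fun x _ => ?_
  rw [mul_comm, Complex.mul_conj]
  exact_mod_cast Complex.normSq_nonneg _

end SpChar

namespace SpChar

section Ergodic

variable {B H : Type*} [Group B] [NormedAddCommGroup H] [InnerProductSpace ℂ H]

lemma inner_rep {ρ : B →* (H →L[ℂ] H)} (hρ : ∀ g x, ‖ρ g x‖ = ‖x‖) (g : B) (x y : H) :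
    ⟪ρ g x, ρ g y⟫_ℂ = ⟪x, y⟫_ℂ :=
  LinearIsometry.inner_map_map (⟨(ρ g).toLinearMap, hρ g⟩ : H →ₗᵢ[ℂ] H) x y

lemma rep_mul (ρ : B →* (H →L[ℂ] H)) (g h : B) (x : H) : ρ (g * h) x = ρ g (ρ h x) := by
  rw [map_mul]; rfl

lemma rep_one (ρ : B →* (H →L[ℂ] H)) (x : H) : ρ 1 x = x := by
  rw [map_one]; rfl

lemma inner_rep_left {ρ : B →* (H →L[ℂ] H)} (hρ : ∀ g x, ‖ρ g x‖ = ‖x‖) (g : B) (x y : H) :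
    ⟪ρ g x, y⟫_ℂ = ⟪x, ρ g⁻¹ y⟫_ℂ := by
  rw [← inner_rep hρ g x, ← rep_mul, mul_inv_cancel, rep_one]

/-- Fixed vectors. -/
def fixS (ρ : B →* (H →L[ℂ] H)) : Submodule ℂ H where
  carrier := {x | ∀ b, ρ b x = x}
  add_mem' := fun {x y} hx hy b => by rw [map_add, hx b, hy b]
  zero_mem' := fun b => map_zero _
  smul_mem' := fun c x hx b => by rw [map_smul, hx b]

lemma mem_fixS {ρ : B →* (H →L[ℂ] H)} {x : H} : x ∈ fixS ρ ↔ ∀ b, ρ b x = x := Iff.rfl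

lemma isClosed_fixS (ρ : B →* (H →L[ℂ] H)) : IsClosed (fixS ρ : Set H) := by
  have : (fixS ρ : Set H) = ⋂ b, {x | ρ b x = x} := by
    ext x; simp [mem_fixS]
  rw [this]
  exact isClosed_iInter fun b => isClosed_eq (ρ b).continuous continuous_id

variable [CompleteSpace H]

instance (ρ : B →* (H →L[ℂ] H)) : CompleteSpace (fixS ρ) :=
  (isClosed_fixS ρ).completeSpace_coe

/-- Projection onto the fixed vectors. -/
noncomputable def Pr (ρ : B →* (H →L[ℂ] H)) : H →L[ℂ] H := (fixS ρ).starProjection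

lemma Pr_mem (ρ : B →* (H →L[ℂ] H)) (y : H) : Pr ρ y ∈ fixS ρ :=
  Submodule.starProjection_apply_mem _ _

lemma rep_Pr (ρ : B →* (H →L[ℂ] H)) (b : B) (y : H) : ρ b (Pr ρ y) = Pr ρ y := Pr_mem ρ y b

lemma Pr_of_mem {ρ : B →* (H →L[ℂ] H)} {y : H} (h : y ∈ fixS ρ) : Pr ρ y = y :=
  Submodule.starProjection_eq_self_iff.2 h

lemma Pr_Pr (ρ : B →* (H →L[ℂ] H)) (y : H) : Pr ρ (Pr ρ y) = Pr ρ y := Pr_of_mem (Pr_mem ρ y)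

lemma Pr_symm (ρ : B →* (H →L[ℂ] H)) (x y : H) : ⟪Pr ρ x, y⟫_ℂ = ⟪x, Pr ρ y⟫_ℂ :=
  Submodule.inner_starProjection_left_eq_right _ _ _

lemma eq_Pr {ρ : B →* (H →L[ℂ] H)} {m y : H} (hm : m ∈ fixS ρ)
    (h : ∀ w ∈ fixS ρ, ⟪y - m, w⟫_ℂ = 0) : Pr ρ y = m :=
  Submodule.eq_starProjection_of_mem_of_inner_eq_zero hm h

lemma sub_Pr_inner (ρ : B →* (H →L[ℂ] H)) (y : H) {w : H} (hw : w ∈ fixS ρ) :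
    ⟪y - Pr ρ y, w⟫_ℂ = 0 := Submodule.starProjection_inner_eq_zero _ _ hw

lemma Pr_rep {ρ : B →* (H →L[ℂ] H)} (hρ : ∀ g x, ‖ρ g x‖ = ‖x‖) (b : B) (y : H) :
    Pr ρ (ρ b y) = Pr ρ y := by
  refine eq_Pr (Pr_mem ρ y) fun w hw => ?_
  have := sub_Pr_inner ρ y hw
  rw [inner_sub_left] at this ⊢
  rw [inner_rep_left hρ, hw, this]

lemma Pr_comm {ρ : B →* (H →L[ℂ] H)} (A C : H →L[ℂ] H) (hA : ∀ x y, ⟪A x, A y⟫_ℂ = ⟪x, y⟫_ℂ)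
    (hAC : ∀ x, A (C x) = x) (h1 : ∀ x ∈ fixS ρ, A x ∈ fixS ρ) (h2 : ∀ x ∈ fixS ρ, C x ∈ fixS ρ)
    (y : H) : Pr ρ (A y) = A (Pr ρ y) := by
  refine eq_Pr (h1 _ (Pr_mem ρ y)) fun w hw => ?_
  rw [← map_sub, ← hAC w, hA]
  exact sub_Pr_inner ρ y (h2 w hw)

lemma closure_conv_const {E F : Type*} [NormedAddCommGroup E] [NormedSpace ℝ E]
    [NormedAddCommGroup F] [NormedSpace ℝ F] (A : E →L[ℝ] F) {S : Set E} {c : F}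
    (h : ∀ x ∈ S, A x = c) {m : E} (hm : m ∈ closure (convexHull ℝ S)) : A m = c := by
  have hcl : IsClosed {x | A x = c} := isClosed_eq A.continuous continuous_const
  have hcv : Convex ℝ {x | A x = c} :=
    (convex_singleton c).linear_preimage A.toLinearMap
  exact closure_minimal (convexHull_min h hcv) hcl hm

lemma closure_conv_map {E F : Type*} [NormedAddCommGroup E] [NormedSpace ℝ E]
    [NormedAddCommGroup F] [NormedSpace ℝ F] (A : E →L[ℝ] F) {S : Set E} {T : Set F}
    (h : ∀ x ∈ S, A x ∈ T) {m : E} (hm : m ∈ closure (convexHull ℝ S)) :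
    A m ∈ closure (convexHull ℝ T) := by
  have hcl : IsClosed (A ⁻¹' closure (convexHull ℝ T)) := isClosed_closure.preimage A.continuous
  have hcv : Convex ℝ (A ⁻¹' closure (convexHull ℝ T)) :=
    (convex_convexHull ℝ T).closure.linear_preimage A.toLinearMap
  have h0 : S ⊆ A ⁻¹' closure (convexHull ℝ T) := fun x hx =>
    subset_closure (subset_convexHull ℝ T (h x hx))
  exact closure_minimal (convexHull_min h0 hcv) hcl hm

lemma exists_fixed {ρ : B →* (H →L[ℂ] H)} (hρ : ∀ g x, ‖ρ g x‖ = ‖x‖) (y : H) :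
    ∃ m ∈ closure (convexHull ℝ (Set.range fun b => ρ b y)), m ∈ fixS ρ := by
  let _ : InnerProductSpace ℝ H := InnerProductSpace.rclikeToReal ℂ H
  set C := closure (convexHull ℝ (Set.range fun b => ρ b y)) with hC
  have hne : C.Nonempty := ⟨ρ 1 y, subset_closure (subset_convexHull ℝ _ ⟨1, rfl⟩)⟩
  have hcv : Convex ℝ C := (convex_convexHull ℝ _).closure
  obtain ⟨m, hm, hmin⟩ := exists_norm_eq_iInf_of_complete_convex (F := H) hne
    isClosed_closure.isComplete hcv 0
  refine ⟨m, hm, fun b => ?_⟩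
  have hb : ρ b m ∈ C := by
    refine closure_conv_map ((ρ b).restrictScalars ℝ) ?_ hm
    rintro _ ⟨a, rfl⟩
    exact ⟨b * a, rep_mul ρ b a y⟩
  have h1 := (norm_eq_iInf_iff_real_inner_le_zero hcv hm).1 hmin _ hb
  have h2 : ‖ρ b m - m‖ ^ 2 ≤ 0 := by
    rw [norm_sub_sq_real, hρ]
    rw [inner_sub_right, zero_sub, inner_neg_left, inner_neg_left, real_inner_self_eq_norm_sq,
      real_inner_comm] at h1
    linarith
  have h3 : ‖ρ b m - m‖ = 0 := by
    have := norm_nonneg (ρ b m - m)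
    nlinarith
  exact sub_eq_zero.1 (norm_eq_zero.1 h3)

lemma closure_conv_ne_one [Infinite B] {ρ : B →* (H →L[ℂ] H)} (hρ : ∀ g x, ‖ρ g x‖ = ‖x‖)
    {y m : H} (hm : m ∈ closure (convexHull ℝ (Set.range fun b => ρ b y))) (hf : m ∈ fixS ρ) :
    m ∈ closure (convexHull ℝ ((fun b => ρ b y) '' {b | b ≠ 1})) := by
  classical
  rw [Metric.mem_closure_iff] at hm ⊢
  intro ε hε
  obtain ⟨z, hz, hd⟩ := hm ε hε
  rw [convexHull_eq_union_convexHull_finite_subsets] at hz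
  simp only [Set.mem_iUnion] at hz
  obtain ⟨t, ht, hz⟩ := hz
  rw [← Set.image_univ, Finset.subset_set_image_iff] at ht
  obtain ⟨s, -, rfl⟩ := ht
  obtain ⟨c, hc⟩ := Infinite.exists_notMem_finset (s.image fun b => b⁻¹)
  refine ⟨ρ c z, ?_, ?_⟩
  · have : ρ c z ∈ ((ρ c).toLinearMap.restrictScalars ℝ) ''
        (convexHull ℝ (((s.image fun b => ρ b y) : Finset H) : Set H)) := ⟨z, hz, rfl⟩
    rw [LinearMap.image_convexHull] at this
    refine convexHull_mono ?_ this
    rintro _ ⟨_, hx, rfl⟩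
    rw [Finset.mem_coe, Finset.mem_image] at hx
    obtain ⟨b, hb, rfl⟩ := hx
    refine ⟨c * b, fun h => hc ?_, rep_mul ρ c b y⟩
    rw [Finset.mem_image]
    exact ⟨b, hb, (eq_inv_of_mul_eq_one_left h).symm⟩
  · rw [dist_eq_norm] at hd ⊢
    rw [← hf c, ← map_sub, hρ]
    exact hd

lemma eq_Pr_of_closure {ρ : B →* (H →L[ℂ] H)} (hρ : ∀ g x, ‖ρ g x‖ = ‖x‖) {y m : H}
    (hm : m ∈ closure (convexHull ℝ (Set.range fun b => ρ b y))) (hf : m ∈ fixS ρ) :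
    m = Pr ρ y := by
  refine (eq_Pr hf fun w hw => ?_).symm
  have : ⟪w, m⟫_ℂ = ⟪w, y⟫_ℂ := by
    refine closure_conv_const ((innerSL ℂ w).restrictScalars ℝ) ?_ hm
    rintro _ ⟨b, rfl⟩
    change ⟪w, ρ b y⟫_ℂ = _
    conv_lhs => rw [← hw b]
    exact inner_rep hρ b w y
  rw [← inner_conj_symm, inner_sub_right, this, sub_self, map_zero]

lemma Pr_const [Infinite B] {ρ : B →* (H →L[ℂ] H)} (hρ : ∀ g x, ‖ρ g x‖ = ‖x‖) {F : Type*}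
    [NormedAddCommGroup F] [NormedSpace ℂ F] (y : H) (A : H →L[ℂ] F) (c : F)
    (h : ∀ b, b ≠ 1 → A (ρ b y) = c) : A (Pr ρ y) = c := by
  obtain ⟨m, hm, hf⟩ := exists_fixed hρ y
  rw [← eq_Pr_of_closure hρ hm hf]
  refine closure_conv_const (A.restrictScalars ℝ) ?_ (closure_conv_ne_one hρ hm hf)
  rintro _ ⟨b, hb, rfl⟩
  exact h b hb

lemma Pr_pair [Infinite B] {ρ₁ ρ₂ : B →* (H →L[ℂ] H)} (h₁ : ∀ g x, ‖ρ₁ g x‖ = ‖x‖)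
    (h₂ : ∀ g x, ‖ρ₂ g x‖ = ‖x‖) (y₁ y₂ : H) (A₁ A₂ : H →L[ℂ] H)
    (h : ∀ b, b ≠ 1 → A₁ (ρ₁ b y₁) = A₂ (ρ₂ b y₂)) : A₁ (Pr ρ₁ y₁) = A₂ (Pr ρ₂ y₂) := by
  let e := WithLp.prodContinuousLinearEquiv 2 ℂ H H
  let ρ : B →* (WithLp 2 (H × H) →L[ℂ] WithLp 2 (H × H)) :=
    { toFun := fun b => e.symm.toContinuousLinearMap ∘L ((ρ₁ b).prodMap (ρ₂ b)) ∘L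
        e.toContinuousLinearMap
      map_one' := by
        ext x : 1
        simp
      map_mul' := fun a b => by
        ext x : 1
        simp
        rfl }
  have hρv : ∀ b x, ρ b x = WithLp.toLp 2 (ρ₁ b x.fst, ρ₂ b x.snd) := fun b x => rfl
  have hρ : ∀ g x, ‖ρ g x‖ = ‖x‖ := by
    intro g x
    have : ‖ρ g x‖ ^ 2 = ‖x‖ ^ 2 := by
      rw [WithLp.prod_norm_sq_eq_of_L2, WithLp.prod_norm_sq_eq_of_L2, hρv]
      simp [h₁, h₂]
    exact (sq_eq_sq₀ (norm_nonneg _) (norm_nonneg _)).1 this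
  let y : WithLp 2 (H × H) := WithLp.toLp 2 (y₁, y₂)
  obtain ⟨m, hm, hf⟩ := exists_fixed hρ y
  let p₁ : WithLp 2 (H × H) →L[ℂ] H := ContinuousLinearMap.fst ℂ H H ∘L e.toContinuousLinearMap
  let p₂ : WithLp 2 (H × H) →L[ℂ] H := ContinuousLinearMap.snd ℂ H H ∘L e.toContinuousLinearMap
  have hp₁ : ∀ b x, p₁ (ρ b x) = ρ₁ b (p₁ x) := fun b x => rfl
  have hp₂ : ∀ b x, p₂ (ρ b x) = ρ₂ b (p₂ x) := fun b x => rfl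
  have e₁ : p₁ m = Pr ρ₁ y₁ := by
    refine eq_Pr_of_closure h₁ (closure_conv_map (p₁.restrictScalars ℝ) ?_ hm) ?_
    · rintro _ ⟨b, rfl⟩
      exact ⟨b, rfl⟩
    · intro b
      change ρ₁ b (p₁ m) = p₁ m
      rw [← hp₁, hf b]
  have e₂ : p₂ m = Pr ρ₂ y₂ := by
    refine eq_Pr_of_closure h₂ (closure_conv_map (p₂.restrictScalars ℝ) ?_ hm) ?_
    · rintro _ ⟨b, rfl⟩
      exact ⟨b, rfl⟩
    · intro b
      change ρ₂ b (p₂ m) = p₂ m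
      rw [← hp₂, hf b]
  rw [← e₁, ← e₂, ← sub_eq_zero]
  refine closure_conv_const (((A₁ ∘L p₁) - (A₂ ∘L p₂)).restrictScalars ℝ) ?_
    (closure_conv_ne_one hρ hm hf)
  rintro _ ⟨b, hb, rfl⟩
  exact sub_eq_zero.2 (h b hb)

lemma orth_const {ι : Type*} [Infinite ι] (f : ι → H) (hf : ∀ i j, i ≠ j → ⟪f i, f j⟫_ℂ = 0)
    (C : ℝ) (hC : ∀ i, ‖f i‖ = C) (x : H) (c : ℂ) (hc : ∀ i, ⟪x, f i⟫_ℂ = c) : c = 0 := by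
  by_contra hne
  have hpos : 0 < ‖c‖ ^ 2 := by positivity
  obtain ⟨N, hN⟩ := exists_nat_gt ((‖x‖ ^ 2 * C ^ 2) / ‖c‖ ^ 2)
  rw [div_lt_iff₀ hpos] at hN
  obtain ⟨s, hs⟩ := Infinite.exists_subset_card_eq ι N
  have h1 : ⟪x, ∑ i ∈ s, f i⟫_ℂ = N * c := by
    rw [inner_sum, Finset.sum_congr rfl (fun i _ => hc i)]
    simp [hs]
  have h2 : ‖∑ i ∈ s, f i‖ ^ 2 = N * C ^ 2 := by
    have : ⟪∑ i ∈ s, f i, ∑ i ∈ s, f i⟫_ℂ = ((N * C ^ 2 : ℝ) : ℂ) := by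
      rw [sum_inner]
      have : ∀ i ∈ s, ⟪f i, ∑ j ∈ s, f j⟫_ℂ = ((C ^ 2 : ℝ) : ℂ) := by
        intro i hi
        rw [inner_sum, Finset.sum_eq_single i (fun j _ hj => hf i j hj.symm)
          (fun h => absurd hi h), inner_self_eq_norm_sq_to_K, hC]
        simp
      rw [Finset.sum_congr rfl this]
      simp [hs]
    rw [inner_self_eq_norm_sq_to_K, ← RCLike.ofReal_pow] at this
    exact Complex.ofReal_injective this
  have h3 := norm_inner_le_norm (𝕜 := ℂ) x (∑ i ∈ s, f i)
  rw [h1, norm_mul, Complex.norm_natCast] at h3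
  have h4 : ((N : ℝ) * ‖c‖) ^ 2 ≤ (‖x‖ * ‖∑ i ∈ s, f i‖) ^ 2 := by
    gcongr
  rw [mul_pow, mul_pow, h2] at h4
  have hN0 : (0 : ℝ) < N := by
    rcases Nat.eq_zero_or_pos N with h | h
    · subst h
      simp at hN
      exact absurd hN (not_lt.2 (by positivity))
    · exact_mod_cast h
  nlinarith

end Ergodic

end SpChar

namespace SpChar

section SL2

open Matrix

variable {k : Type*} [Field k]

lemma sl_ext {A B : SpecialLinearGroup (Fin 2) k} (h : A.1 = B.1) : A = B := Subtype.ext h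

lemma sl_mul (A B : SpecialLinearGroup (Fin 2) k) : (A * B).1 = A.1 * B.1 := rfl

lemma sl_one : (1 : SpecialLinearGroup (Fin 2) k).1 = 1 := rfl

/-- Upper unipotents of `SL₂`. -/
def uu : Multiplicative k →* SpecialLinearGroup (Fin 2) k where
  toFun a := ⟨!![1, a.toAdd; 0, 1], by simp [det_fin_two]⟩
  map_one' := by
    ext i j; fin_cases i <;> fin_cases j <;> simp
  map_mul' a b := by
    apply sl_ext
    change !![1, a.toAdd + b.toAdd; 0, 1] = !![1, a.toAdd; 0, 1] * !![1, b.toAdd; 0, 1]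
    simp [add_comm]

/-- Diagonal elements of `SL₂`. -/
def hh (a : kˣ) : SpecialLinearGroup (Fin 2) k :=
  ⟨!![(a : k), 0; 0, ((a⁻¹ : kˣ) : k)], by simp [det_fin_two]⟩

/-- The Weyl element of `SL₂`. -/
def ss : SpecialLinearGroup (Fin 2) k := ⟨!![0, -1; 1, 0], by simp [det_fin_two]⟩

lemma uu_val (a : Multiplicative k) : (uu a).1 = !![1, a.toAdd; 0, 1] := rfl

lemma hh_val (a : kˣ) : (hh a).1 = !![(a : k), 0; 0, ((a⁻¹ : kˣ) : k)] := rfl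

lemma ss_val : (ss : SpecialLinearGroup (Fin 2) k).1 = !![0, -1; 1, 0] := rfl

lemma hh_mul (a b : kˣ) : hh (a * b) = hh a * hh b := by
  apply sl_ext
  rw [sl_mul, hh_val, hh_val, hh_val]
  simp [mul_comm]

lemma hh_one : hh (1 : kˣ) = 1 := by
  ext i j; fin_cases i <;> fin_cases j <;> simp [hh]

lemma hh_uu (a : kˣ) (b : k) : uu (Multiplicative.ofAdd b) * hh a =
    hh a * uu (Multiplicative.ofAdd ((a⁻¹ : kˣ) ^ 2 * b)) := by
  apply sl_ext
  rw [sl_mul, sl_mul, hh_val, uu_val, uu_val]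
  have := a.ne_zero
  simp
  field_simp

lemma ss_uu_ss (a : kˣ) : ss * uu (Multiplicative.ofAdd (a : k)) * ss =
    uu (Multiplicative.ofAdd (-(a⁻¹ : kˣ) : k)) * hh a⁻¹ * ss *
      uu (Multiplicative.ofAdd (-(a⁻¹ : kˣ) : k)) := by
  apply sl_ext
  simp only [sl_mul, hh_val, uu_val, ss_val]
  simp

lemma ss_inv : (ss : SpecialLinearGroup (Fin 2) k)⁻¹ = hh (-1) * ss := by
  rw [inv_eq_iff_mul_eq_one]
  apply sl_ext
  simp only [sl_mul, hh_val, ss_val, sl_one]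
  simp [Matrix.one_fin_two]

lemma sl2_gen (g : SpecialLinearGroup (Fin 2) k) :
    (∃ a b, g = hh a * uu b) ∨ ∃ a b c, g = uu a * hh b * ss * uu c := by
  have hd := g.2
  rw [det_fin_two] at hd
  have hg : g.1 = !![g.1 0 0, g.1 0 1; g.1 1 0, g.1 1 1] := Matrix.eta_fin_two _
  by_cases hc : g.1 1 0 = 0
  · left
    rw [hc, mul_zero, sub_zero] at hd
    have h0 : g.1 0 0 ≠ 0 := left_ne_zero_of_mul_eq_one hd
    refine ⟨Units.mk0 _ h0, Multiplicative.ofAdd ((g.1 0 0)⁻¹ * g.1 0 1), ?_⟩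
    apply sl_ext
    simp only [sl_mul, hh_val, uu_val]
    refine hg.trans ?_
    rw [hc]
    simp [h0]
    exact eq_inv_of_mul_eq_one_right hd
  · right
    refine ⟨Multiplicative.ofAdd (g.1 0 0 * (g.1 1 0)⁻¹), (Units.mk0 _ hc)⁻¹,
      Multiplicative.ofAdd (g.1 1 1 * (g.1 1 0)⁻¹), ?_⟩
    apply sl_ext
    simp only [sl_mul, hh_val, uu_val, ss_val]
    refine hg.trans ?_
    simp [hc]
    field_simp
    refine ⟨?_, trivial⟩
    linear_combination -hd

end SL2

section SL2rep

open Matrix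

variable {k : Type*} [Field k] {H : Type*} [NormedAddCommGroup H] [InnerProductSpace ℂ H]

lemma eq_of_inner_re {x y : H} (hn : ‖x‖ = ‖y‖) (h : ⟪x, y⟫_ℂ = ⟪y, y⟫_ℂ) : x = y := by
  have h1 : ‖x - y‖ ^ 2 = 0 := by
    rw [@norm_sub_sq ℂ, h, hn, inner_self_eq_norm_sq]
    ring
  exact sub_eq_zero.1 (norm_eq_zero.1 (pow_eq_zero_iff (two_ne_zero) |>.1 h1))

variable [CompleteSpace H]

lemma Pr_congr {B B' : Type*} [Group B] [Group B'] {ρ : B →* (H →L[ℂ] H)}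
    {ρ' : B' →* (H →L[ℂ] H)} (h : fixS ρ = fixS ρ') (y : H) : Pr ρ y = Pr ρ' y :=
  eq_Pr (h ▸ Pr_mem ρ' y) fun _ hw => sub_Pr_inner ρ' y (h ▸ hw)

/-- `Pr_comm` for a normalizing element. -/
lemma Pr_normalize {G B : Type*} [Group G] [Group B] {π : G →* (H →L[ℂ] H)}
    (hπ : ∀ g x, ‖π g x‖ = ‖x‖) (j : B →* G) (g : G) (h1 : ∀ b, ∃ b', j b * g = g * j b')
    (h2 : ∀ b, ∃ b', j b * g⁻¹ = g⁻¹ * j b') (y : H) :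
    Pr (π.comp j) (π g y) = π g (Pr (π.comp j) y) := by
  refine Pr_comm (π g) (π g⁻¹) (inner_rep hπ g) (fun x => ?_) ?_ ?_ y
  · rw [← rep_mul, mul_inv_cancel, rep_one]
  · intro x hx b
    obtain ⟨b', hb⟩ := h1 b
    rw [MonoidHom.comp_apply, ← rep_mul, hb, rep_mul]
    exact congrArg _ (hx b')
  · intro x hx b
    obtain ⟨b', hb⟩ := h2 b
    rw [MonoidHom.comp_apply, ← rep_mul, hb, rep_mul]
    exact congrArg _ (hx b')

variable {π : SpecialLinearGroup (Fin 2) k →* (H →L[ℂ] H)}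

lemma P_hh (hπ : ∀ g x, ‖π g x‖ = ‖x‖) (a : kˣ) (y : H) :
    Pr (π.comp uu) (π (hh a) y) = π (hh a) (Pr (π.comp uu) y) := by
  have hi : (hh a)⁻¹ = hh a⁻¹ := by
    rw [inv_eq_iff_mul_eq_one, ← hh_mul, mul_inv_cancel, hh_one]
  refine Pr_normalize hπ uu (hh a) (fun b => ⟨_, hh_uu a b.toAdd⟩) (fun b => ?_) y
  rw [hi]
  exact ⟨_, hh_uu a⁻¹ b.toAdd⟩

/-- The operator `P s P`. -/
noncomputable def XX (π : SpecialLinearGroup (Fin 2) k →* (H →L[ℂ] H)) : H →L[ℂ] H :=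
  Pr (π.comp uu) ∘L π ss ∘L Pr (π.comp uu)

lemma XX_apply (x : H) : XX π x = Pr (π.comp uu) (π ss (Pr (π.comp uu) x)) := rfl

lemma comp_iso {G B : Type*} [Group G] [Group B] {π : G →* (H →L[ℂ] H)}
    (hπ : ∀ g x, ‖π g x‖ = ‖x‖) (j : B →* G) : ∀ g x, ‖(π.comp j) g x‖ = ‖x‖ :=
  fun g x => hπ (j g) x

lemma key_rel (hπ : ∀ g x, ‖π g x‖ = ‖x‖) (a : kˣ) (η : H) :
    Pr (π.comp uu) (π ss (π (uu (Multiplicative.ofAdd (a : k)))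
      (π ss (Pr (π.comp uu) η)))) = π (hh a⁻¹) (XX π η) := by
  rw [← rep_mul, ← rep_mul, ss_uu_ss, rep_mul, rep_mul, rep_mul]
  have h1 := Pr_rep (comp_iso hπ uu) (Multiplicative.ofAdd (-(a⁻¹ : kˣ) : k))
  have h2 := rep_Pr (π.comp uu) (Multiplicative.ofAdd (-(a⁻¹ : kˣ) : k)) η
  rw [MonoidHom.comp_apply] at h1 h2
  rw [h1, h2, P_hh hπ, XX_apply]

lemma Pr_XX (η : H) : Pr (π.comp uu) (XX π η) = XX π η := Pr_Pr _ _

variable [Infinite k]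

lemma X2_hh (hπ : ∀ g x, ‖π g x‖ = ‖x‖) (c : kˣ) (η : H) :
    π (hh c) (XX π (XX π η)) = XX π (XX π η) := by
  let m : Multiplicative k →* Multiplicative k :=
    AddMonoidHom.toMultiplicative (AddMonoidHom.mulLeft (c : k))
  have hm : ∀ b : k, m (Multiplicative.ofAdd b) = Multiplicative.ofAdd (c * b) := fun b => rfl
  have hI : Infinite (Multiplicative k) := inferInstanceAs (Infinite k)
  have hf : fixS ((π.comp uu).comp m) = fixS (π.comp uu) := by
    ext x
    refine ⟨fun h b => ?_, fun h b => h (m b)⟩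
    have := h (Multiplicative.ofAdd ((c⁻¹ : kˣ) * b.toAdd))
    rwa [MonoidHom.comp_apply, hm, ← mul_assoc, Units.mul_inv, one_mul] at this
  have := Pr_pair (comp_iso hπ uu) (comp_iso (comp_iso hπ uu) m) (π ss (Pr (π.comp uu) η))
    (π ss (Pr (π.comp uu) η)) (Pr (π.comp uu) ∘L π ss) (π (hh c) ∘L (Pr (π.comp uu) ∘L π ss)) ?_
  · rw [Pr_congr hf] at this
    rw [XX_apply (XX π η), Pr_XX, XX_apply η]
    exact this.symm
  · intro b hb
    have hb0 : b.toAdd ≠ 0 := fun h => hb h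
    have h1 := key_rel hπ (Units.mk0 _ hb0) η
    have h2 := key_rel hπ (c * Units.mk0 _ hb0) η
    refine h1.trans ((congrArg (π (hh c)) h2).trans ?_).symm
    rw [← rep_mul, ← hh_mul]
    congr 3
    rw [_root_.mul_inv_rev, mul_comm, mul_assoc, inv_mul_cancel, mul_one]

lemma X3 (hπ : ∀ g x, ‖π g x‖ = ‖x‖) (η : H) :
    XX π (XX π (XX π η)) = XX π (XX π η) := by
  have hI : Infinite (Multiplicative k) := inferInstanceAs (Infinite k)
  have := Pr_const (comp_iso hπ uu) (π ss (Pr (π.comp uu) (XX π η))) (Pr (π.comp uu) ∘L π ss)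
    (XX π (XX π η)) ?_
  · rw [XX_apply (XX π (XX π η)), Pr_XX, XX_apply (XX π η)]
    exact this
  · intro b hb
    have hb0 : b.toAdd ≠ 0 := fun h => hb h
    exact (key_rel hπ (Units.mk0 _ hb0) (XX π η)).trans (X2_hh hπ _ η)

lemma X2_fix (hπ : ∀ g x, ‖π g x‖ = ‖x‖) (η : H) : XX π (XX π η) ∈ fixS π := by
  have h1 := X2_hh hπ (η := η)
  have h2 := X3 hπ η
  have h3 : Pr (π.comp uu) (XX π (XX π η)) = XX π (XX π η) := Pr_XX _
  generalize XX π (XX π η) = ζ at *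
  have hs : π ss ζ = ζ := by
    refine eq_of_inner_re (hπ _ _) ?_
    conv_lhs => rw [← h3, ← Pr_symm, h3]
    rw [XX_apply, h3] at h2
    rw [h2]
  have hu : ∀ b, π (uu b) ζ = ζ := fun b => by
    rw [← h3]
    exact rep_Pr (π.comp uu) b ζ
  intro g
  rcases sl2_gen g with ⟨a, b, rfl⟩ | ⟨a, b, c, rfl⟩
  · rw [rep_mul, hu, h1]
  · rw [rep_mul, rep_mul, rep_mul, hu, hs, h1, hu]

lemma X_zero (hπ : ∀ g x, ‖π g x‖ = ‖x‖) (η : H) (hη : ∀ w ∈ fixS π, ⟪η, w⟫_ℂ = 0) :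
    XX π η = 0 := by
  have hX : ∀ x, ∀ w ∈ fixS π, ⟪XX π x, w⟫_ℂ = ⟪x, w⟫_ℂ := by
    intro x w hw
    have hw' : Pr (π.comp uu) w = w := Pr_of_mem fun b => hw (uu b)
    rw [XX_apply, Pr_symm, hw', inner_rep_left hπ, hw, Pr_symm, hw']
  have h0 : XX π (XX π η) = 0 := by
    have h := X2_fix hπ η
    rw [← inner_self_eq_zero (𝕜 := ℂ), hX _ _ h, hX _ _ h, hη _ h]
  rw [← inner_self_eq_zero (𝕜 := ℂ)]
  nth_rw 1 [XX_apply]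
  rw [Pr_symm, Pr_XX, inner_rep_left hπ, ss_inv, rep_mul, Pr_symm, P_hh hπ]
  have : Pr (π.comp uu) (π ss (XX π η)) = XX π (XX π η) := by
    rw [XX_apply (XX π η), Pr_XX]
  rw [this, h0, map_zero, inner_zero_right]

/-- The full statement for all elements of the big cell. -/
lemma X_zero_cell (hπ : ∀ g x, ‖π g x‖ = ‖x‖) (η : H) (hη : ∀ w ∈ fixS π, ⟪η, w⟫_ℂ = 0)
    (b : k) (hb : b ≠ 0) :
    Pr (π.comp uu) (π (ss⁻¹ * uu (Multiplicative.ofAdd b) * ss) (Pr (π.comp uu) η)) = 0 := by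
  have := key_rel hπ (Units.mk0 b hb) η
  rw [X_zero hπ η hη, map_zero] at this
  rw [ss_inv, mul_assoc, mul_assoc, rep_mul, rep_mul, rep_mul, P_hh hπ]
  rw [Units.val_mk0] at this
  rw [this, map_zero]

end SL2rep

end SpChar

namespace SpChar

section StepA

open Matrix

variable {k : Type*} [Field k] [Infinite k] {G H : Type*} [Group G] [NormedAddCommGroup H]
  [InnerProductSpace ℂ H] [CompleteSpace H]

lemma stepA {π : G × G →* (H →L[ℂ] H)} (hπ : ∀ g x, ‖π g x‖ = ‖x‖) (ξ : H)
    (hξ : ∀ g, π (g, g) ξ = ξ) (j : SpecialLinearGroup (Fin 2) k →* G) :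
    Pr ((π.comp (MonoidHom.inl G G)).comp (j.comp uu)) ξ ∈
      fixS ((π.comp (MonoidHom.inl G G)).comp j) := by
  have hI : Infinite (Multiplicative k) := inferInstanceAs (Infinite k)
  set σ := (π.comp (MonoidHom.inl G G)).comp j with hσd
  have hσ : ∀ g x, ‖σ g x‖ = ‖x‖ := fun g x => hπ _ x
  change Pr (σ.comp uu) ξ ∈ fixS σ
  set η := ξ - Pr σ ξ with hη
  have hηo : ∀ w ∈ fixS σ, ⟪η, w⟫_ℂ = 0 := fun w hw => sub_Pr_inner σ ξ hw
  set q := Pr (σ.comp uu) η with hq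
  have hPE : Pr (σ.comp uu) (Pr σ ξ) = Pr σ ξ := Pr_of_mem fun b => rep_Pr σ (uu b) ξ
  have hPq : Pr (σ.comp uu) q = q := Pr_Pr _ _
  have hR : ∀ g y, Pr (σ.comp uu) (π (1, g) y) = π (1, g) (Pr (σ.comp uu) y) := by
    intro g y
    refine Pr_normalize hπ ((MonoidHom.inl G G).comp (j.comp uu)) (1, g) (fun b => ⟨b, ?_⟩)
      (fun b => ⟨b, ?_⟩) y <;> ext <;> simp
  have hz : ⟪ξ, q⟫_ℂ = 0 := by
    refine orth_const (fun a : Multiplicative k => π (j (uu a * ss), j (uu a * ss)) q) ?_ ‖q‖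
      (fun a => hπ _ _) ξ _ ?_
    · intro a b hab
      rw [inner_rep_left hπ, ← rep_mul]
      have hb : (a⁻¹ * b).toAdd ≠ 0 := fun h => hab (inv_mul_eq_one.1 h)
      have h0 := X_zero_cell hσ η hηo _ hb
      set g := j (ss⁻¹ * uu (a⁻¹ * b) * ss) with hg
      have hg' : (j (uu a * ss), j (uu a * ss))⁻¹ * (j (uu b * ss), j (uu b * ss)) =
          (1, g) * (g, 1) := by
        have : (j (uu a * ss))⁻¹ * j (uu b * ss) = g := by
          rw [hg, ← map_inv, ← map_mul]
          congr 1
          rw [map_mul, map_inv]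
          group
        refine Prod.ext ?_ ?_
        · exact this.trans (one_mul g).symm
        · exact this.trans (mul_one g).symm
      rw [hg', rep_mul]
      conv_lhs => rw [← hPq, Pr_symm, hR]
      have h1 : Pr (σ.comp uu) (π (g, 1) q) = 0 := h0
      rw [hPq, h1, map_zero, inner_zero_right]
    · intro a
      have := inner_rep hπ (j (uu a * ss), j (uu a * ss)) ξ q
      rwa [hξ] at this
  have hq0 : q = 0 := by
    rw [← inner_self_eq_zero (𝕜 := ℂ)]
    nth_rw 1 [hq]
    rw [Pr_symm, hPq, hη, inner_sub_left, hz, zero_sub, neg_eq_zero, hq, ← Pr_symm, hPE,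
      ← inner_conj_symm, hηo _ (Pr_mem σ ξ), map_zero]
  have : Pr (σ.comp uu) ξ = Pr σ ξ := by
    rw [hq, hη, map_sub, hPE, sub_eq_zero] at hq0
    exact hq0
  rw [this]
  exact Pr_mem σ ξ

end StepA

end SpChar

namespace SpChar

section Symp

open Matrix

/-- A group acting faithfully on `V` as the full isometry group of a symplectic form. -/
structure SpData (k V G : Type*) [Field k] [AddCommGroup V] [Module k V] [Group G] where
  ω : V →ₗ[k] V →ₗ[k] k
  alt : ∀ x, ω x x = 0
  nd : ∀ x, (∀ y, ω x y = 0) → x = 0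
  act : G →* (V →ₗ[k] V)
  inj : Function.Injective act
  pres : ∀ g x y, ω (act g x) (act g y) = ω x y
  surj : ∀ T : V →ₗ[k] V, (∀ x y, ω (T x) (T y) = ω x y) → ∃ g, act g = T

variable {k V G : Type*} [Field k] [AddCommGroup V] [Module k V] [Group G]

namespace SpData

variable (D : SpData k V G)

lemma anti (x y : V) : D.ω x y = -D.ω y x := by
  have h := D.alt (x + y)
  simp only [map_add, LinearMap.add_apply, D.alt, zero_add, add_zero] at h
  linear_combination h

lemma act_mul (g h : G) (x : V) : D.act (g * h) x = D.act g (D.act h x) := by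
  rw [map_mul]; rfl

lemma act_one (x : V) : D.act 1 x = x := by
  rw [map_one]; rfl

lemma act_inv_act (g : G) (x : V) : D.act g⁻¹ (D.act g x) = x := by
  rw [← act_mul, inv_mul_cancel, act_one]

lemma act_act_inv (g : G) (x : V) : D.act g (D.act g⁻¹ x) = x := by
  rw [← act_mul, mul_inv_cancel, act_one]

lemma ext_act {g h : G} (H : ∀ x, D.act g x = D.act h x) : g = h :=
  D.inj (LinearMap.ext H)

lemma pres_inv (g : G) (x y : V) : D.ω (D.act g⁻¹ x) y = D.ω x (D.act g y) := by
  rw [← D.pres g, act_act_inv]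

lemma exists_ne {v : V} (hv : v ≠ 0) : ∃ w, D.ω v w ≠ 0 := by
  by_contra! h
  exact hv (D.nd v h)

lemma exists_one {v : V} (hv : v ≠ 0) : ∃ w, D.ω v w = 1 := by
  obtain ⟨w, hw⟩ := D.exists_ne hv
  exact ⟨(D.ω v w)⁻¹ • w, by simp [hw]⟩

lemma exists_two {v v' : V} (hv : v ≠ 0) (hv' : v' ≠ 0) : ∃ x, D.ω v x ≠ 0 ∧ D.ω v' x ≠ 0 := by
  obtain ⟨x, hx⟩ := D.exists_ne hv
  obtain ⟨y, hy⟩ := D.exists_ne hv'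
  by_cases h1 : D.ω v' x = 0
  · by_cases h2 : D.ω v y = 0
    · exact ⟨x + y, by simp [h2, hx], by simp [h1, hy]⟩
    · exact ⟨y, h2, hy⟩
  · exact ⟨x, hx, h1⟩

lemma exists_sep {v v' : V} (h : ∀ c : k, v' ≠ c • v) : ∃ x, D.ω v x = 0 ∧ D.ω v' x ≠ 0 := by
  by_cases hv : v = 0
  · subst hv
    obtain ⟨x, hx⟩ := D.exists_ne (v := v') (by simpa using h 0)
    exact ⟨x, by simp, hx⟩
  obtain ⟨w, hw⟩ := D.exists_one hv
  by_contra! H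
  refine h (D.ω v' w) (sub_eq_zero.1 (D.nd _ fun x => ?_))
  have := H (x - D.ω v x • w) (by simp [hw])
  simp only [map_sub, map_smul, smul_eq_mul, LinearMap.sub_apply, LinearMap.smul_apply] at this ⊢
  linear_combination this

/-- The transvection as a linear map. -/
def tvL (v : V) (a : k) : V →ₗ[k] V := LinearMap.id + (a • D.ω v).smulRight v

lemma tvL_apply (v : V) (a : k) (x : V) : D.tvL v a x = x + (a * D.ω v x) • v := by
  simp [tvL]

lemma tvL_pres (v : V) (a : k) (x y : V) : D.ω (D.tvL v a x) (D.tvL v a y) = D.ω x y := by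
  simp only [tvL_apply, map_add, map_smul, LinearMap.add_apply, LinearMap.smul_apply, D.alt,
    smul_eq_mul]
  rw [D.anti x v]
  ring

/-- Transvections. -/
noncomputable def tv (v : V) : Multiplicative k →* G :=
  have key : ∀ a : k, D.act (D.surj (D.tvL v a) (D.tvL_pres v a)).choose = D.tvL v a :=
    fun a => (D.surj (D.tvL v a) (D.tvL_pres v a)).choose_spec
  { toFun := fun a => (D.surj (D.tvL v a.toAdd) (D.tvL_pres v a.toAdd)).choose
    map_one' := by
      refine D.ext_act fun x => ?_
      rw [key, tvL_apply, act_one]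
      simp
    map_mul' := fun a b => by
      refine D.ext_act fun x => ?_
      rw [act_mul, key, key, key, tvL_apply, tvL_apply, tvL_apply]
      simp only [toAdd_mul, map_add, map_smul, D.alt, smul_zero, add_zero]
      module }

lemma tv_act (v : V) (a : Multiplicative k) (x : V) :
    D.act (D.tv v a) x = x + (a.toAdd * D.ω v x) • v := by
  rw [← tvL_apply]
  exact congrArg (fun T : V →ₗ[k] V => T x)
    (D.surj (D.tvL v a.toAdd) (D.tvL_pres v a.toAdd)).choose_spec

/-- The action of a two by two matrix on the plane spanned by `v`, `w`. -/
def jL (v w : V) (A : Matrix (Fin 2) (Fin 2) k) : V →ₗ[k] V :=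
  LinearMap.id + ((A 0 0 - 1) • D.ω.flip w + A 0 1 • D.ω v).smulRight v +
    (A 1 0 • D.ω.flip w + (A 1 1 - 1) • D.ω v).smulRight w

lemma jL_apply (v w : V) (A : Matrix (Fin 2) (Fin 2) k) (x : V) :
    D.jL v w A x = x + ((A 0 0 - 1) * D.ω x w + A 0 1 * D.ω v x) • v +
      (A 1 0 * D.ω x w + (A 1 1 - 1) * D.ω v x) • w := by
  simp [jL]

lemma jL_pres {v w : V} (h : D.ω v w = 1) (A : Matrix (Fin 2) (Fin 2) k) (hA : A.det = 1)
    (x y : V) : D.ω (D.jL v w A x) (D.jL v w A y) = D.ω x y := by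
  rw [det_fin_two] at hA
  simp only [jL_apply, map_add, map_smul, LinearMap.add_apply, LinearMap.smul_apply, D.alt,
    smul_eq_mul]
  rw [D.anti x v, D.anti w v, h, D.anti w y]
  linear_combination (D.ω x w * D.ω v y - D.ω v x * D.ω y w) * hA

/-- The embedding of `SL₂` attached to a hyperbolic pair. -/
noncomputable def jh {v w : V} (h : D.ω v w = 1) : SpecialLinearGroup (Fin 2) k →* G :=
  have key : ∀ A : SpecialLinearGroup (Fin 2) k,
      D.act (D.surj (D.jL v w A.1) (D.jL_pres h A.1 A.2)).choose = D.jL v w A.1 :=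
    fun A => (D.surj (D.jL v w A.1) (D.jL_pres h A.1 A.2)).choose_spec
  { toFun := fun A => (D.surj (D.jL v w A.1) (D.jL_pres h A.1 A.2)).choose
    map_one' := by
      refine D.ext_act fun x => ?_
      rw [key, jL_apply, act_one]
      simp
    map_mul' := fun A B => by
      refine D.ext_act fun x => ?_
      rw [act_mul, key, key, key, sl_mul, jL_apply, jL_apply, jL_apply]
      have hw : D.ω w w = 0 := D.alt w
      have hv : D.ω v v = 0 := D.alt v
      simp only [map_add, map_smul, hw, hv, h, LinearMap.add_apply, LinearMap.smul_apply,
        smul_eq_mul, Matrix.mul_apply, Fin.sum_univ_two]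
      module }

lemma jh_act {v w : V} (h : D.ω v w = 1) (A : SpecialLinearGroup (Fin 2) k) (x : V) :
    D.act (D.jh h A) x = x + ((A.1 0 0 - 1) * D.ω x w + A.1 0 1 * D.ω v x) • v +
      (A.1 1 0 * D.ω x w + (A.1 1 1 - 1) * D.ω v x) • w := by
  rw [← jL_apply]
  exact congrArg (fun T : V →ₗ[k] V => T x)
    (D.surj (D.jL v w A.1) (D.jL_pres h A.1 A.2)).choose_spec

lemma jh_uu {v w : V} (h : D.ω v w = 1) : (D.jh h).comp uu = D.tv v := by
  refine MonoidHom.ext fun a => D.ext_act fun x => ?_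
  rw [MonoidHom.comp_apply, jh_act, tv_act, uu_val]
  simp

lemma jh_lower {v w : V} (h : D.ω v w = 1) (c : k) (a : Multiplicative k) :
    D.tv (c • w) a ∈ (D.jh h).range := by
  have hex : ∃ A : SpecialLinearGroup (Fin 2) k, A.1 = !![1, 0; -(c ^ 2 * a.toAdd), 1] :=
    ⟨⟨!![1, 0; -(c ^ 2 * a.toAdd), 1], by simp [det_fin_two]⟩, rfl⟩
  obtain ⟨A, hA⟩ := hex
  refine ⟨A, D.ext_act fun x => ?_⟩
  rw [jh_act, hA, tv_act, D.anti x w]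
  simp
  module

lemma jh_hh {v w : V} (h : D.ω v w = 1) (m : kˣ) :
    D.act (D.jh h (hh m)) v = (m : k) • v ∧ D.act (D.jh h (hh m)) w = ((m⁻¹ : kˣ) : k) • w := by
  have hw : D.ω w w = 0 := D.alt w
  have hv : D.ω v v = 0 := D.alt v
  rw [jh_act, jh_act, hh_val]
  constructor
  · simp [h, hv]
    module
  · simp [h, hw]
    module

/-- Fixed space. -/
def fx (g : G) : Submodule k V := LinearMap.ker (D.act g - LinearMap.id)

lemma mem_fx {g : G} {x : V} : x ∈ D.fx g ↔ D.act g x = x := by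
  rw [fx, LinearMap.mem_ker, LinearMap.sub_apply, LinearMap.id_apply, sub_eq_zero]

lemma fx_z {g : G} {x v : V} (hx : D.act g x = x) : D.ω (D.act g v - v) x = 0 := by
  rw [map_sub, LinearMap.sub_apply]
  nth_rw 1 [← hx]
  rw [D.pres, sub_self]

lemma generation [FiniteDimensional k V] (K : Subgroup G) (hK : ∀ v a, D.tv v a ∈ K) (g : G) :
    g ∈ K := by
  suffices ∀ (F : Submodule k V) (g : G), D.fx g = F → g ∈ K from this _ g rfl
  intro F
  induction F using WellFoundedGT.induction with
  | ind F ih =>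
  -- the case of a vector moved to a non-orthogonal one
  have caseA : ∀ g : G, F ≤ D.fx g → (∃ v, D.ω v (D.act g v) ≠ 0) → g ∈ K := by
    rintro g hF ⟨v, hv⟩
    set z := D.act g v - v with hz
    have hzv : D.ω z v ≠ 0 := by
      rw [hz, map_sub, LinearMap.sub_apply, D.alt, sub_zero, D.anti]
      exact neg_ne_zero.2 hv
    set u := D.tv z (Multiplicative.ofAdd (D.ω z v)⁻¹) with hu
    have huv : D.act u v = D.act g v := by
      rw [hu, tv_act, toAdd_ofAdd, inv_mul_cancel₀ hzv, one_smul, hz]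
      abel
    have hgv : D.act (u⁻¹ * g) v = v := by
      rw [act_mul, ← huv, act_inv_act]
    have hle : D.fx g ≤ D.fx (u⁻¹ * g) := by
      intro x hx
      rw [mem_fx] at hx ⊢
      have : D.act u x = x := by
        rw [hu, tv_act, D.fx_z hx, mul_zero, zero_smul, add_zero]
      rw [act_mul, hx]
      nth_rw 1 [← this]
      rw [act_inv_act]
    have hlt : F < D.fx (u⁻¹ * g) := by
      refine lt_of_le_of_ne (hF.trans hle) fun h => hv ?_
      have : v ∈ F := by rw [h, mem_fx]; exact hgv
      rw [D.mem_fx.1 (hF this), D.alt]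
    have := K.mul_mem (hK z (Multiplicative.ofAdd (D.ω z v)⁻¹)) (ih _ hlt (u⁻¹ * g) rfl)
    rwa [← hu, mul_inv_cancel_left] at this
  intro g hg
  by_cases hA : ∃ v, D.ω v (D.act g v) ≠ 0
  · exact caseA g hg.ge hA
  push Not at hA
  by_cases hg1 : g = 1
  · rw [hg1]; exact K.one_mem
  have : ∃ v0, D.act g v0 ≠ v0 := by
    by_contra! h
    exact hg1 (D.ext_act fun x => by rw [h, act_one])
  obtain ⟨v0, hv0⟩ := this
  set z := D.act g v0 - v0 with hz
  have hz0 : z ≠ 0 := sub_ne_zero.2 hv0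
  set u := D.tv z (Multiplicative.ofAdd 1) with hu
  have hug : u * g ∈ K := by
    refine caseA _ ?_ ?_
    · rw [← hg]
      intro x hx
      rw [mem_fx] at hx ⊢
      rw [act_mul, hx, hu, tv_act, D.fx_z hx, mul_zero, zero_smul, add_zero]
    · obtain ⟨v, hv⟩ := D.exists_ne hz0
      refine ⟨v, ?_⟩
      have h1 : D.ω v (D.act (u * g) v) = D.ω z v ^ 2 := by
        have e1 := hA (v0 + v)
        have e2 := hA v0
        have e3 := hA v
        have e4 := D.pres g v0 v
        rw [act_mul, hu, tv_act, toAdd_ofAdd, one_mul, map_add, map_smul, hA, zero_add,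
          smul_eq_mul]
        simp only [map_add, LinearMap.add_apply, e2, e3] at e1
        have e5 : D.ω z (D.act g v) = -D.ω z v := by
          rw [hz]
          simp only [map_sub, LinearMap.sub_apply]
          rw [e4, D.anti (D.act g v0) v]
          linear_combination -e1
        rw [e5, D.anti v z]
        ring
      rw [h1]
      exact pow_ne_zero 2 hv
  have := K.mul_mem (K.inv_mem (hK z (Multiplicative.ofAdd 1))) hug
  rwa [← hu, inv_mul_cancel_left] at this

lemma scalar_of {g : G} (h : ∀ v, ∃ c : k, D.act g v = c • v) (hV : ∃ v : V, v ≠ 0) :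
    (∀ v, D.act g v = v) ∨ (∀ v, D.act g v = -v) := by
  -- a linear map preserving all lines is a scalar
  choose c hc using h
  have hc' : ∀ v w, v ≠ 0 → w ≠ 0 → D.ω v w ≠ 0 → c v * c w = 1 := by
    intro v w _ _ h
    have := D.pres g v w
    rw [hc, hc, map_smul, map_smul, LinearMap.smul_apply, smul_eq_mul, smul_eq_mul] at this
    have h2 : (c v * c w - 1) * D.ω v w = 0 := by linear_combination this
    exact sub_eq_zero.1 ((mul_eq_zero.1 h2).resolve_right h)
  have hcc : ∀ v w, v ≠ 0 → w ≠ 0 → c v = c w := by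
    intro v w hv hw
    obtain ⟨x, h1, h2⟩ := D.exists_two hv hw
    have hx : x ≠ 0 := by rintro rfl; simp at h1
    have e1 := hc' v x hv hx h1
    have e2 := hc' w x hw hx h2
    exact mul_right_cancel₀ (right_ne_zero_of_mul_eq_one e1) (e1.trans e2.symm)
  obtain ⟨v0, hv0⟩ := hV
  obtain ⟨w, hw⟩ := D.exists_ne hv0
  have hw0 : w ≠ 0 := by rintro rfl; simp at hw
  have e := hc' v0 w hv0 hw0 hw
  rw [← hcc v0 w hv0 hw0] at e
  rcases mul_self_eq_one_iff.1 e with h | h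
  · left
    intro v
    by_cases hv : v = 0
    · simp [hv]
    rw [hc, hcc v v0 hv hv0, h, one_smul]
  · right
    intro v
    by_cases hv : v = 0
    · simp [hv]
    rw [hc, hcc v v0 hv hv0, h, neg_one_smul]

end SpData

end Symp

end SpChar

namespace SpChar

section Vanish

variable {k V G : Type*} [Field k] [AddCommGroup V] [Module k V] [Group G]
variable {H : Type*} [NormedAddCommGroup H] [InnerProductSpace ℂ H] [CompleteSpace H]

lemma infinite_pow4 [Infinite k] : Infinite {y : k // ∃ m : kˣ, (m : k) ^ 4 = y} := by
  by_contra hfin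
  rw [not_infinite_iff_finite] at hfin
  have hS : {y : k | ∃ m : kˣ, (m : k) ^ 4 = y}.Finite := hfin
  have hS' := hS.insert 0
  have hf : ((fun x : k => x ^ 4) ⁻¹' (insert 0 {y : k | ∃ m : kˣ, (m : k) ^ 4 = y})).Finite := by
    refine hS'.preimage' fun b _ => ?_
    classical
    refine ((Polynomial.nthRoots 4 b).toFinset.finite_toSet).subset fun x hx => ?_
    rw [Finset.mem_coe, Multiset.mem_toFinset, Polynomial.mem_nthRoots (by norm_num)]
    exact hx
  refine Set.infinite_univ (α := k) (hf.subset fun x _ => ?_)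
  by_cases hx : x = 0
  · left
    simp [hx]
  · right
    exact ⟨Units.mk0 x hx, rfl⟩

lemma van1 [Infinite k] (D : SpData k V G) {L : G →* (H →L[ℂ] H)} (hL : ∀ g x, ‖L g x‖ = ‖x‖)
    (ξ : H) (hc : ∀ x g, ⟪ξ, L (g * x * g⁻¹) ξ⟫_ℂ = ⟪ξ, L x ξ⟫_ℂ)
    (hP : ∀ v, v ≠ 0 → Pr (L.comp (D.tv v)) ξ = 0) (g : G) (v : V) (hv : v ≠ 0) (l : k)
    (hg : D.act g v = l • v) (hl : l ^ 2 ≠ 1) : ⟪ξ, L g ξ⟫_ℂ = 0 := by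
  have hI : Infinite (Multiplicative k) := inferInstanceAs (Infinite k)
  have := Pr_const (comp_iso hL (D.tv v)) ξ ((innerSL ℂ ξ) ∘L L g) ⟪ξ, L g ξ⟫_ℂ ?_
  · rw [hP v hv, map_zero] at this
    exact this.symm
  · intro a _
    change ⟪ξ, L g (L (D.tv v a) ξ)⟫_ℂ = _
    rw [← rep_mul]
    have hl' : 1 - l ^ 2 ≠ 0 := sub_ne_zero.2 hl.symm
    set b : k := a.toAdd * l ^ 2 / (1 - l ^ 2) with hb
    have hbe : b = (a.toAdd + b) * l ^ 2 := by
      rw [hb]; field_simp; ring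
    rw [← hc g (D.tv v (Multiplicative.ofAdd b))]
    congr 3
    rw [eq_mul_inv_iff_mul_eq]
    refine D.ext_act fun x => ?_
    rw [D.act_mul, D.act_mul, D.act_mul, D.tv_act, D.tv_act, D.tv_act]
    have h1 := D.pres g v x
    rw [hg, map_smul, LinearMap.smul_apply, smul_eq_mul] at h1
    simp only [map_add, map_smul, D.alt, hg, toAdd_ofAdd, smul_zero, add_zero]
    rw [← h1]
    rw [add_assoc, smul_smul, smul_smul, ← add_smul]
    congr 2
    linear_combination -(D.ω v (D.act g x)) * hbe

lemma van2 {L : G →* (H →L[ℂ] H)} (hL : ∀ g x, ‖L g x‖ = ‖x‖)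
    (ξ : H) (hc : ∀ x g, ⟪ξ, L (g * x * g⁻¹) ξ⟫_ℂ = ⟪ξ, L x ξ⟫_ℂ) (g : G) {ι : Type*} [Infinite ι]
    (x : ι → G)
    (h : ∀ i j, i ≠ j → ⟪ξ, L ((x i * g * (x i)⁻¹)⁻¹ * (x j * g * (x j)⁻¹)) ξ⟫_ℂ = 0) :
    ⟪ξ, L g ξ⟫_ℂ = 0 := by
  refine orth_const (fun i => L (x i * g * (x i)⁻¹) ξ) ?_ ‖ξ‖ (fun i => hL _ _) ξ _
    (fun i => hc g (x i))
  intro i j hij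
  rw [inner_rep_left hL, ← rep_mul]
  exact h i j hij

lemma van3 [Infinite k] (D : SpData k V G) {L : G →* (H →L[ℂ] H)} (hL : ∀ g x, ‖L g x‖ = ‖x‖)
    (ξ : H) (hc : ∀ x g, ⟪ξ, L (g * x * g⁻¹) ξ⟫_ℂ = ⟪ξ, L x ξ⟫_ℂ)
    (hP : ∀ v, v ≠ 0 → Pr (L.comp (D.tv v)) ξ = 0) (g : G) (v : V)
    (hv : D.ω v (D.act g v) ≠ 0) : ⟪ξ, L g ξ⟫_ℂ = 0 := by
  have hI := infinite_pow4 (k := k)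
  have hv0 : v ≠ 0 := by rintro rfl; simp at hv
  have hw : D.ω v ((D.ω v (D.act g v))⁻¹ • D.act g v) = 1 := by simp [hv]
  have hsm : ∀ (c d : k) (x y : V), d * c = 1 → x = c • y → y = d • x := by
    rintro c d x y h rfl
    rw [smul_smul, h, one_smul]
  choose m hm using fun y : {y : k // ∃ m : kˣ, (m : k) ^ 4 = y} => y.2
  have h1 : ∀ n : kˣ, D.act (D.jh hw (hh n)) (D.act g v) = ((n⁻¹ : kˣ) : k) • D.act g v := by
    intro n
    have := (D.jh_hh hw n).2
    rw [map_smul, smul_comm] at this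
    exact smul_right_injective V (inv_ne_zero hv) this
  have h2 : ∀ n : kˣ, D.act (D.jh hw (hh n))⁻¹ v = ((n⁻¹ : kˣ) : k) • v := by
    intro n
    have := congrArg (D.act (D.jh hw (hh n))⁻¹) (D.jh_hh hw n).1
    rw [D.act_inv_act, map_smul] at this
    exact hsm _ _ _ _ (Units.inv_mul n) this
  have h3 : ∀ n : kˣ, D.act (D.jh hw (hh n) * g * (D.jh hw (hh n))⁻¹) v =
      ((n⁻¹ : kˣ) : k) ^ 2 • D.act g v := by
    intro n
    rw [D.act_mul, D.act_mul, h2, map_smul, map_smul, h1, smul_smul, pow_two]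
  refine van2 hL ξ hc g (fun y => D.jh hw (hh (m y))) fun i j hij => ?_
  refine van1 D hL ξ hc hP _ v hv0 (((m j)⁻¹ : kˣ) ^ 2 * (m i : k) ^ 2) ?_ ?_
  · have h4 := congrArg (D.act (D.jh hw (hh (m i)) * g * (D.jh hw (hh (m i)))⁻¹)⁻¹) (h3 (m i))
    rw [D.act_inv_act, map_smul] at h4
    rw [D.act_mul, h3, map_smul]
    rw [hsm _ ((m i : k) ^ 2) _ _ (by rw [← mul_pow, Units.mul_inv, one_pow]) h4, smul_smul]
  · intro h
    apply hij
    apply Subtype.ext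
    rw [← hm i, ← hm j]
    have h0 : ((m j : kˣ) : k) ≠ 0 := (m j).ne_zero
    rw [Units.val_inv_eq_inv_val] at h
    field_simp at h
    linear_combination h

lemma van4 [Infinite k] (D : SpData k V G) {L : G →* (H →L[ℂ] H)} (hL : ∀ g x, ‖L g x‖ = ‖x‖)
    (ξ : H) (hc : ∀ x g, ⟪ξ, L (g * x * g⁻¹) ξ⟫_ℂ = ⟪ξ, L x ξ⟫_ℂ)
    (hP : ∀ v, v ≠ 0 → Pr (L.comp (D.tv v)) ξ = 0) (g : G) (v : V)
    (hv : ∀ c : k, D.act g v ≠ c • v) : ⟪ξ, L g ξ⟫_ℂ = 0 := by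
  have hI : Infinite (Multiplicative k) := inferInstanceAs (Infinite k)
  have hv0 : v ≠ 0 := by rintro rfl; exact hv 0 (by simp)
  obtain ⟨x, hx, hx'⟩ := D.exists_sep (v := v) (v' := D.act g⁻¹ v) (by
    intro c hcv
    have h1 : v = c • D.act g v := by
      rw [← map_smul, ← hcv, D.act_act_inv]
    have hc0 : c ≠ 0 := by
      rintro rfl
      rw [zero_smul] at h1
      exact hv0 h1
    refine hv c⁻¹ ?_
    nth_rw 2 [h1]
    rw [smul_smul, inv_mul_cancel₀ hc0, one_smul])
  refine van2 hL ξ hc g (fun a => D.tv v a) fun a b hab => ?_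
  have hd : (a⁻¹ * b).toAdd ≠ 0 := fun h => hab (inv_mul_eq_one.1 h)
  have he : (D.tv v a * g * (D.tv v a)⁻¹)⁻¹ * (D.tv v b * g * (D.tv v b)⁻¹) =
      D.tv v a * (g⁻¹ * D.tv v (a⁻¹ * b) * g * (D.tv v (a⁻¹ * b))⁻¹) * (D.tv v a)⁻¹ := by
    rw [map_mul, map_inv]
    group
  rw [he, hc]
  refine van3 D hL ξ hc hP _ x ?_
  rw [← map_inv, D.act_mul, D.act_mul, D.act_mul, D.tv_act v _ x, hx, mul_zero, zero_smul,
    add_zero, D.tv_act, map_add, map_smul, D.act_inv_act, map_add, D.alt, zero_add, map_smul,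
    D.anti x, smul_eq_mul, ← D.pres_inv]
  exact mul_ne_zero (mul_ne_zero hd hx') (neg_ne_zero.2 hx')

end Vanish

end SpChar

namespace SpChar

section Main

universe u

variable {k V : Type*} {G : Type u} [Field k] [AddCommGroup V] [Module k V] [Group G]

lemma setup (φ : G → ℂ) (hpos : IsPositiveType φ) (hone : φ 1 = 1)
    (hcentral : ∀ x g : G, φ (g * x * g⁻¹) = φ x) :
    ∃ (H : Type u) (_ : NormedAddCommGroup H) (_ : InnerProductSpace ℂ H) (_ : CompleteSpace H)
      (π : G × G →* (H →L[ℂ] H)) (ξ : H), (∀ g x, ‖π g x‖ = ‖x‖) ∧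
      (∀ g, φ g = ⟪ξ, π (g, 1) ξ⟫_ℂ) ∧ ∀ g, π (g, g) ξ = ξ := by
  have hΦ : IsPositiveType (fun x : G × G => φ (x.1 * x.2⁻¹)) := by
    intro n g c
    have := hpos n (fun i => (g i).1 * (g i).2⁻¹) c
    refine this.trans_eq (Finset.sum_congr rfl fun i _ => Finset.sum_congr rfl fun j _ => ?_)
    congr 1
    refine Eq.trans ?_ (hcentral _ (g i).2)
    congr 1
    simp only [Prod.fst_mul, Prod.snd_mul, Prod.fst_inv, Prod.snd_inv]
    group
  obtain ⟨H, i1, i2, i3, π, ξ, hπ, hφ⟩ := gns _ hΦ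
  refine ⟨H, i1, i2, i3, π, ξ, hπ, fun g => ?_, fun g => ?_⟩
  · rw [← hφ]
    simp
  · refine eq_of_inner_re (hπ _ _) ?_
    have h1 := hφ (g, g)
    have h2 := hφ 1
    rw [rep_one] at h2
    rw [← inner_conj_symm, ← h1, ← h2]
    simp [hone]

lemma exists_p [Infinite k] [FiniteDimensional k V] (D : SpData k V G) (hV : ∃ v : V, v ≠ 0)
    {H : Type*} [NormedAddCommGroup H] [InnerProductSpace ℂ H] [CompleteSpace H]
    {π : G × G →* (H →L[ℂ] H)} (hπ : ∀ g x, ‖π g x‖ = ‖x‖) (ξ : H)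
    (hξ : ∀ g, π (g, g) ξ = ξ) :
    ∃ p ∈ fixS (π.comp (MonoidHom.inl G G)),
      ∀ v, v ≠ 0 → Pr ((π.comp (MonoidHom.inl G G)).comp (D.tv v)) ξ = p := by
  set L := π.comp (MonoidHom.inl G G) with hLdef
  have hfix : ∀ v w, D.ω v w ≠ 0 → Pr (L.comp (D.tv v)) ξ ∈ fixS (L.comp (D.tv w)) := by
    intro v w hvw a
    have h : D.ω v ((D.ω v w)⁻¹ • w) = 1 := by simp [hvw]
    have hA := stepA hπ ξ hξ (D.jh h)
    rw [D.jh_uu] at hA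
    obtain ⟨A, hj⟩ := D.jh_lower h (D.ω v w) a
    rw [smul_inv_smul₀ hvw] at hj
    rw [MonoidHom.comp_apply, ← hj]
    exact hA A
  have hin : ∀ v w, D.ω v w ≠ 0 → ⟪Pr (L.comp (D.tv v)) ξ, Pr (L.comp (D.tv w)) ξ⟫_ℂ =
      ⟪Pr (L.comp (D.tv v)) ξ, Pr (L.comp (D.tv v)) ξ⟫_ℂ := by
    intro v w hvw
    rw [← Pr_symm, Pr_of_mem (hfix v w hvw), ← Pr_symm, Pr_Pr]
  have heq : ∀ v w, D.ω v w ≠ 0 → Pr (L.comp (D.tv v)) ξ = Pr (L.comp (D.tv w)) ξ := by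
    intro v w hvw
    have h1 := hin v w hvw
    have h2 := hin w v (by rw [D.anti]; exact neg_ne_zero.2 hvw)
    rw [← sub_eq_zero, ← inner_self_eq_zero (𝕜 := ℂ), inner_sub_left, inner_sub_right,
      inner_sub_right, h1, h2]
    simp
  have hall : ∀ v w, v ≠ 0 → w ≠ 0 → Pr (L.comp (D.tv v)) ξ = Pr (L.comp (D.tv w)) ξ := by
    intro v w hv hw
    obtain ⟨x, h1, h2⟩ := D.exists_two hv hw
    rw [heq v x h1, heq w x h2]
  obtain ⟨v0, hv0⟩ := hV
  refine ⟨Pr (L.comp (D.tv v0)) ξ, ?_, fun v hv => hall v v0 hv hv0⟩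
  set p := Pr (L.comp (D.tv v0)) ξ with hp
  let K : Subgroup G :=
    { carrier := {g | L g p = p}
      mul_mem' := fun {a b} ha hb => by
        change L (a * b) p = p
        rw [rep_mul, hb, ha]
      one_mem' := rep_one L p
      inv_mem' := fun {a} ha => by
        change L a⁻¹ p = p
        have ha' : L a p = p := ha
        nth_rw 1 [← ha']
        rw [← rep_mul, inv_mul_cancel, rep_one] }
  intro g
  refine D.generation K (fun v a => ?_) g
  change L (D.tv v a) p = p
  by_cases hv : v = 0
  · have : D.tv v a = 1 := D.ext_act fun x => by rw [D.tv_act, D.act_one, hv]; simp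
    rw [this, rep_one]
  · rw [hp, hall v0 v hv0 hv]
    exact rep_Pr (L.comp (D.tv v)) a ξ

theorem main [Infinite k] [FiniteDimensional k V] (D : SpData k V G) (hV : ∃ v : V, v ≠ 0)
    (φ : G → ℂ) (hpos : IsPositiveType φ) (hone : φ 1 = 1)
    (hcentral : ∀ x g : G, φ (g * x * g⁻¹) = φ x) :
    ∃ t : ℝ, t ∈ Set.Icc (0 : ℝ) 1 ∧ ∃ ψ : G → ℂ, IsPositiveType ψ ∧ ψ 1 = 1 ∧
      (∀ g, ¬ (∀ v, D.act g v = v) → ¬ (∀ v, D.act g v = -v) → ψ g = 0) ∧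
      ∀ g, φ g = (t : ℂ) + (1 - (t : ℂ)) * ψ g := by
  obtain ⟨H, i1, i2, i3, π, ξ, hπ, hφ, hξ⟩ := setup φ hpos hone hcentral
  obtain ⟨p, hpf, hp⟩ := exists_p D hV hπ ξ hξ
  set L := π.comp (MonoidHom.inl G G) with hLdef
  have hL : ∀ g x, ‖L g x‖ = ‖x‖ := fun g x => hπ _ x
  have hφL : ∀ g, φ g = ⟪ξ, L g ξ⟫_ℂ := hφ
  obtain ⟨v0, hv0⟩ := hV
  set ξ' := ξ - p with hξ'
  have ho : ⟪ξ', p⟫_ℂ = 0 := by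
    rw [hξ']
    nth_rw 1 [← hp v0 hv0]
    exact sub_Pr_inner _ _ fun b => hpf _
  have ho' : ⟪p, ξ'⟫_ℂ = 0 := by rw [← inner_conj_symm, ho, map_zero]
  have hdec : ∀ g, φ g = ((‖p‖ ^ 2 : ℝ) : ℂ) + ⟪ξ', L g ξ'⟫_ℂ := by
    intro g
    have e : ξ = p + ξ' := by rw [hξ']; abel
    have h1 : ⟪p, L g ξ'⟫_ℂ = 0 := by
      rw [← ho', ← inner_rep hL g p ξ', hpf g]
    rw [hφL, e, map_add, hpf g, inner_add_left, inner_add_right, inner_add_right, ho, h1,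
      inner_self_eq_norm_sq_to_K]
    simp
  have hc : ∀ x g, ⟪ξ', L (g * x * g⁻¹) ξ'⟫_ℂ = ⟪ξ', L x ξ'⟫_ℂ := by
    intro x g
    have := hcentral x g
    rw [hdec, hdec] at this
    exact add_left_cancel this
  have hP : ∀ v, v ≠ 0 → Pr (L.comp (D.tv v)) ξ' = 0 := by
    intro v hv
    have h1 : Pr (L.comp (D.tv v)) p = p := Pr_of_mem (ρ := L.comp (D.tv v)) (fun b => hpf _)
    rw [hξ', map_sub, hp v hv, h1, sub_self]
  have hvan : ∀ g, ¬ (∀ v, D.act g v = v) → ¬ (∀ v, D.act g v = -v) → ⟪ξ', L g ξ'⟫_ℂ = 0 := by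
    intro g h1 h2
    by_cases h : ∃ v, ∀ c : k, D.act g v ≠ c • v
    · obtain ⟨v, hv⟩ := h
      exact van4 D hL ξ' hc hP g v hv
    · push Not at h
      rcases D.scalar_of h ⟨v0, hv0⟩ with h | h
      · exact absurd h h1
      · exact absurd h h2
  have hnorm : ‖p‖ ^ 2 + ‖ξ'‖ ^ 2 = 1 := by
    have := hdec 1
    rw [hone, rep_one, inner_self_eq_norm_sq_to_K, ← RCLike.ofReal_pow] at this
    have h2 : ((1 : ℝ) : ℂ) = ((‖p‖ ^ 2 + ‖ξ'‖ ^ 2 : ℝ) : ℂ) := by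
      rw [Complex.ofReal_add]
      simpa using this
    exact (Complex.ofReal_injective h2).symm
  refine ⟨‖p‖ ^ 2, ⟨by positivity, by nlinarith [sq_nonneg ‖ξ'‖]⟩, ?_⟩
  by_cases hz : ξ' = 0
  · classical
    refine ⟨fun g => if g = 1 then 1 else 0, posType_delta, by simp, ?_, ?_⟩
    · intro g h _
      refine if_neg ?_
      rintro rfl
      exact h fun v => D.act_one v
    · intro g
      have h1 : ‖p‖ ^ 2 = 1 := by
        rw [hz] at hnorm
        simpa using hnorm
      rw [hdec, h1, hz]
      simp
  · have hpos' : 0 < ‖ξ'‖ ^ 2 := by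
      have := norm_pos_iff.2 hz
      positivity
    have hne : ((‖ξ'‖ ^ 2 : ℝ) : ℂ) ≠ 0 := Complex.ofReal_ne_zero.2 hpos'.ne'
    refine ⟨fun g => (((‖ξ'‖ ^ 2)⁻¹ : ℝ) : ℂ) * ⟪ξ', L g ξ'⟫_ℂ,
      posType_of_rep L (inner_rep hL) ξ' _ (inv_nonneg.2 hpos'.le), ?_, ?_, ?_⟩
    · simp only
      rw [rep_one, inner_self_eq_norm_sq_to_K, ← RCLike.ofReal_pow, Complex.ofReal_inv]
      exact inv_mul_cancel₀ hne
    · intro g h1 h2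
      simp only
      rw [hvan g h1 h2, mul_zero]
    · intro g
      have h1 : (1 : ℂ) - ((‖p‖ ^ 2 : ℝ) : ℂ) = ((‖ξ'‖ ^ 2 : ℝ) : ℂ) := by
        rw [← Complex.ofReal_one, ← Complex.ofReal_sub]
        congr 1
        linarith
      simp only
      rw [h1, Complex.ofReal_inv, mul_inv_cancel_left₀ hne]
      exact hdec g

end Main

section Inst

open Matrix

variable {k : Type*} [Field k]

/-- The concrete symplectic group. -/
noncomputable def spInst (n : ℕ) :
    SpData k (Fin n ⊕ Fin n → k) (Matrix.symplecticGroup (Fin n) k) where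
  ω := Matrix.toLinearMap₂' k (J (Fin n) k)
  alt := fun x => by
    rw [Matrix.toLinearMap₂'_apply']
    simp [J, Matrix.fromBlocks_mulVec, dotProduct, Fintype.sum_sum_type, mul_comm,
      Matrix.neg_mulVec]
  nd := fun x h => by
    have h1 : ∀ y, x ⬝ᵥ (J (Fin n) k *ᵥ y) = 0 := fun y => by
      rw [← Matrix.toLinearMap₂'_apply']
      exact h y
    funext i
    have h2 := h1 (-(J (Fin n) k *ᵥ Pi.single i 1))
    rw [mulVec_neg, mulVec_mulVec, J_squared, neg_mulVec, one_mulVec, neg_neg] at h2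
    simpa using h2
  act := (Matrix.toLinAlgEquiv' : Matrix (Fin n ⊕ Fin n) (Fin n ⊕ Fin n) k ≃ₐ[k]
    _).toAlgHom.toRingHom.toMonoidHom.comp (Matrix.symplecticGroup (Fin n) k).subtype
  inj := fun a b h => Subtype.ext (Matrix.toLinAlgEquiv'.injective h)
  pres := fun g x y => by
    have hg := SymplecticGroup.mem_iff'.1 g.2
    rw [Matrix.toLinearMap₂'_apply', Matrix.toLinearMap₂'_apply']
    change (g.1 *ᵥ x) ⬝ᵥ (J (Fin n) k *ᵥ (g.1 *ᵥ y)) = _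
    conv_rhs => rw [← hg]
    rw [← mulVec_mulVec, ← mulVec_mulVec, dotProduct_mulVec x, vecMul_transpose]
  surj := fun T hT => by
    have hA : LinearMap.toMatrix' T ∈ Matrix.symplecticGroup (Fin n) k := by
      rw [SymplecticGroup.mem_iff']
      apply (Matrix.toLinearMap₂' (n := Fin n ⊕ Fin n) (m := Fin n ⊕ Fin n) (N₂ := k)
        (S₁ := k) (S₂ := k) k).injective
      refine LinearMap.ext fun x => LinearMap.ext fun y => ?_
      rw [← hT x y, Matrix.toLinearMap₂'_apply', Matrix.toLinearMap₂'_apply',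
        ← LinearMap.toMatrix'_mulVec, ← LinearMap.toMatrix'_mulVec,
        ← mulVec_mulVec, ← mulVec_mulVec, dotProduct_mulVec, vecMul_transpose]
    exact ⟨⟨_, hA⟩, Matrix.toLin'_toMatrix' T⟩

lemma spInst_act (n : ℕ) (g : Matrix.symplecticGroup (Fin n) k) (x : Fin n ⊕ Fin n → k) :
    (spInst n).act g x = g.1 *ᵥ x := rfl

end Inst

end SpChar

theorem stmt_14 {k : Type*} [Field k] [Infinite k] (n : ℕ) (hn : 1 ≤ n)
    (φ : Matrix.symplecticGroup (Fin n) k → ℂ)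
    (hpos : IsPositiveType φ) (hone : φ 1 = 1)
    (hcentral : ∀ x g : Matrix.symplecticGroup (Fin n) k, φ (g * x * g⁻¹) = φ x) :
    ∃ t : ℝ, t ∈ Set.Icc (0 : ℝ) 1 ∧
      ∃ ψ : Matrix.symplecticGroup (Fin n) k → ℂ,
        IsPositiveType ψ ∧ ψ 1 = 1 ∧
        (∀ g : Matrix.symplecticGroup (Fin n) k,
          (g : Matrix ((Fin n) ⊕ (Fin n)) ((Fin n) ⊕ (Fin n)) k) ≠ 1 →
          (g : Matrix ((Fin n) ⊕ (Fin n)) ((Fin n) ⊕ (Fin n)) k) ≠ -1 → ψ g = 0) ∧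
        ∀ g : Matrix.symplecticGroup (Fin n) k, φ g = (t : ℂ) + (1 - (t : ℂ)) * ψ g := by
  have hV : ∃ v : Fin n ⊕ Fin n → k, v ≠ 0 :=
    ⟨fun _ => 1, fun h => one_ne_zero (congrFun h (Sum.inl ⟨0, hn⟩))⟩
  obtain ⟨t, ht, ψ, h1, h2, h3, h4⟩ :=
    SpChar.main (SpChar.spInst (k := k) n) hV φ hpos hone hcentral
  refine ⟨t, ht, ψ, h1, h2, fun g hg hg' => h3 g (fun h => hg ?_) (fun h => hg' ?_), h4⟩
  · apply Matrix.toLin'.injective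
    refine LinearMap.ext fun x => ?_
    have := h x
    rw [SpChar.spInst_act] at this
    rw [Matrix.toLin'_apply, Matrix.toLin'_apply, Matrix.one_mulVec, this]
  · apply Matrix.toLin'.injective
    refine LinearMap.ext fun x => ?_
    have := h x
    rw [SpChar.spInst_act] at this
    rw [Matrix.toLin'_apply, Matrix.toLin'_apply, Matrix.neg_mulVec, Matrix.one_mulVec, this]
end

section
/- Let k be an infinite field, n ≥ 2, and let χ be a group homomorphism from the center Z of SL_n(k) to the unit circle in ℂ. Let χ̃ : SL_n(k) → ℂ be the trivial extension of χ (equal to χ on Z and 0 outside Z). If χ̃ = t·φ_1 + (1−t)·φ_2 for some t ∈ (0,1) and normalized functions of positive type φ_1, φ_2 on SL_n(k) that are constant on conjugacy classes, then φ_1 = φ_2 = χ̃; that is, χ̃ is an extreme point of the set of traces on SL_n(k). -/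
open scoped ComplexOrder

open scoped ComplexConjugate in
lemma posType_conj {G : Type*} [Group G] {φ : G → ℂ} (h : IsPositiveType φ) (h1 : φ 1 = 1)
    (x : G) : φ x⁻¹ = conj (φ x) := by
  have e1 := h 2 ![1, x] ![1, 1]
  have e2 := h 2 ![1, x] ![1, Complex.I]
  simp [Fin.sum_univ_two, h1] at e1 e2
  rw [Complex.le_def] at e1 e2
  have f1 := e1.2
  have f2 := e2.2
  simp at f1 f2
  apply Complex.ext <;> simp <;> linarith

open scoped ComplexConjugate in
lemma posType_norm {G : Type*} [Group G] {φ : G → ℂ} (h : IsPositiveType φ) (h1 : φ 1 = 1)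
    (x : G) : Complex.normSq (φ x) ≤ 1 := by
  have e1 := h 2 ![1, x] ![-φ x, 1]
  simp [Fin.sum_univ_two, h1, posType_conj h h1] at e1
  rw [Complex.le_def] at e1
  have f1 := e1.1
  simp at f1
  rw [Complex.normSq_apply]
  nlinarith

open scoped ComplexConjugate in
lemma form_cons {G : Type*} [Group G] (φ : G → ℂ) (h1 : φ 1 = 1)
    (N : ℕ) (x : Fin N → G) (a b w : ℂ) (ha : ∀ i, φ (x i) = a) (hb : ∀ i, φ (x i)⁻¹ = b) :
    ∑ i, ∑ j, conj ((Fin.cons w (fun _ => 1) : Fin (N+1) → ℂ) i) *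
      (Fin.cons w (fun _ => 1) : Fin (N+1) → ℂ) j *
        φ (((Fin.cons 1 x : Fin (N+1) → G) i)⁻¹ * (Fin.cons 1 x : Fin (N+1) → G) j) =
    conj w * w + N * (conj w * a + w * b) + ∑ i, ∑ j, φ ((x i)⁻¹ * x j) := by
  simp [Fin.sum_univ_succ, h1, ha, hb, Finset.sum_add_distrib]
  ring

/-- Infinitely many conjugates, distinct modulo the center. -/
lemma exists_conjugates {k : Type*} [Field k] [Infinite k] (n : ℕ)
    (g : Matrix.SpecialLinearGroup (Fin n) k)
    (hg : g ∉ Subgroup.center (Matrix.SpecialLinearGroup (Fin n) k)) :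
    ∃ x : ℕ → Matrix.SpecialLinearGroup (Fin n) k, (∀ m, ∃ u, x m = u * g * u⁻¹) ∧
      ∀ m l, m ≠ l → (x m)⁻¹ * x l ∉ Subgroup.center (Matrix.SpecialLinearGroup (Fin n) k) := by
  classical
  have hfin : Finite (Subgroup.center (Matrix.SpecialLinearGroup (Fin n) k)) := by
    have : NeZero (max (Fintype.card (Fin n)) 1) := ⟨by positivity⟩
    exact Finite.of_equiv _ Matrix.SpecialLinearGroup.center_equiv_rootsOfUnity.symm.toEquiv
  have hnc : ∃ (i j : Fin n) (_ : i ≠ j), ¬ Commute (Matrix.single i j 1) (g : Matrix _ _ k) := by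
    by_contra! hcon
    apply hg
    obtain ⟨r, hr⟩ := Matrix.mem_range_scalar_iff_commute_single.2 hcon
    refine Subgroup.mem_center_iff.2 fun B => Subtype.ext ?_
    have := (Matrix.scalar_commute (n := Fin n) r (Commute.all r) (B : Matrix _ _ k)).eq
    rw [hr] at this
    simpa using this.symm
  obtain ⟨i, j, hij, hc⟩ := hnc
  let u : k → Matrix.SpecialLinearGroup (Fin n) k := fun s =>
    Matrix.SpecialLinearGroup.transvection hij s
  have umul : ∀ s r, u s * u r = u (s + r) := fun s r =>
    Subtype.ext (by simpa [u] using! Matrix.transvection_mul_transvection_same i j hij s r)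
  have u0 : u 0 = 1 := Matrix.SpecialLinearGroup.transvection_coeff_zero hij
  have uinv : ∀ s, (u s)⁻¹ = u (-s) := fun s => by
    rw [inv_eq_iff_mul_eq_one, umul, add_neg_cancel, u0]
  have ucomm : ∀ s, u s * g = g * u s → s = 0 := by
    intro s hs
    by_contra h0
    apply hc
    have h2 : (u s : Matrix (Fin n) (Fin n) k) * (g : Matrix (Fin n) (Fin n) k) = (g : Matrix (Fin n) (Fin n) k) * (u s : Matrix (Fin n) (Fin n) k) := by
      simpa using congrArg Subtype.val hs
    have h3 : (u s : Matrix (Fin n) (Fin n) k) = 1 + s • Matrix.single i j 1 := by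
      simp [u, Matrix.SpecialLinearGroup.transvection_coe]
    rw [h3, add_mul, mul_add, one_mul, mul_one, add_right_inj, smul_mul_assoc,
      mul_smul_comm] at h2
    exact smul_right_injective _ h0 h2
  have hinj : Function.Injective fun s => u s * g * (u s)⁻¹ := by
    intro s r hsr
    have : u (-r + s) * g = g * u (-r + s) := by
      rw [← umul, ← uinv]
      have h4 : u s * g * (u s)⁻¹ = u r * g * (u r)⁻¹ := hsr
      have h5 : u s * g = u r * g * (u r)⁻¹ * u s := by rw [← h4]; group
      rw [mul_assoc, h5]; group
    have := ucomm _ this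
    exact (neg_add_eq_zero.1 this).symm
  let Z := Subgroup.center (Matrix.SpecialLinearGroup (Fin n) k)
  let q : k → Matrix.SpecialLinearGroup (Fin n) k ⧸ Z := fun s =>
    QuotientGroup.mk (u s * g * (u s)⁻¹)
  have hinf : (Set.range q).Infinite := by
    intro hf
    have hpre : ∀ b ∈ Set.range q, (q ⁻¹' {b}).Finite := by
      rintro _ ⟨r, rfl⟩
      have : Set.InjOn (fun s => (u r * g * (u r)⁻¹)⁻¹ * (u s * g * (u s)⁻¹)) (q ⁻¹' {q r}) := by
        intro a _ b _ hab
        exact hinj (mul_left_cancel hab)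
      refine Set.Finite.of_finite_image ((Set.toFinite (Z : Set _)).subset ?_) this
      rintro _ ⟨s, hs, rfl⟩
      exact QuotientGroup.eq.1 (Eq.symm hs)
    have := hf.preimage' hpre
    rw [Set.preimage_range] at this
    exact Set.infinite_univ this
  have := hinf.to_subtype
  let e := Infinite.natEmbedding (Set.range q)
  choose s hs using fun m => (e m).2
  refine ⟨fun m => u (s m) * g * (u (s m))⁻¹, fun m => ⟨_, rfl⟩, fun m l hml hZ => hml ?_⟩
  apply e.injective
  apply Subtype.ext
  rw [← hs m, ← hs l]
  exact QuotientGroup.eq.2 hZ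

open scoped ComplexConjugate in
lemma convex_eq (t : ℝ) (ht : t ∈ Set.Ioo (0 : ℝ) 1) (x y z : ℂ) (hx : Complex.normSq x ≤ 1)
    (hy : Complex.normSq y ≤ 1) (hz : Complex.normSq z = 1)
    (h : z = (t : ℂ) * x + (1 - (t : ℂ)) * y) : x = z ∧ y = z := by
  obtain ⟨h0, h1⟩ := ht
  have key : Complex.normSq z = t * Complex.normSq x + (1 - t) * Complex.normSq y
      - t * (1 - t) * Complex.normSq (x - y) := by
    rw [h]; simp [Complex.normSq_apply]; ring
  have hp : 0 < t * (1 - t) := mul_pos h0 (by linarith)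
  have h3 : t * (1 - t) * Complex.normSq (x - y) ≤ 0 := by nlinarith
  have h4 : Complex.normSq (x - y) = 0 :=
    le_antisymm (nonpos_of_mul_nonpos_right h3 hp) (Complex.normSq_nonneg _)
  have h5 : x = y := sub_eq_zero.1 (Complex.normSq_eq_zero.1 h4)
  subst h5
  have : z = x := by rw [h]; ring
  exact ⟨this.symm, this.symm⟩

theorem stmt_15 {k : Type*} [Field k] [Infinite k] (n : ℕ) (hn : 2 ≤ n)
    (χ : (Subgroup.center (Matrix.SpecialLinearGroup (Fin n) k)) →* Circle)
    -- χext is the trivial extension χ̃ of χ to SL_n(k):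
    (χext : Matrix.SpecialLinearGroup (Fin n) k → ℂ)
    (hext_in : ∀ g (hg : g ∈ Subgroup.center (Matrix.SpecialLinearGroup (Fin n) k)),
      χext g = (χ ⟨g, hg⟩ : ℂ))
    (hext_out : ∀ g ∉ Subgroup.center (Matrix.SpecialLinearGroup (Fin n) k), χext g = 0)
    (t : ℝ) (ht : t ∈ Set.Ioo (0 : ℝ) 1)
    (φ₁ φ₂ : Matrix.SpecialLinearGroup (Fin n) k → ℂ)
    (hpos₁ : IsPositiveType φ₁) (hone₁ : φ₁ 1 = 1)
    (hcentral₁ : ∀ x g : Matrix.SpecialLinearGroup (Fin n) k, φ₁ (g * x * g⁻¹) = φ₁ x)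
    (hpos₂ : IsPositiveType φ₂) (hone₂ : φ₂ 1 = 1)
    (hcentral₂ : ∀ x g : Matrix.SpecialLinearGroup (Fin n) k, φ₂ (g * x * g⁻¹) = φ₂ x)
    (hcomb : ∀ g : Matrix.SpecialLinearGroup (Fin n) k,
      χext g = (t : ℂ) * φ₁ g + (1 - (t : ℂ)) * φ₂ g) :
    φ₁ = χext ∧ φ₂ = χext := by
  have hout : ∀ g ∉ Subgroup.center (Matrix.SpecialLinearGroup (Fin n) k),
      φ₁ g = 0 ∧ φ₂ g = 0 := by
    intro g hg
    have hsum : (t : ℂ) * φ₁ g + (1 - (t : ℂ)) * φ₂ g = 0 := by rw [← hcomb, hext_out g hg]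
    have ht0 : (t : ℂ) ≠ 0 := by exact_mod_cast ht.1.ne'
    have ht1 : (1 - (t : ℂ)) ≠ 0 := by
      have : (1 - t : ℝ) ≠ 0 := (sub_pos.2 ht.2).ne'
      exact_mod_cast this
    suffices h : φ₁ g = 0 by
      refine ⟨h, ?_⟩
      rw [h, mul_zero, zero_add] at hsum
      exact (mul_eq_zero.1 hsum).resolve_left ht1
    obtain ⟨x, hxc, hxd⟩ := exists_conjugates n g hg
    set a := φ₁ g with ha
    set b := φ₂ g with hb
    have hx1 : ∀ m, φ₁ (x m) = a := fun m => by
      obtain ⟨u, hu⟩ := hxc m; rw [hu, hcentral₁]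
    have hx2 : ∀ m, φ₂ (x m) = b := fun m => by
      obtain ⟨u, hu⟩ := hxc m; rw [hu, hcentral₂]
    have key : ∀ m : ℕ, 0 < m →
        2 * t * m * Complex.normSq a ≤ Complex.normSq a + 1 := by
      intro m hm
      let N := m ^ 2
      let w : ℂ := m * a
      let y : Fin N → Matrix.SpecialLinearGroup (Fin n) k := fun i => x i
      have p2 := hpos₂ (N + 1) (Fin.cons 1 y) (Fin.cons w (fun _ => 1))
      have p1 := hpos₁ N y (fun _ => 1)
      rw [form_cons φ₂ hone₂ N y b _ w (fun i => hx2 i)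
        (fun i => by rw [posType_conj hpos₂ hone₂, hx2 i])] at p2
      simp only [map_one, one_mul] at p1
      have hB : (t : ℂ) * ∑ i, ∑ j, φ₁ ((y i)⁻¹ * y j)
          + (1 - (t : ℂ)) * ∑ i, ∑ j, φ₂ ((y i)⁻¹ * y j) = N := by
        have h1 : ∀ i j : Fin N, (t : ℂ) * φ₁ ((y i)⁻¹ * y j) + (1 - (t : ℂ)) * φ₂ ((y i)⁻¹ * y j)
            = if i = j then 1 else 0 := by
          intro i j
          split_ifs with hij
          · subst hij; simp [hone₁, hone₂]
          · rw [← hcomb]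
            exact hext_out _ (hxd _ _ (fun h => hij (Fin.ext h)))
        simp only [Finset.mul_sum, ← Finset.sum_add_distrib, h1]
        simp
      generalize (∑ i, ∑ j, φ₁ ((y i)⁻¹ * y j)) = B1 at *
      generalize (∑ i, ∑ j, φ₂ ((y i)⁻¹ * y j)) = B2 at *
      have q2 := (Complex.le_def.1 p2).1
      have q1 := (Complex.le_def.1 p1).1
      have rB := congrArg Complex.re hB
      have r1 := congrArg Complex.re hsum
      have r2 := congrArg Complex.im hsum
      have hNc : ((N : ℕ) : ℂ) = ((m ^ 2 : ℝ) : ℂ) := by simp [N]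
      have hwc : w = ((m : ℝ) : ℂ) * a := by simp [w]
      rw [hNc] at q2 rB
      rw [hwc] at q2
      simp only [Complex.add_re, Complex.mul_re, Complex.mul_im, Complex.add_im, Complex.sub_re,
        Complex.sub_im, Complex.ofReal_re, Complex.ofReal_im, Complex.one_re, Complex.one_im,
        Complex.zero_re, Complex.zero_im, Complex.conj_re, Complex.conj_im] at q1 q2 rB r1 r2
      ring_nf at r1 r2 rB
      rw [Complex.normSq_apply]
      have hm' : (0 : ℝ) < m := by exact_mod_cast hm
      have ht2 : 0 < 1 - t := by linarith [ht.2]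
      have s1 : 0 ≤ t * B1.re := mul_nonneg ht.1.le q1
      have s2 := mul_nonneg ht2.le q2
      have hfin : 0 ≤ (m:ℝ)^2 * (a.re * a.re + a.im * a.im + 1
          - 2 * t * m * (a.re * a.re + a.im * a.im)) := by
        have e1 : (1 - t) * b.re = - t * a.re := by linarith
        have e2 : (1 - t) * b.im = - t * a.im := by linarith
        have : 0 ≤ (1-t) * (m:ℝ)^2 * (a.re * a.re + a.im * a.im)
          + 2 * m^3 * (a.re * ((1 - t) * b.re) + a.im * ((1 - t) * b.im)) + (1 - t) * B2.re := by
          refine s2.trans_eq ?_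
          ring
        rw [e1, e2] at this
        have s3 : 0 ≤ t * ((m:ℝ)^2 * (a.re * a.re + a.im * a.im)) :=
          mul_nonneg ht.1.le (mul_nonneg (sq_nonneg _)
            (add_nonneg (mul_self_nonneg _) (mul_self_nonneg _)))
        nlinarith
      have := nonneg_of_mul_nonneg_right hfin (by positivity)
      linarith
    by_contra ha0
    have hA : 0 < Complex.normSq a := Complex.normSq_pos.2 ha0
    have hd : 0 < 2 * t * Complex.normSq a := mul_pos (by linarith [ht.1]) hA
    obtain ⟨m, hm⟩ := exists_nat_gt ((Complex.normSq a + 1) / (2 * t * Complex.normSq a))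
    have hm0 : 0 < m := by
      have : (0 : ℝ) < m := lt_of_le_of_lt (by positivity) hm
      exact_mod_cast this
    rw [div_lt_iff₀ hd] at hm
    linarith [key m hm0]
  have hall : ∀ g, φ₁ g = χext g ∧ φ₂ g = χext g := by
    intro g
    by_cases hg : g ∈ Subgroup.center (Matrix.SpecialLinearGroup (Fin n) k)
    · refine convex_eq t ht _ _ _ (posType_norm hpos₁ hone₁ g) (posType_norm hpos₂ hone₂ g) ?_
        (hcomb g)
      rw [hext_in g hg]; simp
    · rw [hext_out g hg]; exact hout g hg
  exact ⟨funext fun g => (hall g).1, funext fun g => (hall g).2⟩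
end
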